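/- Let P be a d-dimensional polytope with exactly d+4 vertices and at least d+4 facets. Then xc(P) = d+3 if and only if either (1) P is a (d−2)-fold pyramid over a Desarguian hexagon, or (2) some 6 vertices of P have convex hull combinatorially equivalent to the triangular prism Δ_1 × Δ_2. -/

import Mathlib

open Set

noncomputable section

/-- A polytope: the convex hull of a finite set of points. -/
def IsPolytope {N : ℕ} (P : Set (Fin N → ℝ)) : Prop :=
  ∃ S : Finset (Fin N → ℝ), P = convexHull ℝ (S : Set (Fin N → ℝ))

/-- Dimension of a set: the dimension of its affine hull (with `-1` for the empty set). -/
def pdim {N : ℕ} (P : Set (Fin N → ℝ)) : ℤ :=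
  haveI := Classical.dec P.Nonempty
  if P.Nonempty then (Module.finrank ℝ (affineSpan ℝ P).direction : ℤ) else -1

/-- `F` is a face of `P`: the subset of `P` where some linear functional bounded above on `P`
attains its maximum value.  This includes `∅` and `P` itself. -/
def IsFaceOf {N : ℕ} (F P : Set (Fin N → ℝ)) : Prop :=
  ∃ (c : Fin N → ℝ) (b : ℝ),
    (∀ x ∈ P, ∑ i, c i * x i ≤ b) ∧ F = {x ∈ P | ∑ i, c i * x i = b}

/-- A facet: a face of dimension one less than the polytope. -/
def IsFacetOf {N : ℕ} (F P : Set (Fin N → ℝ)) : Prop :=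
  IsFaceOf F P ∧ pdim F + 1 = pdim P

/-- A ridge: a face of dimension two less than the polytope. -/
def IsRidgeOf {N : ℕ} (F P : Set (Fin N → ℝ)) : Prop :=
  IsFaceOf F P ∧ pdim F + 2 = pdim P

def IsVertexOf {N : ℕ} (v : Fin N → ℝ) (P : Set (Fin N → ℝ)) : Prop :=
  IsFaceOf {v} P

def vertexSet {N : ℕ} (P : Set (Fin N → ℝ)) : Set (Fin N → ℝ) :=
  {v | IsVertexOf v P}

def vertexCount {N : ℕ} (P : Set (Fin N → ℝ)) : ℕ := (vertexSet P).ncard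

def facetCount {N : ℕ} (P : Set (Fin N → ℝ)) : ℕ := {F | IsFacetOf F P}.ncard

/-- Extension complexity: the minimal number of facets of a polytope (in any dimension)
admitting an affine projection onto `P`. -/
def xc {N : ℕ} (P : Set (Fin N → ℝ)) : ℕ :=
  sInf {n | ∃ (e : ℕ) (Q : Set (Fin e → ℝ)) (π : (Fin e → ℝ) →ᵃ[ℝ] (Fin N → ℝ)),
    IsPolytope Q ∧ π '' Q = P ∧ facetCount Q = n}

/-- Combinatorial equivalence: an inclusion-preserving bijection between face lattices. -/
def CombEquiv {M N : ℕ} (P : Set (Fin M → ℝ)) (Q : Set (Fin N → ℝ)) : Prop :=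
  ∃ φ : {F : Set (Fin M → ℝ) // IsFaceOf F P} ≃ {G : Set (Fin N → ℝ) // IsFaceOf G Q},
    ∀ F₁ F₂ : {F : Set (Fin M → ℝ) // IsFaceOf F P},
      F₁.1 ⊆ F₂.1 ↔ (φ F₁).1 ⊆ (φ F₂).1

/-- A full-dimensional `n`-simplex in `ℝ^n` with the origin in its (relative) interior. -/
def simplexF (n : ℕ) : Set (Fin n → ℝ) :=
  convexHull ℝ ((Set.range fun i : Fin n => Pi.single i (1 : ℝ)) ∪ {fun _ => -1})

/-- The Cartesian product `Δ_n × Δ_m`, realized in `ℝ^{n+m}`. -/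
def prodP (n m : ℕ) : Set (Fin (n + m) → ℝ) :=
  {z | ∃ a ∈ simplexF n, ∃ b ∈ simplexF m, z = Fin.append a b}

/-- The direct sum `Δ_n ⊕ Δ_m`, realized in `ℝ^{n+m}`. -/
def sumP (n m : ℕ) : Set (Fin (n + m) → ℝ) :=
  convexHull ℝ (((fun a : Fin n → ℝ => Fin.append a (0 : Fin m → ℝ)) '' simplexF n) ∪
    ((fun b : Fin m → ℝ => Fin.append (0 : Fin n → ℝ) b) '' simplexF m))

/-- The join `A ⋆ B` of two polytopes, realized in `ℝ^{p+q+1}` with the two copies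
placed in skew affine subspaces. -/
def joinP {p q : ℕ} (A : Set (Fin p → ℝ)) (B : Set (Fin q → ℝ)) :
    Set (Fin (p + q + 1) → ℝ) :=
  convexHull ℝ
    (((fun a : Fin p → ℝ =>
        Fin.append (Fin.append a (0 : Fin q → ℝ)) (fun _ : Fin 1 => (0 : ℝ))) '' A) ∪
     ((fun b : Fin q → ℝ =>
        Fin.append (Fin.append (0 : Fin p → ℝ) b) (fun _ : Fin 1 => (1 : ℝ))) '' B))

/-- The canonical `k`-fold iterated pyramid over `X`, realized in `ℝ^{p+k}`. -/
def pyrK {p : ℕ} (k : ℕ) (X : Set (Fin p → ℝ)) : Set (Fin (p + k) → ℝ) :=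
  convexHull ℝ (((fun x : Fin p → ℝ => Fin.append x (0 : Fin k → ℝ)) '' X) ∪
    Set.range (fun j : Fin k => Fin.append (0 : Fin p → ℝ) (Pi.single j (1 : ℝ))))

/-- Transport a subset of `ℝ^a` to `ℝ^b` along a proof that `a = b`. -/
def castSet {a b : ℕ} (h : a = b) (X : Set (Fin a → ℝ)) : Set (Fin b → ℝ) :=
  (fun x : Fin a → ℝ => fun i : Fin b => x (Fin.cast h.symm i)) '' X

/-- Projective equivalence of two subsets of `ℝ^N`: `Q` is the image of `P` under a
projective transformation `x ↦ (A x + b) / (⟨c, x⟩ + δ)` whose associated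
`(N+1) × (N+1)` matrix is invertible and whose denominator is positive on `P`. -/
def ProjEquiv {N : ℕ} (P Q : Set (Fin N → ℝ)) : Prop :=
  ∃ (A : (Fin N → ℝ) →ₗ[ℝ] (Fin N → ℝ)) (b c : Fin N → ℝ) (δ : ℝ),
    Function.Bijective
      (fun z : (Fin N → ℝ) × ℝ => (A z.1 + z.2 • b, (∑ i, c i * z.1 i) + δ * z.2)) ∧
    (∀ x ∈ P, 0 < (∑ i, c i * x i) + δ) ∧
    Q = (fun x : Fin N → ℝ => ((∑ i, c i * x i) + δ)⁻¹ • (A x + b)) '' P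

/-- `P` is a pyramid with base `B`: the convex hull of `B` and a point outside
the affine hull of `B`. -/
def IsPyramidOver {N : ℕ} (P B : Set (Fin N → ℝ)) : Prop :=
  ∃ a : Fin N → ℝ, a ∉ affineSpan ℝ B ∧ P = convexHull ℝ (B ∪ {a})

/-- `P` is a `k`-fold iterated pyramid over `B`. -/
def IsKFoldPyramidOver {N : ℕ} : ℕ → Set (Fin N → ℝ) → Set (Fin N → ℝ) → Prop
  | 0, P, B => P = B
  | k + 1, P, B => ∃ P' : Set (Fin N → ℝ), IsPyramidOver P P' ∧ IsKFoldPyramidOver k P' B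

/-- `P` is a pyramid: the convex hull of one of its facets together with one more vertex. -/
def IsPyramidPolytope {N : ℕ} (P : Set (Fin N → ℝ)) : Prop :=
  ∃ (F : Set (Fin N → ℝ)) (v : Fin N → ℝ),
    IsFacetOf F P ∧ IsVertexOf v P ∧ P = convexHull ℝ (F ∪ {v})

/-- A facet is pyramidal if it contains all vertices of the polytope but one. -/
def IsPyramidalFacet {N : ℕ} (F P : Set (Fin N → ℝ)) : Prop :=
  IsFacetOf F P ∧ ∃ v, IsVertexOf v P ∧ v ∉ F ∧ ∀ w, IsVertexOf w P → w ≠ v → w ∈ F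

/-- The projection `π_d : ℝ^{d+1} → ℝ^d` forgetting the last coordinate. -/
def projFun (d : ℕ) : (Fin (d + 1) → ℝ) → (Fin d → ℝ) :=
  fun x i => x i.castSucc

/-- `c` is an outer normal vector exposing the face `F` of `Q`. -/
def IsOuterNormal {N : ℕ} (Q F : Set (Fin N → ℝ)) (c : Fin N → ℝ) : Prop :=
  ∃ b : ℝ, (∀ x ∈ Q, ∑ i, c i * x i ≤ b) ∧ F = {x ∈ Q | ∑ i, c i * x i = b}

/-- An upper facet: outer normal with positive last coordinate. -/
def IsUpperFacet {d : ℕ} (F Q : Set (Fin (d + 1) → ℝ)) : Prop :=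
  IsFacetOf F Q ∧ ∃ c, IsOuterNormal Q F c ∧ 0 < c (Fin.last d)

/-- A lower facet: outer normal with negative last coordinate. -/
def IsLowerFacet {d : ℕ} (F Q : Set (Fin (d + 1) → ℝ)) : Prop :=
  IsFacetOf F Q ∧ ∃ c, IsOuterNormal Q F c ∧ c (Fin.last d) < 0

/-- A vertical facet: every outer normal has vanishing last coordinate. -/
def IsVerticalFacet {d : ℕ} (F Q : Set (Fin (d + 1) → ℝ)) : Prop :=
  IsFacetOf F Q ∧ ∀ c, IsOuterNormal Q F c → c (Fin.last d) = 0

/-- An equatorial ridge: a ridge that is the intersection of an upper and a lower facet. -/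
def IsEquatorialRidge {d : ℕ} (F Q : Set (Fin (d + 1) → ℝ)) : Prop :=
  IsRidgeOf F Q ∧ ∃ F₁ F₂ : Set (Fin (d + 1) → ℝ),
    IsUpperFacet F₁ Q ∧ IsLowerFacet F₂ Q ∧ F = F₁ ∩ F₂

/-- A face `F` of `Q` is preserved under the projection forgetting the last coordinate. -/
def PreservedFace {d : ℕ} (Q F : Set (Fin (d + 1) → ℝ)) : Prop :=
  IsFaceOf (projFun d '' F) (projFun d '' Q) ∧ projFun d ⁻¹' (projFun d '' F) ∩ Q = F

/-- A face `F` of `Q` is strictly preserved: preserved and of the same dimension as its image. -/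
def StrictlyPreservedFace {d : ℕ} (Q F : Set (Fin (d + 1) → ℝ)) : Prop :=
  PreservedFace Q F ∧ pdim (projFun d '' F) = pdim F

/-- A hexagon: a 2-dimensional polytope with exactly 6 vertices. -/
def IsHexagon {N : ℕ} (P : Set (Fin N → ℝ)) : Prop :=
  IsPolytope P ∧ pdim P = 2 ∧ vertexCount P = 6

/-- Three lines are concurrent: they share a common point, or they are pairwise parallel. -/
def ConcurrentLines {N : ℕ} (L₁ L₂ L₃ : AffineSubspace ℝ (Fin N → ℝ)) : Prop :=
  (∃ x, x ∈ L₁ ∧ x ∈ L₂ ∧ x ∈ L₃) ∨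
    (AffineSubspace.Parallel L₁ L₂ ∧ AffineSubspace.Parallel L₂ L₃ ∧
      AffineSubspace.Parallel L₁ L₃)

/-- A cyclic labeling of the vertices of a hexagon: consecutive points are joined by edges. -/
def CyclicLabeling {N : ℕ} (P : Set (Fin N → ℝ)) (p : Fin 6 → (Fin N → ℝ)) : Prop :=
  Function.Injective p ∧ Set.range p = vertexSet P ∧
    ∀ i : Fin 6, IsFaceOf (segment ℝ (p i) (p (i + 1))) P

/-- A Desarguian hexagon. -/
def Desarguian {N : ℕ} (P : Set (Fin N → ℝ)) : Prop :=
  ∃ p : Fin 6 → (Fin N → ℝ), CyclicLabeling P p ∧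
    ConcurrentLines (affineSpan ℝ {p 0, p 1}) (affineSpan ℝ {p 5, p 2})
      (affineSpan ℝ {p 3, p 4})

/-- A polytope is simplicial if every facet is a simplex. -/
def IsSimplicial {N : ℕ} (P : Set (Fin N → ℝ)) : Prop :=
  ∀ F : Set (Fin N → ℝ), IsFacetOf F P →
    ∃ S : Finset (Fin N → ℝ),
      AffineIndependent ℝ (Subtype.val : {x // x ∈ S} → (Fin N → ℝ)) ∧
      F = convexHull ℝ (S : Set (Fin N → ℝ))

/-! ### Homogenization -/

/-- The homogenization `(x, 1)` of a point. -/
def hom {N : ℕ} (x : Fin N → ℝ) : (Fin N → ℝ) × ℝ := (x, 1)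

theorem isFaceOf_iff {N : ℕ} {F P : Set (Fin N → ℝ)} :
    IsFaceOf F P ↔ ∃ ψ : (Fin N → ℝ) × ℝ →ₗ[ℝ] ℝ,
      (∀ x ∈ P, 0 ≤ ψ (hom x)) ∧ F = {x ∈ P | ψ (hom x) = 0} := by
  constructor
  · rintro ⟨c, b, hc, rfl⟩
    refine ⟨b • LinearMap.snd ℝ _ _ -
      (∑ i, c i • LinearMap.proj i) ∘ₗ LinearMap.fst ℝ (Fin N → ℝ) ℝ, fun x hx => ?_, ?_⟩
    · simpa [hom] using hc x hx
    · ext x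
      simp only [mem_ofPred_eq, and_congr_right_iff]
      intro _
      simp only [hom, LinearMap.sub_apply, LinearMap.smul_apply, LinearMap.snd_apply, smul_eq_mul,
        mul_one, LinearMap.comp_apply, LinearMap.fst_apply, LinearMap.sum_apply, LinearMap.proj_apply]
      rw [sub_eq_zero, eq_comm]
  · rintro ⟨ψ, hψ, rfl⟩
    have key : ∀ x : Fin N → ℝ,
        ψ (hom x) = (∑ i, ψ (Pi.single i 1, 0) * x i) + ψ (0, 1) := by
      intro x
      have h1 : hom x = (∑ i, x i • ((Pi.single i 1, 0) : (Fin N → ℝ) × ℝ)) + (0, 1) := by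
        ext j
        · simp [hom, Prod.fst_sum, Finset.sum_apply, Pi.single_apply]
        · simp [hom, Prod.snd_sum]
      rw [h1, map_add, map_sum]
      simp only [map_smul, smul_eq_mul, mul_comm]
    refine ⟨fun i => - ψ (Pi.single i 1, 0), ψ (0, 1), fun x hx => ?_, ?_⟩
    · have := hψ x hx
      rw [key] at this
      simp only [neg_mul, Finset.sum_neg_distrib]
      linarith
    · ext x
      simp only [mem_ofPred_eq, key, neg_mul, Finset.sum_neg_distrib]
      constructor
      · rintro ⟨h1, h2⟩
        exact ⟨h1, by linarith⟩
      · rintro ⟨h1, h2⟩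
        exact ⟨h1, by linarith⟩

theorem pdim_add_one {N : ℕ} (X : Set (Fin N → ℝ)) :
    pdim X + 1 = Module.finrank ℝ (Submodule.span ℝ (hom '' X)) := by
  classical
  rcases X.eq_empty_or_nonempty with rfl | ⟨x₀, hx₀⟩
  · rw [image_empty, Submodule.span_empty, finrank_bot]
    simp [pdim]
  have hne : X.Nonempty := ⟨x₀, hx₀⟩
  rw [pdim, if_pos hne, direction_affineSpan]
  set U := Submodule.span ℝ (hom '' X) with hU
  let f : U →ₗ[ℝ] ℝ := LinearMap.snd ℝ _ _ ∘ₗ U.subtype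
  have hx₀U : hom x₀ ∈ U := Submodule.subset_span ⟨x₀, hx₀, rfl⟩
  have hf : Function.Surjective f := fun r => ⟨r • ⟨hom x₀, hx₀U⟩, by simp [f, hom]⟩
  have hrange : Module.finrank ℝ (LinearMap.range f) = 1 := by
    rw [LinearMap.range_eq_top.2 hf, finrank_top, Module.finrank_self]
  have hsum := LinearMap.finrank_range_add_finrank_ker f
  have hker : Module.finrank ℝ (LinearMap.ker f) = Module.finrank ℝ (vectorSpan ℝ X) := by
    let g : vectorSpan ℝ X →ₗ[ℝ] (Fin N → ℝ) × ℝ :=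
      LinearMap.inl ℝ _ _ ∘ₗ (vectorSpan ℝ X).subtype
    have hg : Function.Injective g :=
      (LinearMap.inl_injective).comp (Submodule.injective_subtype _)
    rw [← LinearMap.finrank_range_of_inj hg,
      ← LinearMap.finrank_range_of_inj (f := U.subtype ∘ₗ (LinearMap.ker f).subtype)
        ((Submodule.injective_subtype _).comp (Submodule.injective_subtype _))]
    suffices h : LinearMap.range (U.subtype ∘ₗ (LinearMap.ker f).subtype) = LinearMap.range g by
      rw [h]
    apply le_antisymm
    · rintro _ ⟨⟨⟨z, hz⟩, hz0⟩, rfl⟩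
      have hz0' : z.2 = 0 := hz0
      have : ∀ z ∈ U, z.1 - z.2 • x₀ ∈ vectorSpan ℝ X := by
        intro z hz
        have : U ≤ (vectorSpan ℝ X).comap
            (LinearMap.fst ℝ (Fin N → ℝ) ℝ - (LinearMap.snd ℝ (Fin N → ℝ) ℝ).smulRight x₀) := by
          rw [hU, Submodule.span_le]
          rintro _ ⟨x, hx, rfl⟩
          simpa [hom] using vsub_mem_vectorSpan ℝ hx hx₀
        simpa using this hz
      refine ⟨⟨z.1, by simpa [hz0'] using this z hz⟩, ?_⟩
      ext <;> simp [g, hz0']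
    · rintro _ ⟨⟨v, hv⟩, rfl⟩
      have : (v, (0 : ℝ)) ∈ U := by
        have h : vectorSpan ℝ X ≤ U.comap (LinearMap.inl ℝ (Fin N → ℝ) ℝ) := by
          rw [vectorSpan_def, Submodule.span_le]
          rintro _ ⟨x, hx, y, hy, rfl⟩
          have := U.sub_mem (Submodule.subset_span ⟨x, hx, rfl⟩)
            (Submodule.subset_span ⟨y, hy, rfl⟩)
          simpa [hom] using this
        exact h hv
      exact ⟨⟨⟨_, this⟩, by simp [f]⟩, rfl⟩
  rw [hrange, hker] at hsum
  omega

theorem hom_mem_span_of_mem_affineSpan {N : ℕ} {X : Set (Fin N → ℝ)} {a : Fin N → ℝ}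
    (ha : a ∈ affineSpan ℝ X) : hom a ∈ Submodule.span ℝ (hom '' X) := by
  refine affineSpan_induction (p := fun a => hom a ∈ Submodule.span ℝ (hom '' X)) ha
    (fun x hx => Submodule.subset_span ⟨x, hx, rfl⟩) fun c u v w hu hv hw => ?_
  have : hom (c • (u -ᵥ v) +ᵥ w) = c • (hom u - hom v) + hom w := by
    ext <;> simp [hom]
  rw [this]
  exact Submodule.add_mem _ (Submodule.smul_mem _ _ (Submodule.sub_mem _ hu hv)) hw

/-- A functional vanishing on the kernel of `f` inside `L` descends along `f`. -/
theorem exists_descent {V W : Type*} [AddCommGroup V] [Module ℝ V] [AddCommGroup W] [Module ℝ W]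
    (L : Submodule ℝ V) (f : V →ₗ[ℝ] W) (φ : V →ₗ[ℝ] ℝ)
    (h : ∀ y ∈ L, f y = 0 → φ y = 0) : ∃ ψ : W →ₗ[ℝ] ℝ, ∀ y ∈ L, ψ (f y) = φ y := by
  have hmem : φ ∘ₗ L.subtype ∈ (LinearMap.ker (f ∘ₗ L.subtype)).dualAnnihilator := by
    rw [Submodule.mem_dualAnnihilator]
    rintro ⟨y, hy⟩ hy0
    exact h y hy hy0
  rw [← LinearMap.range_dualMap_eq_dualAnnihilator_ker] at hmem
  obtain ⟨ψ, hψ⟩ := hmem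
  exact ⟨ψ, fun y hy => LinearMap.congr_fun hψ ⟨y, hy⟩⟩

/-! ### Facets and coatoms of the face poset -/

/-- A maximal proper face. -/
def IsCoatomFace {N : ℕ} (F P : Set (Fin N → ℝ)) : Prop :=
  IsFaceOf F P ∧ F ≠ P ∧ ∀ G, IsFaceOf G P → F ⊆ G → G ≠ P → F = G

theorem IsFaceOf.subset {N : ℕ} {F P : Set (Fin N → ℝ)} (h : IsFaceOf F P) : F ⊆ P := by
  obtain ⟨c, b, _, rfl⟩ := h
  exact sep_subset _ _

/-- Nested faces of equal dimension coincide. -/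
theorem IsFaceOf.eq_of_finrank_le {N : ℕ} {F G P : Set (Fin N → ℝ)} (hF : IsFaceOf F P)
    (hFG : F ⊆ G) (hGP : G ⊆ P)
    (h : Module.finrank ℝ (Submodule.span ℝ (hom '' G)) ≤
      Module.finrank ℝ (Submodule.span ℝ (hom '' F))) : F = G := by
  obtain ⟨ψ, hψ, rfl⟩ := isFaceOf_iff.1 hF
  refine hFG.antisymm fun x hx => ⟨hGP hx, ?_⟩
  have hle := Submodule.span_mono (R := ℝ) (image_mono (f := hom) hFG)
  have heq := Submodule.eq_of_le_of_finrank_le hle h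
  have hx' : hom x ∈ Submodule.span ℝ (hom '' G) := Submodule.subset_span ⟨x, hx, rfl⟩
  rw [← heq] at hx'
  have : Submodule.span ℝ (hom '' {x ∈ P | ψ (hom x) = 0}) ≤ LinearMap.ker ψ := by
    rw [Submodule.span_le]
    rintro _ ⟨y, hy, rfl⟩
    exact hy.2
  exact this hx'

theorem IsFacetOf.isCoatomFace {N : ℕ} {F P : Set (Fin N → ℝ)} (h : IsFacetOf F P) :
    IsCoatomFace F P := by
  obtain ⟨hF, hd⟩ := h
  have h1 := pdim_add_one F
  have h2 := pdim_add_one P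
  refine ⟨hF, ?_, fun G hG hFG hne => ?_⟩
  · rintro rfl
    omega
  · refine hF.eq_of_finrank_le hFG hG.subset ?_
    by_contra hlt
    refine hne (hG.eq_of_finrank_le hG.subset subset_rfl ?_)
    omega

/-- A set cut out of a linear space by homogenized inequalities. -/
def cutOut {N : ℕ} {ι : Type*} (R : Submodule ℝ ((Fin N → ℝ) × ℝ))
    (G : ι → (Fin N → ℝ) × ℝ →ₗ[ℝ] ℝ) : Set (Fin N → ℝ) :=
  {x | hom x ∈ R ∧ ∀ i, 0 ≤ G i (hom x)}

theorem hom_combo {N : ℕ} (x y : Fin N → ℝ) (ε : ℝ) :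
    hom (x + ε • (x - y)) = (1 + ε) • hom x - ε • hom y := by
  ext <;> simp [hom]
  ring

theorem cutOut_face_subset {N : ℕ} {ι : Type*} [Fintype ι] (R : Submodule ℝ ((Fin N → ℝ) × ℝ))
    (G : ι → (Fin N → ℝ) × ℝ →ₗ[ℝ] ℝ) {F : Set (Fin N → ℝ)} (hF : IsFaceOf F (cutOut R G))
    (hne : F.Nonempty) (hFP : F ≠ cutOut R G) :
    ∃ i, F ⊆ {x ∈ cutOut R G | G i (hom x) = 0} ∧
      {x ∈ cutOut R G | G i (hom x) = 0} ≠ cutOut R G := by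
  classical
  obtain ⟨ψ, hψ, rfl⟩ := isFaceOf_iff.1 hF
  by_contra hcon
  push Not at hcon
  -- every inequality not tight on all of the set is strict somewhere on the face
  have hstrict : ∀ i, ∃ x, (x ∈ cutOut R G ∧ ψ (hom x) = 0) ∧
      ((∃ y ∈ cutOut R G, G i (hom y) ≠ 0) → 0 < G i (hom x)) := by
    intro i
    by_cases h : ∀ x ∈ cutOut R G, ψ (hom x) = 0 → G i (hom x) = 0
    · obtain ⟨x, hx⟩ := hne
      refine ⟨x, hx, fun ⟨y, hy, hy0⟩ => ?_⟩
      have := hcon i (fun z hz => ⟨hz.1, h z hz.1 hz.2⟩)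
      rw [← this] at hy
      exact absurd hy.2 hy0
    · push Not at h
      obtain ⟨x, hx, hx0, hx1⟩ := h
      exact ⟨x, ⟨hx, hx0⟩, fun _ => lt_of_le_of_ne (hx.2 i) (Ne.symm hx1)⟩
  choose x hx hxpos using hstrict
  obtain ⟨x₀, hx₀⟩ := hne
  -- the sum of the chosen points, as a point of the cone
  set n : ℝ := Fintype.card ι + 1 with hn
  have hnpos : 0 < n := by positivity
  set z : Fin N → ℝ := n⁻¹ • (x₀ + ∑ i, x i) with hz
  have hhz : hom z = n⁻¹ • (hom x₀ + ∑ i, hom (x i)) := by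
    ext j
    · simp [hom, hz, Prod.fst_sum]
    · simp only [hom, Prod.smul_snd, Prod.snd_add, Prod.snd_sum, smul_eq_mul]
      simp only [Finset.sum_const, Finset.card_univ, nsmul_eq_mul, mul_one]
      rw [add_comm, inv_mul_cancel₀ hnpos.ne']
  have hzR : hom z ∈ R := by
    rw [hhz]
    exact R.smul_mem _ (R.add_mem hx₀.1.1 (R.sum_mem fun i _ => (hx i).1.1))
  have hzG : ∀ j, G j (hom z) = n⁻¹ * (G j (hom x₀) + ∑ i, G j (hom (x i))) := by
    intro j; rw [hhz]; simp only [map_smul, map_add, map_sum, smul_eq_mul]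
  have hzψ : ψ (hom z) = 0 := by
    rw [hhz]; simp [hx₀.2, fun i => (hx i).2]
  have hzpos : ∀ j, (∃ y ∈ cutOut R G, G j (hom y) ≠ 0) → 0 < G j (hom z) := by
    intro j hj
    rw [hzG]
    refine mul_pos (inv_pos.2 hnpos) (add_pos_of_nonneg_of_pos (hx₀.1.2 j) ?_)
    exact Finset.sum_pos' (fun i _ => (hx i).1.2 j) ⟨j, Finset.mem_univ _, hxpos j hj⟩
  apply hFP
  refine (sep_subset _ _).antisymm fun y hy => ⟨hy, ?_⟩
  -- move slightly from `z` away from `y`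
  have hε : ∃ ε : ℝ, 0 < ε ∧ ∀ j, ε * G j (hom y) ≤ (1 + ε) * G j (hom z) := by
    have : ∀ j, ∃ ε : ℝ, 0 < ε ∧ ∀ δ : ℝ, 0 < δ → δ ≤ ε →
        δ * G j (hom y) ≤ (1 + δ) * G j (hom z) := by
      intro j
      by_cases h : ∃ y ∈ cutOut R G, G j (hom y) ≠ 0
      · have hp := hzpos j h
        have hy0 := hy.2 j
        refine ⟨G j (hom z) / (G j (hom y) + 1), by positivity, fun δ hδ hle => ?_⟩
        rw [le_div_iff₀ (by positivity)] at hle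
        nlinarith
      · push Not at h
        refine ⟨1, one_pos, fun δ hδ _ => ?_⟩
        rw [h y hy, hzG]
        simp [h _ hx₀.1, fun i => h _ (hx i).1]
    choose ε hε hε' using this
    rcases isEmpty_or_nonempty ι with hι | hι
    · exact ⟨1, one_pos, fun j => hι.elim j⟩
    · refine ⟨Finset.univ.inf' Finset.univ_nonempty ε, ?_, fun j => ?_⟩
      · rw [Finset.lt_inf'_iff]; exact fun i _ => hε i
      · refine hε' j _ ?_ (Finset.inf'_le _ (Finset.mem_univ j))
        rw [Finset.lt_inf'_iff]; exact fun i _ => hε i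
  obtain ⟨ε, hε, hεG⟩ := hε
  have hmem : z + ε • (z - y) ∈ cutOut R G := by
    refine ⟨?_, fun j => ?_⟩
    · rw [hom_combo]
      exact R.sub_mem (R.smul_mem _ hzR) (R.smul_mem _ hy.1)
    · rw [hom_combo]
      simpa using hεG j
  have h1 := hψ _ hmem
  rw [hom_combo] at h1
  simp only [map_sub, map_smul, hzψ, smul_eq_mul, mul_zero, zero_sub] at h1
  have h2 := hψ _ hy
  nlinarith

theorem cutOut_coatoms {N : ℕ} {ι : Type*} [Fintype ι] (R : Submodule ℝ ((Fin N → ℝ) × ℝ))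
    (G : ι → (Fin N → ℝ) × ℝ →ₗ[ℝ] ℝ) :
    {F | IsCoatomFace F (cutOut R G)} ⊆
        range (fun i => {x ∈ cutOut R G | G i (hom x) = 0}) ∨
      {F | IsCoatomFace F (cutOut R G)} = {∅} := by
  by_cases h : IsCoatomFace ∅ (cutOut R G)
  · right
    ext F
    simp only [mem_ofPred_eq, mem_singleton_iff]
    refine ⟨fun hF => (h.2.2 F hF.1 (empty_subset _) hF.2.1).symm, ?_⟩
    rintro rfl
    exact h
  · left
    intro F hF
    have hne : F.Nonempty := by
      by_contra hne
      rw [not_nonempty_iff_eq_empty] at hne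
      exact h (hne ▸ hF)
    obtain ⟨i, hi, hi'⟩ := cutOut_face_subset R G hF.1 hne hF.2.1
    refine ⟨i, (hF.2.2 _ (isFaceOf_iff.2 ⟨G i, fun x hx => hx.2 i, rfl⟩) hi hi').symm⟩

theorem cutOut_coatoms_finite {N : ℕ} {ι : Type*} [Fintype ι]
    (R : Submodule ℝ ((Fin N → ℝ) × ℝ)) (G : ι → (Fin N → ℝ) × ℝ →ₗ[ℝ] ℝ) :
    {F | IsCoatomFace F (cutOut R G)}.Finite := by
  rcases cutOut_coatoms R G with h | h
  · exact (finite_range _).subset h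
  · rw [h]; exact finite_singleton _

theorem cutOut_coatoms_ncard_le {N : ℕ} {ι : Type*} [Fintype ι] [Nonempty ι]
    (R : Submodule ℝ ((Fin N → ℝ) × ℝ)) (G : ι → (Fin N → ℝ) × ℝ →ₗ[ℝ] ℝ) :
    {F | IsCoatomFace F (cutOut R G)}.ncard ≤ Fintype.card ι := by
  rcases cutOut_coatoms R G with h | h
  · refine (ncard_le_ncard h (finite_range _)).trans ?_
    rw [← Nat.card_coe_set_eq]
    refine (Finite.card_range_le _).trans ?_
    rw [Nat.card_eq_fintype_card]
  · rw [h, ncard_singleton]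
    exact Fintype.card_pos

theorem facetCount_cutOut_le {N : ℕ} {ι : Type*} [Fintype ι] [Nonempty ι]
    (R : Submodule ℝ ((Fin N → ℝ) × ℝ)) (G : ι → (Fin N → ℝ) × ℝ →ₗ[ℝ] ℝ) :
    facetCount (cutOut R G) ≤ Fintype.card ι :=
  (ncard_le_ncard (fun _ hF => IsFacetOf.isCoatomFace hF) (cutOut_coatoms_finite R G)).trans
    (cutOut_coatoms_ncard_le R G)

/-! ### Fourier–Motzkin elimination and facet descriptions -/

theorem fourier_motzkin {ι : Type*} (s : Finset ι) (α κ : ι → ℝ) :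
    (∃ t : ℝ, ∀ i ∈ s, 0 ≤ α i + t * κ i) ↔
      (∀ i ∈ s, κ i = 0 → 0 ≤ α i) ∧
        ∀ i ∈ s, ∀ j ∈ s, 0 < κ i → κ j < 0 → 0 ≤ κ i * α j - κ j * α i := by
  classical
  constructor
  · rintro ⟨t, ht⟩
    refine ⟨fun i hi h0 => by simpa [h0] using ht i hi, fun i hi j hj hpos hneg => ?_⟩
    have h1 := mul_nonneg (neg_nonneg.2 hneg.le) (ht i hi)
    have h2 := mul_nonneg hpos.le (ht j hj)
    nlinarith
  · rintro ⟨h0, h⟩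
    have hpt : ∀ i t, 0 < κ i → (0 ≤ α i + t * κ i ↔ -α i / κ i ≤ t) := by
      intro i t hi
      rw [div_le_iff₀ hi]
      constructor <;> intro <;> linarith
    have hnt : ∀ i t, κ i < 0 → (0 ≤ α i + t * κ i ↔ t ≤ -α i / κ i) := by
      intro i t hi
      rw [le_div_iff_of_neg hi]
      constructor <;> intro <;> linarith
    rcases (s.filter fun i => 0 < κ i).eq_empty_or_nonempty with hp | hp
    · have hp' : ∀ i ∈ s, κ i ≤ 0 := fun i hi => by
        by_contra hlt
        have : i ∈ s.filter fun i => 0 < κ i := Finset.mem_filter.2 ⟨hi, not_le.1 hlt⟩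
        simp [hp] at this
      rcases (s.filter fun i => κ i < 0).eq_empty_or_nonempty with hn | hn
      · refine ⟨0, fun i hi => ?_⟩
        have : κ i = 0 := by
          refine le_antisymm (hp' i hi) ?_
          by_contra hlt
          have : i ∈ s.filter fun i => κ i < 0 := Finset.mem_filter.2 ⟨hi, not_le.1 hlt⟩
          simp [hn] at this
        simpa using h0 i hi this
      · refine ⟨(s.filter fun i => κ i < 0).inf' hn fun i => -α i / κ i, fun i hi => ?_⟩
        rcases (hp' i hi).lt_or_eq with hlt | heq
        · rw [hnt i _ hlt]
          exact Finset.inf'_le _ (Finset.mem_filter.2 ⟨hi, hlt⟩)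
        · simpa [heq] using h0 i hi heq
    · refine ⟨(s.filter fun i => 0 < κ i).sup' hp fun i => -α i / κ i, fun i hi => ?_⟩
      rcases lt_trichotomy (κ i) 0 with hlt | heq | hgt
      · rw [hnt i _ hlt, Finset.sup'_le_iff]
        intro j hj
        obtain ⟨hj, hjp⟩ := Finset.mem_filter.1 hj
        have := h j hj i hi hjp hlt
        rw [div_le_iff₀ hjp, div_mul_eq_mul_div, le_div_iff_of_neg hlt]
        linarith
      · simpa [heq] using h0 i hi heq
      · rw [hpt i _ hgt]
        exact Finset.le_sup' (fun i => -α i / κ i) (Finset.mem_filter.2 ⟨hi, hgt⟩)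

/-- The convex cone generated by a finite family of vectors. -/
def coneOf {ι V : Type*} [AddCommGroup V] [Module ℝ V] (s : Finset ι) (p : ι → V) : Set V :=
  {z | ∃ c : ι → ℝ, (∀ i ∈ s, 0 ≤ c i) ∧ ∑ i ∈ s, c i • p i = z}

theorem mem_coneOf_insert {ι V : Type*} [DecidableEq ι] [AddCommGroup V] [Module ℝ V]
    {s : Finset ι} {a : ι} (ha : a ∉ s) (p : ι → V) (z : V) :
    z ∈ coneOf (insert a s) p ↔ ∃ t : ℝ, 0 ≤ t ∧ z - t • p a ∈ coneOf s p := by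
  constructor
  · rintro ⟨c, hc, rfl⟩
    refine ⟨c a, hc a (Finset.mem_insert_self _ _), c,
      fun i hi => hc i (Finset.mem_insert_of_mem hi), ?_⟩
    rw [Finset.sum_insert ha, add_sub_cancel_left]
  · rintro ⟨t, ht, c, hc, hz⟩
    refine ⟨Function.update c a t, fun i hi => ?_, ?_⟩
    · rcases eq_or_ne i a with rfl | hne
      · simpa
      · rw [Function.update_of_ne hne]
        exact hc i (Finset.mem_of_mem_insert_of_ne hi hne)
    · rw [Finset.sum_insert ha, Function.update_self]
      have : ∑ i ∈ s, Function.update c a t i • p i = ∑ i ∈ s, c i • p i := by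
        refine Finset.sum_congr rfl fun i hi => ?_
        rw [Function.update_of_ne (ne_of_mem_of_not_mem hi ha)]
      rw [this, hz, add_sub_cancel]

/-- Finitely generated cones are polyhedral. -/
theorem exists_finset_dual_coneOf {ι V : Type*} [AddCommGroup V] [Module ℝ V]
    [FiniteDimensional ℝ V] (s : Finset ι) (p : ι → V) :
    ∃ G : Finset (V →ₗ[ℝ] ℝ), ∀ z, z ∈ coneOf s p ↔ ∀ g ∈ G, 0 ≤ g z := by
  classical
  induction s using Finset.induction_on with
  | empty =>
    let b := Module.finBasis ℝ V
    refine ⟨Finset.univ.image b.coord ∪ Finset.univ.image fun i => -b.coord i, fun z => ?_⟩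
    constructor
    · rintro ⟨c, _, rfl⟩
      simp
    · intro h
      refine ⟨0, by simp, ?_⟩
      rw [Finset.sum_empty, eq_comm, ← b.forall_coord_eq_zero_iff]
      intro i
      refine le_antisymm ?_ (h _ (Finset.mem_union_left _ (Finset.mem_image_of_mem _
        (Finset.mem_univ i))))
      have := h (-b.coord i) (Finset.mem_union_right _ (Finset.mem_image.2
        ⟨i, Finset.mem_univ i, rfl⟩))
      simpa using this
  | insert a s ha ih =>
    obtain ⟨G, hG⟩ := ih
    let β : Option (V →ₗ[ℝ] ℝ) → V →ₗ[ℝ] ℝ := fun o => o.getD 0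
    let κ : Option (V →ₗ[ℝ] ℝ) → ℝ := fun o => o.elim 1 fun g => -g (p a)
    let I := Finset.insertNone G
    refine ⟨(I.filter fun i => κ i = 0).image β ∪
      ((I ×ˢ I).filter fun ij => 0 < κ ij.1 ∧ κ ij.2 < 0).image
        fun ij => κ ij.1 • β ij.2 - κ ij.2 • β ij.1, fun z => ?_⟩
    have h1 : z ∈ coneOf (insert a s) p ↔ ∃ t : ℝ, ∀ i ∈ I, 0 ≤ β i z + t * κ i := by
      rw [mem_coneOf_insert ha]
      refine exists_congr fun t => ?_
      rw [hG, Finset.forall_mem_insertNone]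
      simp [β, κ, sub_eq_add_neg]
    rw [h1, fourier_motzkin]
    simp only [Finset.mem_union, or_imp, forall_and, Finset.mem_image, Finset.mem_filter,
      Finset.mem_product]
    refine and_congr ?_ ?_
    · constructor
      · rintro h _ ⟨i, ⟨hi, h0⟩, rfl⟩
        exact h i hi h0
      · exact fun h i hi h0 => h _ ⟨i, ⟨hi, h0⟩, rfl⟩
    · constructor
      · rintro h _ ⟨⟨i, j⟩, ⟨⟨hi, hj⟩, hp, hn⟩, rfl⟩
        simpa using h i hi j hj hp hn
      · intro h i hi j hj hp hn
        simpa using h _ ⟨⟨i, j⟩, ⟨⟨hi, hj⟩, hp, hn⟩, rfl⟩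

theorem mem_convexHull_iff_hom {N : ℕ} (S : Finset (Fin N → ℝ)) (x : Fin N → ℝ) :
    x ∈ convexHull ℝ (S : Set (Fin N → ℝ)) ↔ hom x ∈ coneOf S hom := by
  rw [Finset.mem_convexHull']
  refine exists_congr fun c => and_congr_right fun _ => ?_
  rw [Prod.ext_iff]
  simp only [hom, Prod.smul_mk, smul_eq_mul, mul_one, Prod.fst_sum, Prod.snd_sum]
  exact and_comm

theorem coneOf_add {ι V : Type*} [AddCommGroup V] [Module ℝ V] {s : Finset ι} {p : ι → V}
    {y z : V} (hy : y ∈ coneOf s p) (hz : z ∈ coneOf s p) : y + z ∈ coneOf s p := by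
  obtain ⟨c, hc, rfl⟩ := hy
  obtain ⟨c', hc', rfl⟩ := hz
  exact ⟨fun i => c i + c' i, fun i hi => add_nonneg (hc i hi) (hc' i hi), by
    simp [add_smul, Finset.sum_add_distrib]⟩

theorem coneOf_smul {ι V : Type*} [AddCommGroup V] [Module ℝ V] {s : Finset ι} {p : ι → V}
    {y : V} (hy : y ∈ coneOf s p) {t : ℝ} (ht : 0 ≤ t) : t • y ∈ coneOf s p := by
  obtain ⟨c, hc, rfl⟩ := hy
  exact ⟨fun i => t * c i, fun i hi => mul_nonneg ht (hc i hi), by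
    simp [mul_smul, Finset.smul_sum]⟩

theorem exists_facet_description {N : ℕ} (S : Finset (Fin N → ℝ)) :
    ∃ G : Finset ((Fin N → ℝ) × ℝ →ₗ[ℝ] ℝ),
      G.card ≤ facetCount (convexHull ℝ (S : Set (Fin N → ℝ))) ∧
      ∀ z, z ∈ coneOf S hom ↔
        z ∈ Submodule.span ℝ (hom '' (convexHull ℝ (S : Set (Fin N → ℝ)))) ∧
          ∀ g ∈ G, 0 ≤ g z := by
  classical
  set Q := convexHull ℝ (S : Set (Fin N → ℝ)) with hQ
  set U := Submodule.span ℝ (hom '' Q) with hU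
  have hSQ : ∀ x ∈ S, x ∈ Q := fun x hx => subset_convexHull ℝ _ hx
  have hcU : ∀ z ∈ coneOf S hom, z ∈ U := by
    rintro _ ⟨c, _, rfl⟩
    exact U.sum_mem fun x hx => U.smul_mem _ (Submodule.subset_span ⟨x, hSQ x hx, rfl⟩)
  let D : Set (Finset ((Fin N → ℝ) × ℝ →ₗ[ℝ] ℝ)) :=
    {G | ∀ z, z ∈ coneOf S hom ↔ z ∈ U ∧ ∀ g ∈ G, 0 ≤ g z}
  have hDne : D.Nonempty := by
    obtain ⟨G, hG⟩ := exists_finset_dual_coneOf S (hom (N := N))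
    exact ⟨G, fun z => ⟨fun hz => ⟨hcU z hz, (hG z).1 hz⟩, fun hz => (hG z).2 hz.2⟩⟩
  obtain ⟨G, hGD, hmin⟩ := (measure Finset.card).wf.has_min D hDne
  have hG : ∀ z, z ∈ coneOf S hom ↔ z ∈ U ∧ ∀ g ∈ G, 0 ≤ g z := hGD
  refine ⟨G, ?_, hG⟩
  have hviol : ∀ g ∈ G, ∃ z ∈ U, g z < 0 ∧ ∀ h ∈ G, h ≠ g → 0 ≤ h z := by
    intro g hg
    by_contra hcon
    push Not at hcon
    refine hmin (G.erase g) (fun z => ?_) (Finset.card_erase_lt_of_mem hg)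
    rw [hG]
    refine and_congr_right fun hzU => ⟨fun h g' hg' => h g' (Finset.mem_of_mem_erase hg'),
      fun h g' hg' => ?_⟩
    rcases eq_or_ne g' g with rfl | hne
    · by_contra hlt
      obtain ⟨g₂, hg₂, hne, hlt₂⟩ := hcon z hzU (not_le.1 hlt)
      exact hlt₂.not_ge (h g₂ (Finset.mem_erase.2 ⟨hne, hg₂⟩))
    · exact h g' (Finset.mem_erase.2 ⟨hne, hg'⟩)
  have hstrict : ∃ x ∈ coneOf S hom, ∀ g ∈ G, 0 < g x := by
    have h1 : ∀ g ∈ G, ∃ x ∈ S, 0 < g (hom x) := by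
      intro g hg
      by_contra hcon
      push Not at hcon
      have h0 : ∀ x ∈ S, g (hom x) = 0 := fun x hx =>
        le_antisymm (hcon x hx) (((hG _).1 ((mem_convexHull_iff_hom S x).1 (hSQ x hx))).2 g hg)
      have hle : U ≤ LinearMap.ker g := by
        rw [hU, Submodule.span_le]
        rintro _ ⟨x, hx, rfl⟩
        obtain ⟨c, _, hc⟩ := (mem_convexHull_iff_hom S x).1 hx
        rw [← hc]
        exact Submodule.sum_mem _ fun y hy => Submodule.smul_mem _ _ (h0 y hy)
      obtain ⟨z, hzU, hz, _⟩ := hviol g hg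
      exact hz.ne (hle hzU)
    refine ⟨∑ x ∈ S, hom x, ⟨fun _ => 1, by simp, by simp⟩, fun g hg => ?_⟩
    rw [map_sum]
    refine Finset.sum_pos' (fun x hx => ?_) (h1 g hg)
    exact ((hG _).1 ((mem_convexHull_iff_hom S x).1 (hSQ x hx))).2 g hg
  obtain ⟨x₀, hx₀, hx₀pos⟩ := hstrict
  have hbd : ∀ g ∈ G, ∃ y ∈ coneOf S hom, g y = 0 ∧ ∀ h ∈ G, h ≠ g → 0 < h y := by
    intro g hg
    obtain ⟨z, hzU, hz, hzo⟩ := hviol g hg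
    have hg0 : g (g x₀ • z + (-g z) • x₀) = 0 := by
      simp only [map_add, map_smul, smul_eq_mul]
      ring
    have hgo : ∀ h ∈ G, h ≠ g → 0 < h (g x₀ • z + (-g z) • x₀) := by
      intro h hh hne
      simp only [map_add, map_smul, smul_eq_mul]
      exact add_pos_of_nonneg_of_pos (mul_nonneg (hx₀pos g hg).le (hzo h hh hne))
        (mul_pos (neg_pos.2 hz) (hx₀pos h hh))
    refine ⟨g x₀ • z + (-g z) • x₀, (hG _).2 ⟨U.add_mem (U.smul_mem _ hzU)
      (U.smul_mem _ (hcU _ hx₀)), fun h hh => ?_⟩, hg0, hgo⟩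
    rcases eq_or_ne h g with rfl | hne
    · exact hg0.ge
    · exact (hgo h hh hne).le
  let Fg : ((Fin N → ℝ) × ℝ →ₗ[ℝ] ℝ) → Set (Fin N → ℝ) := fun g => {x ∈ Q | g (hom x) = 0}
  have hface : ∀ g ∈ G, ∀ x ∈ Q, 0 ≤ g (hom x) := fun g hg x hx =>
    ((hG _).1 ((mem_convexHull_iff_hom S x).1 hx)).2 g hg
  have hcF : ∀ g ∈ G, ∀ z ∈ coneOf S hom, g z = 0 → z ∈ Submodule.span ℝ (hom '' Fg g) := by
    rintro g hg _ ⟨c, hc, rfl⟩ hz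
    rw [map_sum, Finset.sum_eq_zero_iff_of_nonneg (fun x hx => by
      rw [map_smul]; exact mul_nonneg (hc x hx) (hface g hg x (hSQ x hx)))] at hz
    refine Submodule.sum_mem _ fun x hx => ?_
    have := hz x hx
    rw [map_smul, smul_eq_mul, mul_eq_zero] at this
    rcases this with h | h
    · simp [h]
    · exact Submodule.smul_mem _ _ (Submodule.subset_span ⟨x, ⟨hSQ x hx, h⟩, rfl⟩)
  have hspan : ∀ g ∈ G, Submodule.span ℝ (hom '' Fg g) = U ⊓ LinearMap.ker g := by
    intro g hg
    apply le_antisymm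
    · rw [Submodule.span_le]
      rintro _ ⟨x, hx, rfl⟩
      exact ⟨Submodule.subset_span ⟨x, hx.1, rfl⟩, hx.2⟩
    · rintro w ⟨hwU, hw⟩
      have hw : g w = 0 := hw
      obtain ⟨y, hy, hy0, hyo⟩ := hbd g hg
      have hM : ∃ M : ℝ, ∀ h ∈ G, 0 ≤ h (w + M • y) := by
        have := (fourier_motzkin G (fun h => h w) (fun h => h y)).2 ⟨fun h hh h0 => ?_,
          fun h hh h' hh' hp hn => ?_⟩
        · simpa using this
        · rcases eq_or_ne h g with rfl | hne
          · exact hw.ge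
          · exact absurd h0 (hyo h hh hne).ne'
        · exact absurd hn (not_lt.2 (((hG _).1 hy).2 h' hh'))
      obtain ⟨M, hM⟩ := hM
      have h1 := hcF g hg _ ((hG _).2 ⟨U.add_mem hwU (U.smul_mem M (hcU _ hy)), hM⟩)
        (by simp [hw, hy0])
      have h2 := Submodule.sub_mem _ h1 (Submodule.smul_mem _ M (hcF g hg y hy hy0))
      simpa using h2
  have hfacet : ∀ g ∈ G, IsFacetOf (Fg g) Q := by
    intro g hg
    refine ⟨isFaceOf_iff.2 ⟨g, hface g hg, rfl⟩, ?_⟩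
    have h1 := pdim_add_one (Fg g)
    have h2 := pdim_add_one Q
    rw [← hU] at h2
    rw [hspan g hg] at h1
    obtain ⟨z, hzU, hz, _⟩ := hviol g hg
    let f : U →ₗ[ℝ] ℝ := g ∘ₗ U.subtype
    have hf : Function.Surjective f := by
      apply LinearMap.surjective_of_ne_zero
      intro h0
      have : f ⟨z, hzU⟩ = 0 := by rw [h0]; rfl
      exact hz.ne this
    have hsum := LinearMap.finrank_range_add_finrank_ker f
    rw [LinearMap.range_eq_top.2 hf, finrank_top, Module.finrank_self] at hsum
    have hk : Module.finrank ℝ (LinearMap.ker f) =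
        Module.finrank ℝ (U ⊓ LinearMap.ker g : Submodule ℝ _) := by
      rw [← Submodule.map_comap_subtype]
      have : LinearMap.ker f = Submodule.comap U.subtype (LinearMap.ker g) := rfl
      rw [this]
      exact (Submodule.equivMapOfInjective _ U.injective_subtype _).finrank_eq
    omega
  have hinj : Set.InjOn Fg G := by
    intro g hg g' hg' heq
    by_contra hne
    obtain ⟨y, hy, hy0, hyo⟩ := hbd g hg
    have h1 := hcF g hg y hy hy0
    rw [heq, hspan g' hg'] at h1
    exact (hyo g' hg' (Ne.symm hne)).ne' h1.2
  have hfin : {F | IsFacetOf F Q}.Finite := by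
    have hcut : Q = cutOut U (fun g : G => g.1) := by
      ext x
      rw [hQ, mem_convexHull_iff_hom, hG]
      simp [cutOut]
    rw [hcut]
    exact (cutOut_coatoms_finite _ _).subset fun _ hF => IsFacetOf.isCoatomFace hF
  rw [← Set.ncard_coe_finset, ← hinj.ncard_image]
  refine ncard_le_ncard ?_ hfin
  rintro _ ⟨g, hg, rfl⟩
  exact hfacet g hg

/-! ### Slack lifts -/

/-- Homogenization as an affine map. -/
def homAffine (N : ℕ) : (Fin N → ℝ) →ᵃ[ℝ] (Fin N → ℝ) × ℝ where
  toFun := hom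
  linear := LinearMap.inl ℝ _ _
  map_vadd' p v := by ext <;> simp [hom]

/-- The section of the nonnegative part of `L` at height `ρ = 1`. -/
def slackSet {ι : Type*} (L : Submodule ℝ (ι → ℝ)) (ρ : (ι → ℝ) →ₗ[ℝ] ℝ) : Set (ι → ℝ) :=
  {y | y ∈ L ∧ (∀ i, 0 ≤ y i) ∧ ρ y = 1}

/-- `P` is a linear image of a polytope whose homogenization is the section of a nonnegative
orthant by the linear space `L`, with height function `ρ`. -/
structure IsSlackLift {ι : Type*} {N : ℕ} (P : Set (Fin N → ℝ)) (L : Submodule ℝ (ι → ℝ))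
    (ρ : (ι → ℝ) →ₗ[ℝ] ℝ) (T : (ι → ℝ) →ₗ[ℝ] (Fin N → ℝ)) : Prop where
  pos : ∀ y ∈ L, (∀ i, 0 ≤ y i) → y ≠ 0 → 0 < ρ y
  polytope : ∃ S : Finset (ι → ℝ), slackSet L ρ = convexHull ℝ (S : Set (ι → ℝ))
  image : P = T '' slackSet L ρ

theorem convex_slackSet {ι : Type*} (L : Submodule ℝ (ι → ℝ)) (ρ : (ι → ℝ) →ₗ[ℝ] ℝ) :
    Convex ℝ (slackSet L ρ) := by
  rintro y ⟨hy, hy0, hy1⟩ z ⟨hz, hz0, hz1⟩ a b ha hb hab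
  refine ⟨L.add_mem (L.smul_mem _ hy) (L.smul_mem _ hz), fun i => ?_, ?_⟩
  · have h1 := hy0 i
    have h2 := hz0 i
    simp only [Pi.add_apply, Pi.smul_apply, smul_eq_mul]
    positivity
  · simp [hy1, hz1, hab]

theorem IsSlackLift.xc_le {ι : Type*} [Fintype ι] [Nonempty ι] {N : ℕ} {P : Set (Fin N → ℝ)}
    {L : Submodule ℝ (ι → ℝ)} {ρ : (ι → ℝ) →ₗ[ℝ] ℝ} {T : (ι → ℝ) →ₗ[ℝ] (Fin N → ℝ)}
    (h : IsSlackLift P L ρ T) : xc P ≤ Fintype.card ι := by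
  classical
  let n := Fintype.card ι
  let e : Fin n ≃ ι := (Fintype.equivFin ι).symm
  let φ : (ι → ℝ) ≃ₗ[ℝ] (Fin n → ℝ) := LinearEquiv.funCongrLeft ℝ ℝ e
  have hφ : ∀ y i, φ y i = y (e i) := fun y i => rfl
  obtain ⟨S, hS⟩ := h.polytope
  let R : Submodule ℝ ((Fin n → ℝ) × ℝ) :=
    (L.comap (φ.symm.toLinearMap ∘ₗ LinearMap.fst ℝ _ _)) ⊓
      LinearMap.ker (ρ ∘ₗ φ.symm.toLinearMap ∘ₗ LinearMap.fst ℝ _ _ - LinearMap.snd ℝ _ _)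
  let G : Fin n → (Fin n → ℝ) × ℝ →ₗ[ℝ] ℝ := fun i => LinearMap.proj i ∘ₗ LinearMap.fst ℝ _ _
  have hQ : φ '' slackSet L ρ = cutOut R G := by
    ext y
    constructor
    · rintro ⟨y, ⟨hyL, hy0, hy1⟩, rfl⟩
      refine ⟨⟨by simpa [hom] using hyL, ?_⟩, fun i => ?_⟩
      · simp [hom, hy1]
      · simpa [G, hom, hφ] using hy0 (e i)
    · rintro ⟨⟨h1, h2⟩, h3⟩
      refine ⟨φ.symm y, ⟨by simpa [hom] using h1, fun i => ?_, ?_⟩, by simp⟩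
      · have := h3 (e.symm i)
        simpa [G, hom, φ] using this
      · have : ρ (φ.symm y) - 1 = 0 := by simpa [hom] using h2
        linarith
  have : Nonempty (Fin n) := ⟨e.symm (Classical.arbitrary ι)⟩
  have hle : facetCount (φ '' slackSet L ρ) ≤ n := by
    rw [hQ]
    simpa using facetCount_cutOut_le R G
  refine le_trans (Nat.sInf_le ⟨n, φ '' slackSet L ρ,
    (T ∘ₗ φ.symm.toLinearMap).toAffineMap, ⟨S.image φ, ?_⟩, ?_, rfl⟩) hle
  · rw [hS, Finset.coe_image]
    exact φ.toLinearMap.image_convexHull _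
  · rw [h.image, image_image]
    simp

theorem coneOf_hom_snd {N : ℕ} {S : Finset (Fin N → ℝ)} {z : (Fin N → ℝ) × ℝ}
    (hz : z ∈ coneOf S hom) : 0 ≤ z.2 ∧ (z.2 = 0 → z = 0) := by
  obtain ⟨c, hc, rfl⟩ := hz
  have h2 : (∑ x ∈ S, c x • hom x).2 = ∑ x ∈ S, c x := by
    simp [hom, Prod.snd_sum]
  rw [h2]
  refine ⟨Finset.sum_nonneg hc, fun h0 => ?_⟩
  rw [Finset.sum_eq_zero_iff_of_nonneg hc] at h0
  exact Finset.sum_eq_zero fun x hx => by rw [h0 x hx, zero_smul]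

/-- A polytope with `n` facets projecting onto `P` yields a slack lift with at most `n`
coordinates. -/
theorem exists_isSlackLift {N e : ℕ} {P : Set (Fin N → ℝ)} {Q : Set (Fin e → ℝ)}
    (hQ : IsPolytope Q) (π : (Fin e → ℝ) →ᵃ[ℝ] (Fin N → ℝ)) (hπ : π '' Q = P) :
    ∃ (G : Finset ((Fin e → ℝ) × ℝ →ₗ[ℝ] ℝ)) (L : Submodule ℝ (G → ℝ))
      (ρ : (G → ℝ) →ₗ[ℝ] ℝ) (T : (G → ℝ) →ₗ[ℝ] (Fin N → ℝ)),
      G.card ≤ facetCount Q ∧ IsSlackLift P L ρ T := by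
  classical
  obtain ⟨S, rfl⟩ := hQ
  obtain ⟨G, hcard, hG⟩ := exists_facet_description S
  set Q := convexHull ℝ (S : Set (Fin e → ℝ)) with hQ
  set U := Submodule.span ℝ (hom '' Q) with hU
  let A : (Fin e → ℝ) × ℝ →ₗ[ℝ] (G → ℝ) := LinearMap.pi fun g => g.1
  have hA : ∀ z ∈ U, (∀ i, 0 ≤ A z i) → z ∈ coneOf S hom := fun z hz h =>
    (hG z).2 ⟨hz, fun g hg => h ⟨g, hg⟩⟩
  have hinj : LinearMap.ker (A ∘ₗ U.subtype) = ⊥ := by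
    rw [LinearMap.ker_eq_bot']
    rintro ⟨z, hz⟩ h0
    have h0' : A z = 0 := h0
    have h1 := coneOf_hom_snd (hA z hz (by simp [h0']))
    have h2 := coneOf_hom_snd (hA (-z) (U.neg_mem hz) (by simp [h0']))
    have : z.2 = 0 := le_antisymm (by simpa using h2.1) h1.1
    exact Subtype.ext (h1.2 this)
  obtain ⟨h, hh⟩ := LinearMap.exists_leftInverse_of_injective _ hinj
  have hhA : ∀ z ∈ U, (h (A z) : (Fin e → ℝ) × ℝ) = z := fun z hz =>
    congrArg Subtype.val (LinearMap.congr_fun hh ⟨z, hz⟩)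
  let πh : (Fin e → ℝ) × ℝ →ₗ[ℝ] (Fin N → ℝ) :=
    π.linear ∘ₗ LinearMap.fst ℝ _ _ + (LinearMap.snd ℝ _ _).smulRight (π 0)
  have hπh : ∀ x, πh (hom x) = π x := by
    intro x
    have := π.map_vadd 0 x
    simp only [vadd_eq_add, add_zero] at this
    simp [πh, hom, this]
  have hslack : slackSet (U.map A) (LinearMap.snd ℝ _ _ ∘ₗ U.subtype ∘ₗ h) =
      (fun x => A (hom x)) '' Q := by
    ext y
    constructor
    · rintro ⟨⟨u, hu, rfl⟩, h0, h1⟩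
      have h1 : (h (A u) : (Fin e → ℝ) × ℝ).2 = 1 := h1
      rw [hhA u hu] at h1
      have hu1 : u = hom u.1 := Prod.ext rfl h1
      refine ⟨u.1, ?_, by simp only [← hu1]⟩
      rw [hQ, mem_convexHull_iff_hom, ← hu1]
      exact hA u hu h0
    · rintro ⟨x, hx, rfl⟩
      have hxU : hom x ∈ U := Submodule.subset_span ⟨x, hx, rfl⟩
      refine ⟨⟨_, hxU, rfl⟩, fun g => ?_, ?_⟩
      · exact ((hG _).1 ((mem_convexHull_iff_hom S x).1 hx)).2 g.1 g.2
      · change (h (A (hom x)) : (Fin e → ℝ) × ℝ).2 = 1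
        rw [hhA _ hxU]
        rfl
  refine ⟨G, U.map A, LinearMap.snd ℝ _ _ ∘ₗ U.subtype ∘ₗ h, πh ∘ₗ U.subtype ∘ₗ h, hcard,
    ?_, ?_, ?_⟩
  · rintro _ ⟨u, hu, rfl⟩ h0 hne
    change 0 < (h (A u) : (Fin e → ℝ) × ℝ).2
    rw [hhA u hu]
    have h1 := coneOf_hom_snd (hA u hu h0)
    refine lt_of_le_of_ne h1.1 fun h2 => hne ?_
    rw [h1.2 h2.symm, map_zero]
  · refine ⟨S.image fun x => A (hom x), ?_⟩
    rw [hslack, Finset.coe_image]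
    exact (A.toAffineMap.comp (homAffine e)).image_convexHull _
  · rw [hslack, image_image, ← hπ]
    refine image_congr fun x hx => ?_
    change π x = πh (h (A (hom x)) : (Fin e → ℝ) × ℝ)
    rw [hhA _ (Submodule.subset_span ⟨x, hx, rfl⟩), hπh]

/-- Adding one point costs one more coordinate. -/
theorem IsSlackLift.exists_insert {ι : Type*} {N : ℕ} {P : Set (Fin N → ℝ)}
    {L : Submodule ℝ (ι → ℝ)} {ρ : (ι → ℝ) →ₗ[ℝ] ℝ} {T : (ι → ℝ) →ₗ[ℝ] (Fin N → ℝ)}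
    (h : IsSlackLift P L ρ T) (v : Fin N → ℝ) :
    ∃ (L' : Submodule ℝ (Option ι → ℝ)) (ρ' : (Option ι → ℝ) →ₗ[ℝ] ℝ)
      (T' : (Option ι → ℝ) →ₗ[ℝ] (Fin N → ℝ)),
      IsSlackLift (convexHull ℝ (P ∪ {v})) L' ρ' T' := by
  classical
  let r : (Option ι → ℝ) →ₗ[ℝ] (ι → ℝ) := LinearMap.funLeft ℝ ℝ some
  have hr : ∀ y i, r y i = y (some i) := fun _ _ => rfl
  let emb : (ι → ℝ) →ₗ[ℝ] (Option ι → ℝ) :=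
    { toFun := fun y o => o.elim 0 y
      map_add' := fun y z => by ext (_ | i) <;> simp
      map_smul' := fun c y => by ext (_ | i) <;> simp }
  let δ : Option ι → ℝ := Pi.single none 1
  let ρ' : (Option ι → ℝ) →ₗ[ℝ] ℝ := ρ ∘ₗ r + LinearMap.proj none
  let T' : (Option ι → ℝ) →ₗ[ℝ] (Fin N → ℝ) := T ∘ₗ r + (LinearMap.proj none).smulRight v
  have hremb : ∀ y, r (emb y) = y := fun y => rfl
  have hrδ : r δ = 0 := by ext i; simp [hr, δ]
  have hdecomp : ∀ y, y = emb (r y) + y none • δ := by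
    intro y; ext (_ | i) <;> simp [emb, δ, hr]
  have hslack : slackSet (L.comap r) ρ' = convexHull ℝ (emb '' slackSet L ρ ∪ {δ}) := by
    apply Subset.antisymm
    · rintro y ⟨hyL, hy0, hy1⟩
      have hyL : r y ∈ L := hyL
      have hy1 : ρ (r y) + y none = 1 := hy1
      by_cases hz : r y = 0
      · rw [hz, map_zero, zero_add] at hy1
        apply subset_convexHull
        right
        rw [mem_singleton_iff, hdecomp y, hz, hy1]
        simp
      · have hp := h.pos _ hyL (fun i => hy0 (some i)) hz
        rw [hdecomp y]
        have : emb (r y) = ρ (r y) • emb ((ρ (r y))⁻¹ • r y) := by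
          rw [← map_smul, smul_smul, mul_inv_cancel₀ hp.ne', one_smul]
        rw [this]
        have hmem : (ρ (r y))⁻¹ • r y ∈ slackSet L ρ := by
          refine ⟨L.smul_mem _ hyL, fun i => ?_, ?_⟩
          · exact mul_nonneg (inv_nonneg.2 hp.le) (hy0 (some i))
          · rw [map_smul, smul_eq_mul, inv_mul_cancel₀ hp.ne']
        have h1 : emb ((ρ (r y))⁻¹ • r y) ∈ convexHull ℝ (emb '' slackSet L ρ ∪ {δ}) :=
          subset_convexHull ℝ _ (Or.inl ⟨_, hmem, rfl⟩)
        have h2 : δ ∈ convexHull ℝ (emb '' slackSet L ρ ∪ {δ}) :=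
          subset_convexHull ℝ _ (Or.inr rfl)
        exact convex_convexHull ℝ _ h1 h2 hp.le (hy0 none) hy1
    · refine convexHull_min ?_ (convex_slackSet _ _)
      rintro _ (⟨y, ⟨hyL, hy0, hy1⟩, rfl⟩ | rfl)
      · refine ⟨hyL, ?_, ?_⟩
        · rintro (_ | i)
          · exact le_rfl
          · exact hy0 i
        · change ρ (r (emb y)) + 0 = 1
          rw [hremb, hy1, add_zero]
      · refine ⟨?_, ?_, ?_⟩
        · change r δ ∈ L
          rw [hrδ]
          exact L.zero_mem
        · intro o
          by_cases ho : o = none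
          · simp [δ, ho]
          · simp [δ, ho]
        · change ρ (r δ) + δ none = 1
          simp [hrδ, δ]
  refine ⟨L.comap r, ρ', T', ?_, ?_, ?_⟩
  · intro y hyL hy0 hne
    change 0 < ρ (r y) + y none
    by_cases hz : r y = 0
    · rw [hz, map_zero, zero_add]
      refine lt_of_le_of_ne (hy0 none) fun h0 => hne ?_
      rw [hdecomp y, hz, ← h0]
      simp
    · exact add_pos_of_pos_of_nonneg (h.pos _ hyL (fun i => hy0 (some i)) hz) (hy0 none)
  · obtain ⟨S, hS⟩ := h.polytope
    refine ⟨S.image emb ∪ {δ}, ?_⟩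
    rw [hslack, hS, Finset.coe_union, Finset.coe_image, Finset.coe_singleton,
      LinearMap.image_convexHull, convexHull_convexHull_union_left]
  · rw [hslack, LinearMap.image_convexHull, image_union, image_image, image_singleton, h.image]
    congr 2
    · refine image_congr fun y _ => ?_
      change T y = T (r (emb y)) + (0 : ℝ) • v
      rw [hremb, zero_smul, add_zero]
    · change {v} = {T (r δ) + δ none • v}
      simp [hrδ, δ]

theorem IsSlackLift.exists_span {ι : Type*} {N : ℕ} {P : Set (Fin N → ℝ)}
    {L : Submodule ℝ (ι → ℝ)} {ρ : (ι → ℝ) →ₗ[ℝ] ℝ} {T : (ι → ℝ) →ₗ[ℝ] (Fin N → ℝ)}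
    (h : IsSlackLift P L ρ T) :
    ∃ L' : Submodule ℝ (ι → ℝ), IsSlackLift P L' ρ T ∧
      L' ≤ Submodule.span ℝ {y | y ∈ L' ∧ ∀ i, 0 ≤ y i} := by
  set L' := Submodule.span ℝ {y | y ∈ L ∧ ∀ i, 0 ≤ y i} with hL'
  have hle : L' ≤ L := Submodule.span_le.2 fun y hy => hy.1
  have hs : slackSet L' ρ = slackSet L ρ := by
    ext y
    exact ⟨fun hy => ⟨hle hy.1, hy.2⟩, fun hy => ⟨Submodule.subset_span ⟨hy.1, hy.2.1⟩, hy.2⟩⟩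
  refine ⟨L', ⟨fun y hy => h.pos y (hle hy), ?_, ?_⟩, ?_⟩
  · rw [hs]; exact h.polytope
  · rw [hs]; exact h.image
  · exact Submodule.span_mono fun y hy => ⟨Submodule.subset_span hy, hy.2⟩

section Analysis

variable {ι : Type*} {N : ℕ} {P : Set (Fin N → ℝ)}
  {L : Submodule ℝ (ι → ℝ)} {ρ : (ι → ℝ) →ₗ[ℝ] ℝ} {T : (ι → ℝ) →ₗ[ℝ] (Fin N → ℝ)}

theorem IsSlackLift.exists_scale (h : IsSlackLift P L ρ T) {y : ι → ℝ} (hy : y ∈ L)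
    (hy0 : ∀ i, 0 ≤ y i) (hne : y ≠ 0) :
    (ρ y)⁻¹ • T y ∈ P ∧ T.prod ρ y = ρ y • hom ((ρ y)⁻¹ • T y) := by
  have hp := h.pos y hy hy0 hne
  constructor
  · rw [h.image]
    refine ⟨(ρ y)⁻¹ • y, ⟨L.smul_mem _ hy, fun i => ?_, ?_⟩, by simp⟩
    · exact mul_nonneg (inv_nonneg.2 hp.le) (hy0 i)
    · rw [map_smul, smul_eq_mul, inv_mul_cancel₀ hp.ne']
  · ext
    · simp [hom, hp.ne']
    · simp [hom]

theorem IsSlackLift.map_eq_span (h : IsSlackLift P L ρ T)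
    (hspan : L ≤ Submodule.span ℝ {y | y ∈ L ∧ ∀ i, 0 ≤ y i}) :
    L.map (T.prod ρ) = Submodule.span ℝ (hom '' P) := by
  apply le_antisymm
  · refine (Submodule.map_mono hspan).trans ?_
    rw [Submodule.map_span_le]
    rintro y ⟨hy, hy0⟩
    by_cases hne : y = 0
    · rw [hne, map_zero]
      exact Submodule.zero_mem _
    · obtain ⟨h1, h2⟩ := h.exists_scale hy hy0 hne
      rw [h2]
      exact Submodule.smul_mem _ _ (Submodule.subset_span ⟨_, h1, rfl⟩)
  · rw [Submodule.span_le]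
    rintro _ ⟨x, hx, rfl⟩
    rw [h.image] at hx
    obtain ⟨y, ⟨hy, _, hy1⟩, rfl⟩ := hx
    exact ⟨y, hy, Prod.ext rfl hy1⟩

/-- Eliminating a one-dimensional kernel bounds the number of facets. -/
theorem IsSlackLift.facetCount_le [Fintype ι] (h : IsSlackLift P L ρ T) {κ : ι → ℝ} (hκ : κ ∈ L)
    (hκ0 : T.prod ρ κ = 0) (hker : ∀ y ∈ L, T.prod ρ y = 0 → ∃ t : ℝ, y = t • κ)
    (hne : (∃ i, κ i = 0) ∨ ((∃ i, 0 < κ i) ∧ ∃ i, κ i < 0)) :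
    facetCount P ≤ Nat.card {i // κ i = 0} + Nat.card {i // 0 < κ i} * Nat.card {i // κ i < 0} := by
  classical
  let J := {i // κ i = 0} ⊕ ({i // 0 < κ i} × {i // κ i < 0})
  let φ : J → (ι → ℝ) →ₗ[ℝ] ℝ := Sum.elim (fun i => LinearMap.proj i.1)
    fun ij => κ ij.1 • LinearMap.proj ij.2.1 - κ ij.2 • LinearMap.proj ij.1.1
  have hφκ : ∀ j, φ j κ = 0 := by
    rintro (i | ij)
    · exact i.2
    · simp [φ]
      ring
  have hdesc : ∀ j, ∃ ψ : (Fin N → ℝ) × ℝ →ₗ[ℝ] ℝ, ∀ y ∈ L, ψ (T.prod ρ y) = φ j y := by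
    intro j
    refine exists_descent L _ _ fun y hy hy0 => ?_
    obtain ⟨t, rfl⟩ := hker y hy hy0
    rw [map_smul, hφκ, smul_zero]
  choose ψ hψ using hdesc
  have hP : P = cutOut (L.map (T.prod ρ)) ψ := by
    ext x
    constructor
    · intro hx
      rw [h.image] at hx
      obtain ⟨y, ⟨hy, hy0, hy1⟩, rfl⟩ := hx
      have hhom : hom (T y) = T.prod ρ y := Prod.ext rfl hy1.symm
      refine ⟨⟨y, hy, hhom.symm⟩, fun j => ?_⟩
      rw [hhom, hψ j y hy]
      rcases j with i | ij
      · exact hy0 _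
      · have h1 := mul_nonneg ij.1.2.le (hy0 ij.2)
        have h2 := mul_nonneg (neg_nonneg.2 ij.2.2.le) (hy0 ij.1)
        simp only [φ, Sum.elim_inr, LinearMap.sub_apply, LinearMap.smul_apply,
          LinearMap.proj_apply, smul_eq_mul]
        linarith
    · rintro ⟨⟨y, hy, hyx⟩, hpos⟩
      simp only [← hyx] at hpos
      have hpos' : ∀ j, 0 ≤ φ j y := fun j => hψ j y hy ▸ hpos j
      obtain ⟨t, ht⟩ := (fourier_motzkin Finset.univ y κ).2
        ⟨fun i _ h0 => hpos' (Sum.inl ⟨i, h0⟩), fun i _ j _ hi hj => by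
          simpa [φ] using hpos' (Sum.inr ⟨⟨i, hi⟩, ⟨j, hj⟩⟩)⟩
      have hy' : T.prod ρ (y + t • κ) = hom x := by
        rw [map_add, map_smul, hκ0, smul_zero, add_zero, hyx]
      rw [h.image]
      exact ⟨y + t • κ, ⟨L.add_mem hy (L.smul_mem _ hκ), fun i => ht i (Finset.mem_univ i),
        congrArg Prod.snd hy'⟩, congrArg Prod.fst hy'⟩
  have : Nonempty J := by
    rcases hne with ⟨i, hi⟩ | ⟨⟨i, hi⟩, j, hj⟩
    · exact ⟨Sum.inl ⟨i, hi⟩⟩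
    · exact ⟨Sum.inr ⟨⟨i, hi⟩, ⟨j, hj⟩⟩⟩
  have := facetCount_cutOut_le (L.map (T.prod ρ)) ψ
  rw [← hP] at this
  rwa [← Nat.card_eq_fintype_card, Nat.card_sum, Nat.card_prod] at this

end Analysis

theorem mem_convexHull_range_iff_hom {N : ℕ} {X : Type*} [Fintype X] (p : X → Fin N → ℝ)
    (x : Fin N → ℝ) :
    x ∈ convexHull ℝ (range p) ↔ hom x ∈ coneOf Finset.univ (fun i => hom (p i)) := by
  classical
  constructor
  · intro hx
    refine convexHull_min (s := range p)
      (t := {x | hom x ∈ coneOf Finset.univ (fun i => hom (p i))}) ?_ ?_ hx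
    · rintro _ ⟨i, rfl⟩
      exact ⟨Pi.single i 1, fun j _ => by
        by_cases hj : j = i
        · simp [hj]
        · simp [hj], by simp [Pi.single_apply, ite_smul]⟩
    · intro y hy z hz a b ha hb hab
      have : hom (a • y + b • z) = a • hom y + b • hom z := by
        ext <;> simp [hom, hab]
      change hom (a • y + b • z) ∈ coneOf Finset.univ (fun i => hom (p i))
      rw [this]
      exact coneOf_add (coneOf_smul hy ha) (coneOf_smul hz hb)
  · rintro ⟨c, hc, hcx⟩
    have h1 : ∑ i, c i • p i = x := by
      simpa [hom, Prod.fst_sum] using congrArg Prod.fst hcx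
    have h2 : ∑ i, c i = 1 := by
      simpa [hom, Prod.snd_sum] using congrArg Prod.snd hcx
    rw [← h1]
    exact (convex_convexHull ℝ _).sum_mem hc h2 fun i _ => subset_convexHull ℝ _ ⟨i, rfl⟩

theorem vertexSet_convexHull_range_subset {N : ℕ} {X : Type*} [Fintype X] (p : X → Fin N → ℝ) :
    vertexSet (convexHull ℝ (range p)) ⊆ range p := by
  intro v hv
  obtain ⟨ψ, hψ, hF⟩ := isFaceOf_iff.1 hv
  have hvF : v ∈ {x ∈ convexHull ℝ (range p) | ψ (hom x) = 0} := hF ▸ mem_singleton v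
  obtain ⟨c, hc, hcv⟩ := (mem_convexHull_range_iff_hom p v).1 hvF.1
  have hsub : ∀ i, p i ∈ convexHull ℝ (range p) := fun i => subset_convexHull ℝ _ ⟨i, rfl⟩
  by_contra hcon
  have hpos : ∀ i, 0 < ψ (hom (p i)) := by
    intro i
    refine lt_of_le_of_ne (hψ _ (hsub i)) fun h0 => hcon ?_
    have : p i ∈ ({v} : Set (Fin N → ℝ)) := hF ▸ ⟨hsub i, h0.symm⟩
    exact ⟨i, this⟩
  have h0 : ∑ i, c i * ψ (hom (p i)) = 0 := by
    have := hvF.2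
    rw [← hcv, map_sum] at this
    simpa using this
  rw [Finset.sum_eq_zero_iff_of_nonneg fun i hi => mul_nonneg (hc i hi) (hpos i).le] at h0
  have h1 : ∑ i, c i = 1 := by
    simpa [hom, Prod.snd_sum] using congrArg Prod.snd hcv
  have h2 : ∀ i, c i = 0 := fun i =>
    (mul_eq_zero.1 (h0 i (Finset.mem_univ i))).resolve_right (hpos i).ne'
  simp [h2] at h1

theorem IsSlackLift.eq_convexHull_range {ι : Type*} {N : ℕ} {P : Set (Fin N → ℝ)}
    {L : Submodule ℝ (ι → ℝ)} {ρ : (ι → ℝ) →ₗ[ℝ] ℝ} {T : (ι → ℝ) →ₗ[ℝ] (Fin N → ℝ)}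
    (h : IsSlackLift P L ρ T) {X : Type*} [Fintype X] (g : X → ι → ℝ) (hgL : ∀ x, g x ∈ L)
    (hg0 : ∀ x i, 0 ≤ g x i) (hgne : ∀ x, g x ≠ 0)
    (hgen : ∀ y ∈ L, (∀ i, 0 ≤ y i) → y ∈ coneOf Finset.univ g) :
    P = convexHull ℝ (range fun x => (ρ (g x))⁻¹ • T (g x)) := by
  have hP : Convex ℝ P := by
    rw [h.image]
    exact (convex_slackSet L ρ).linear_image T
  apply Subset.antisymm
  · intro x hx
    rw [h.image] at hx
    obtain ⟨y, ⟨hy, hy0, hy1⟩, rfl⟩ := hx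
    have hhom : hom (T y) = T.prod ρ y := Prod.ext rfl hy1.symm
    rw [mem_convexHull_range_iff_hom, hhom]
    obtain ⟨c, hc, rfl⟩ := hgen y hy hy0
    refine ⟨fun i => c i * ρ (g i), fun i hi => mul_nonneg (hc i hi)
      (h.pos _ (hgL i) (hg0 i) (hgne i)).le, ?_⟩
    rw [map_sum]
    refine Finset.sum_congr rfl fun i _ => ?_
    rw [map_smul, (h.exists_scale (hgL i) (hg0 i) (hgne i)).2, smul_smul]
  · refine convexHull_min ?_ hP
    rintro _ ⟨x, rfl⟩
    exact (h.exists_scale (hgL x) (hg0 x) (hgne x)).1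

theorem Submodule.exists_generator_of_finrank_eq_one {V : Type*} [AddCommGroup V] [Module ℝ V]
    (W : Submodule ℝ V) (h : Module.finrank ℝ W = 1) :
    ∃ v ∈ W, v ≠ 0 ∧ ∀ w ∈ W, ∃ t : ℝ, t • v = w := by
  obtain ⟨⟨v, hv⟩, hne, hall⟩ := finrank_eq_one_iff'.1 h
  refine ⟨v, hv, fun h0 => hne (Subtype.ext h0), fun w hw => ?_⟩
  obtain ⟨t, ht⟩ := hall ⟨w, hw⟩
  exact ⟨t, congrArg Subtype.val ht⟩

section LowerBound

variable {ι : Type*} [Fintype ι] {N : ℕ} {P : Set (Fin N → ℝ)}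
  {L : Submodule ℝ (ι → ℝ)} {ρ : (ι → ℝ) →ₗ[ℝ] ℝ} {T : (ι → ℝ) →ₗ[ℝ] (Fin N → ℝ)}

theorem IsSlackLift.finrank_eq (h : IsSlackLift P L ρ T)
    (hspan : L ≤ Submodule.span ℝ {y | y ∈ L ∧ ∀ i, 0 ≤ y i}) :
    (Module.finrank ℝ L : ℤ) =
      pdim P + 1 + Module.finrank ℝ (LinearMap.ker ((T.prod ρ).domRestrict L)) := by
  rw [pdim_add_one, ← h.map_eq_span hspan, ← LinearMap.range_domRestrict]
  exact_mod_cast (LinearMap.finrank_range_add_finrank_ker ((T.prod ρ).domRestrict L)).symm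

theorem IsSlackLift.vertexCount_le_of_eq_top (h : IsSlackLift P L ρ T) (hL : L = ⊤) :
    vertexCount P ≤ Fintype.card ι := by
  classical
  have := h.eq_convexHull_range (fun i => Pi.single i (1 : ℝ)) (fun i => hL ▸ Submodule.mem_top)
    (fun i j => by
      by_cases hij : j = i
      · simp [hij]
      · simp [hij])
    (fun i => by simp)
    (fun y _ hy0 => ⟨y, fun i _ => hy0 i, by
      ext j
      simp [Finset.sum_apply, Pi.single_apply]⟩)
  rw [vertexCount, this]
  refine (ncard_le_ncard (vertexSet_convexHull_range_subset _) (finite_range _)).trans ?_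
  rw [← image_univ]
  refine (ncard_image_le finite_univ).trans ?_
  rw [ncard_univ, Nat.card_eq_fintype_card]

theorem IsSlackLift.facetCount_le_of_injective [Nonempty ι] (h : IsSlackLift P L ρ T)
    (hker : LinearMap.ker ((T.prod ρ).domRestrict L) = ⊥) : facetCount P ≤ Fintype.card ι := by
  have := h.facetCount_le (κ := 0) L.zero_mem (map_zero _) (fun y hy hy0 => ⟨0, by
    have h1 : (⟨y, hy⟩ : L) ∈ LinearMap.ker ((T.prod ρ).domRestrict L) := hy0
    rw [hker] at h1
    have h2 : y = 0 := congrArg Subtype.val h1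
    simp [h2]⟩) (Or.inl ⟨Classical.arbitrary ι, rfl⟩)
  refine this.trans ?_
  simp

/-- If `P` has more vertices and more facets than a lift has coordinates, the lift is not a
simplex and has a nontrivial fiber direction. -/
theorem IsSlackLift.finrank_bounds {d : ℕ} (h : IsSlackLift P L ρ T)
    (hspan : L ≤ Submodule.span ℝ {y | y ∈ L ∧ ∀ i, 0 ≤ y i}) (hdP : pdim P = d)
    (hv : Fintype.card ι < vertexCount P) (hf : Fintype.card ι < facetCount P) :
    d + 1 < Module.finrank ℝ L ∧ Module.finrank ℝ L < Fintype.card ι := by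
  have h1 := h.finrank_eq hspan
  have h2 : Module.finrank ℝ L ≤ Fintype.card ι := by
    simpa using Submodule.finrank_le L
  constructor
  · by_contra hcon
    have h3 : Module.finrank ℝ (LinearMap.ker ((T.prod ρ).domRestrict L)) = 0 := by omega
    have : Nonempty ι := Fintype.card_pos_iff.1 (by omega)
    exact absurd (h.facetCount_le_of_injective (Submodule.finrank_eq_zero.1 h3)) (by omega)
  · refine lt_of_le_of_ne h2 fun h3 => ?_
    have : L = ⊤ := Submodule.eq_top_of_finrank_eq (by simpa using h3)
    exact absurd (h.vertexCount_le_of_eq_top this) (by omega)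

theorem Submodule.exists_eq_ker_of_finrank_succ (hL : Module.finrank ℝ L + 1 = Fintype.card ι) :
    ∃ α : ι → ℝ, α ≠ 0 ∧ ∀ y, y ∈ L ↔ ∑ i, α i * y i = 0 := by
  classical
  have hlt : L < ⊤ := by
    refine lt_top_iff_ne_top.2 fun h => ?_
    subst h
    simp at hL
  obtain ⟨φ, hφ, hle⟩ := Submodule.exists_le_ker_of_lt_top L hlt
  have hφsum : ∀ y, ∑ i, φ (Pi.single i 1) * y i = φ y := by
    intro y
    rw [LinearMap.pi_apply_eq_sum_univ φ y]
    refine Finset.sum_congr rfl fun i _ => ?_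
    rw [smul_eq_mul, mul_comm]
    congr 2
    ext j
    simp [Pi.single_apply, eq_comm]
  have heq : L = LinearMap.ker φ := by
    refine Submodule.eq_of_le_of_finrank_le hle ?_
    have h1 := LinearMap.finrank_range_add_finrank_ker φ
    have h2 : Module.finrank ℝ (LinearMap.range φ) = 1 := by
      rw [LinearMap.range_eq_top.2 (LinearMap.surjective hφ)]
      simp
    simp only [Module.finrank_fintype_fun_eq_card] at h1
    omega
  refine ⟨fun i => φ (Pi.single i 1), fun h0 => hφ ?_, fun y => ?_⟩
  · ext i
    exact congrFun h0 i
  · rw [hφsum, heq, LinearMap.mem_ker]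

theorem IsSlackLift.exists_kernel (h : IsSlackLift P L ρ T)
    (hspan : L ≤ Submodule.span ℝ {y | y ∈ L ∧ ∀ i, 0 ≤ y i})
    (hd : (Module.finrank ℝ L : ℤ) = pdim P + 2) :
    ∃ κ ∈ L, κ ≠ 0 ∧ T.prod ρ κ = 0 ∧ ∀ y ∈ L, T.prod ρ y = 0 → ∃ t : ℝ, y = t • κ := by
  have h1 := h.finrank_eq hspan
  have h3 : Module.finrank ℝ (LinearMap.ker ((T.prod ρ).domRestrict L)) = 1 := by omega
  obtain ⟨⟨κ, hκ⟩, hκ0, hne, hall⟩ := Submodule.exists_generator_of_finrank_eq_one _ h3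
  refine ⟨κ, hκ, fun h0 => hne (Subtype.ext h0), hκ0, fun y hy hy0 => ?_⟩
  obtain ⟨t, ht⟩ := hall ⟨y, hy⟩ hy0
  exact ⟨t, (congrArg Subtype.val ht).symm⟩

theorem IsSlackLift.exists_pos_neg (h : IsSlackLift P L ρ T) {κ : ι → ℝ} (hκ : κ ∈ L)
    (hne : κ ≠ 0) (hκ0 : T.prod ρ κ = 0) : (∃ i, 0 < κ i) ∧ ∃ i, κ i < 0 := by
  have hρ : ρ κ = 0 := congrArg Prod.snd hκ0
  constructor
  · by_contra! hcon
    have := h.pos (-κ) (L.neg_mem hκ) (fun i => by simpa using hcon i) (neg_ne_zero.2 hne)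
    simp [hρ] at this
  · by_contra! hcon
    exact (h.pos κ hκ hcon hne).ne' hρ

end LowerBound

theorem exists_isSlackLift_of_xc {N : ℕ} {P : Set (Fin N → ℝ)} (hP : IsPolytope P) :
    ∃ (e : ℕ) (G : Finset ((Fin e → ℝ) × ℝ →ₗ[ℝ] ℝ)) (L : Submodule ℝ (G → ℝ))
      (ρ : (G → ℝ) →ₗ[ℝ] ℝ) (T : (G → ℝ) →ₗ[ℝ] (Fin N → ℝ)), G.card ≤ xc P ∧
      IsSlackLift P L ρ T ∧ L ≤ Submodule.span ℝ {y | y ∈ L ∧ ∀ i, 0 ≤ y i} := by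
  have hne : {n | ∃ (e : ℕ) (Q : Set (Fin e → ℝ)) (π : (Fin e → ℝ) →ᵃ[ℝ] (Fin N → ℝ)),
      IsPolytope Q ∧ π '' Q = P ∧ facetCount Q = n}.Nonempty :=
    ⟨facetCount P, N, P, AffineMap.id ℝ _, hP, by simp, rfl⟩
  obtain ⟨e, Q, π, hQ, hπ, hn⟩ := Nat.sInf_mem hne
  obtain ⟨G, L, ρ, T, hG, hL⟩ := exists_isSlackLift hQ π hπ
  obtain ⟨L', hL', hs⟩ := hL.exists_span
  exact ⟨e, G, L', ρ, T, hG.trans hn.le, hL', hs⟩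

theorem le_xc {N d : ℕ} {P : Set (Fin N → ℝ)} (hP : IsPolytope P) (hdP : pdim P = d)
    (hv : vertexCount P = d + 4) (hf : d + 4 ≤ facetCount P) : d + 3 ≤ xc P := by
  obtain ⟨e, G, L, ρ, T, hG, hL, hs⟩ := exists_isSlackLift_of_xc hP
  by_contra! hcon
  have hc : Fintype.card G = G.card := by simp
  have := hL.finrank_bounds hs hdP (by omega) (by omega)
  omega

theorem exists_pos_forall_mul_le {ι : Type*} (s : Finset ι) (a b : ι → ℝ)
    (hb : ∀ i ∈ s, 0 ≤ b i) (hab : ∀ i ∈ s, b i = 0 → a i = 0) :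
    ∃ ε : ℝ, 0 < ε ∧ ∀ i ∈ s, ε * a i ≤ b i := by
  have : ∀ i ∈ s, ∀ᶠ ε : ℝ in nhdsWithin 0 (Ioi 0), ε * a i ≤ b i := by
    intro i hi
    rcases (hb i hi).eq_or_lt with h | h
    · exact Filter.Eventually.of_forall fun ε => by rw [hab i hi h.symm, ← h, mul_zero]
    · have ht : Filter.Tendsto (fun ε : ℝ => ε * a i) (nhdsWithin 0 (Ioi 0)) (nhds (0 * a i)) :=
        ((continuous_id.mul continuous_const).tendsto 0).mono_left nhdsWithin_le_nhds
      rw [zero_mul] at ht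
      exact (ht.eventually (gt_mem_nhds h)).mono fun _ h => le_of_lt h
  obtain ⟨ε, h1, h2⟩ := (((Filter.eventually_all_finset s).2 this).and
    self_mem_nhdsWithin).exists
  exact ⟨ε, h2, h1⟩

theorem isVertexOf_of_mem_extremePoints {N : ℕ} (S : Finset (Fin N → ℝ)) {s : Fin N → ℝ}
    (hs : s ∈ (convexHull ℝ (S : Set (Fin N → ℝ))).extremePoints ℝ) :
    IsVertexOf s (convexHull ℝ (S : Set (Fin N → ℝ))) := by
  classical
  obtain ⟨hsP, hext⟩ := mem_extremePoints.1 hs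
  obtain ⟨G, hG⟩ := exists_finset_dual_coneOf S (hom (N := N))
  have hmem : ∀ x, x ∈ convexHull ℝ (S : Set (Fin N → ℝ)) ↔ ∀ g ∈ G, 0 ≤ g (hom x) :=
    fun x => (mem_convexHull_iff_hom S x).trans (hG _)
  refine isFaceOf_iff.2 ⟨∑ g ∈ G with g (hom s) = 0, g, fun x hx => ?_, ?_⟩
  · rw [LinearMap.sum_apply]
    exact Finset.sum_nonneg fun g hg => (hmem x).1 hx g (Finset.mem_filter.1 hg).1
  ext x
  simp only [mem_singleton_iff, mem_ofPred_eq, LinearMap.sum_apply]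
  constructor
  · rintro rfl
    exact ⟨hsP, Finset.sum_eq_zero fun g hg => (Finset.mem_filter.1 hg).2⟩
  rintro ⟨hx, hx0⟩
  rw [Finset.sum_eq_zero_iff_of_nonneg
    fun g hg => (hmem x).1 hx g (Finset.mem_filter.1 hg).1] at hx0
  obtain ⟨ε, hε, hle⟩ := exists_pos_forall_mul_le G (fun g => g (hom x)) (fun g => g (hom s))
    ((hmem s).1 hsP) (fun g hg h0 => hx0 g (Finset.mem_filter.2 ⟨hg, h0⟩))
  have hx' : s + ε • (s - x) ∈ convexHull ℝ (S : Set (Fin N → ℝ)) := by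
    rw [hmem]
    intro g hg
    rw [hom_combo, map_sub, map_smul, map_smul, smul_eq_mul, smul_eq_mul]
    have h1 := hle g hg
    have h2 := (hmem s).1 hsP g hg
    nlinarith
  refine (hext x hx _ hx' ⟨ε / (1 + ε), 1 / (1 + ε), by positivity, by positivity, ?_, ?_⟩).1
  · field_simp
    ring
  · ext i
    simp only [Pi.add_apply, Pi.smul_apply, Pi.sub_apply, smul_eq_mul]
    field_simp
    ring

theorem IsPolytope.eq_convexHull_vertexSet {N : ℕ} {P : Set (Fin N → ℝ)} (hP : IsPolytope P) :
    P = convexHull ℝ (vertexSet P) := by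
  obtain ⟨S, rfl⟩ := hP
  have hfin : (S : Set (Fin N → ℝ)).Finite := S.finite_toSet
  have h := closure_convexHull_extremePoints (hfin.isCompact_convexHull ℝ)
    (convex_convexHull ℝ (S : Set (Fin N → ℝ)))
  have hc : IsClosed (convexHull ℝ
      ((convexHull ℝ (S : Set (Fin N → ℝ))).extremePoints ℝ)) :=
    (hfin.subset extremePoints_convexHull_subset).isClosed_convexHull ℝ
  rw [hc.closure_eq] at h
  apply Subset.antisymm
  · conv_lhs => rw [← h]
    exact convexHull_mono fun s hs => isVertexOf_of_mem_extremePoints S hs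
  · exact convexHull_min (fun v hv => (IsFaceOf.subset hv) rfl) (convex_convexHull ℝ _)

/-- `P` has a slack lift with at most `n` coordinates. -/
def HasLift {N : ℕ} (P : Set (Fin N → ℝ)) (n : ℕ) : Prop :=
  ∃ (ι : Type) (_ : Fintype ι) (L : Submodule ℝ (ι → ℝ)) (ρ : (ι → ℝ) →ₗ[ℝ] ℝ)
    (T : (ι → ℝ) →ₗ[ℝ] (Fin N → ℝ)), Fintype.card ι ≤ n ∧ IsSlackLift P L ρ T

theorem HasLift.insert {N n : ℕ} {P : Set (Fin N → ℝ)} (h : HasLift P n) (v : Fin N → ℝ) :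
    HasLift (convexHull ℝ (P ∪ {v})) (n + 1) := by
  obtain ⟨ι, _, L, ρ, T, hc, hL⟩ := h
  obtain ⟨L', ρ', T', hL'⟩ := hL.exists_insert v
  exact ⟨Option ι, inferInstance, L', ρ', T', by simpa using hc, hL'⟩

theorem HasLift.union_finset {N n : ℕ} {S : Set (Fin N → ℝ)} (h : HasLift (convexHull ℝ S) n)
    (V : Finset (Fin N → ℝ)) : HasLift (convexHull ℝ (S ∪ V)) (n + V.card) := by
  classical
  induction V using Finset.induction with
  | empty => simpa using h
  | insert v V hv ih =>
    have := ih.insert v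
    rw [convexHull_convexHull_union_left] at this
    rw [Finset.card_insert_of_notMem hv, Finset.coe_insert, insert_eq, union_comm {v},
      ← union_assoc]
    exact this

theorem HasLift.xc_le {N n : ℕ} {P : Set (Fin N → ℝ)} (h : HasLift P n) (hP : P.Nonempty) :
    xc P ≤ n := by
  obtain ⟨ι, _, L, ρ, T, hc, hL⟩ := h
  rcases isEmpty_or_nonempty ι with hι | hι
  · obtain ⟨x, hx⟩ := hP
    rw [hL.image] at hx
    obtain ⟨y, ⟨_, _, hy1⟩, _⟩ := hx
    rw [Subsingleton.elim y 0, map_zero] at hy1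
    exact absurd hy1 zero_ne_one
  · exact hL.xc_le.trans hc

theorem IsPolytope.hasLift {N : ℕ} {P : Set (Fin N → ℝ)} (hP : IsPolytope P) :
    HasLift P (facetCount P) := by
  obtain ⟨G, L, ρ, T, hG, hL⟩ := exists_isSlackLift hP (AffineMap.id ℝ _) (by simp : _ = P)
  exact ⟨G, inferInstance, L, ρ, T, by simpa using hG, hL⟩

theorem IsKFoldPyramidOver.hasLift {N n : ℕ} {H : Set (Fin N → ℝ)} (hH : HasLift H n) :
    ∀ {k : ℕ} {P : Set (Fin N → ℝ)}, IsKFoldPyramidOver k P H → HasLift P (n + k)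
  | 0, _, h => by
    have h := h.symm
    subst h
    exact hH
  | _ + 1, _, ⟨_, ⟨a, _, hP⟩, h⟩ => hP ▸ (IsKFoldPyramidOver.hasLift hH h).insert a

theorem IsKFoldPyramidOver.base_subset {N : ℕ} {H : Set (Fin N → ℝ)} :
    ∀ {k : ℕ} {P : Set (Fin N → ℝ)}, IsKFoldPyramidOver k P H → H ⊆ P
  | 0, _, h => Eq.subset (Eq.symm h)
  | _ + 1, _, ⟨_, ⟨_, _, hP⟩, h⟩ => (IsKFoldPyramidOver.base_subset h).trans
      (hP ▸ subset_union_left.trans (subset_convexHull ℝ _))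

/-- Combinatorially equivalent sets have the same coatoms in their face lattices. -/
theorem CombEquiv.ncard_coatoms {M N : ℕ} {P : Set (Fin M → ℝ)} {Q : Set (Fin N → ℝ)}
    (h : CombEquiv P Q) :
    {F | IsCoatomFace F P}.ncard = {F | IsCoatomFace F Q}.ncard ∧
      ({F | IsCoatomFace F Q}.Finite → {F | IsCoatomFace F P}.Finite) := by
  obtain ⟨φ, hφ⟩ := h
  have hself : ∀ {K : ℕ} (X : Set (Fin K → ℝ)), IsFaceOf X X := fun X =>
    ⟨0, 0, by simp, by simp⟩
  have htop : (φ ⟨P, hself P⟩).1 = Q := by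
    refine (IsFaceOf.subset (φ _).2).antisymm ?_
    have := (hφ (φ.symm ⟨Q, hself Q⟩) ⟨P, hself P⟩).1 (φ.symm ⟨Q, hself Q⟩).2.subset
    simpa using this
  have hne : ∀ F, F.1 ≠ P ↔ (φ F).1 ≠ Q := by
    intro F
    rw [not_iff_not]
    constructor
    · intro h
      rw [show F = ⟨P, hself P⟩ from Subtype.ext h, htop]
    · intro h
      exact congrArg Subtype.val (φ.injective (Subtype.ext (h.trans htop.symm)))
  have hco : ∀ F, IsCoatomFace F.1 P ↔ IsCoatomFace (φ F).1 Q := by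
    intro F
    constructor
    · rintro ⟨h1, h2, h3⟩
      refine ⟨(φ F).2, (hne F).1 h2, fun G hG hFG hGQ => ?_⟩
      have h4 := h3 (φ.symm ⟨G, hG⟩).1 (φ.symm ⟨G, hG⟩).2 (by rw [hφ]; simpa using hFG)
        (by rw [hne]; simpa using hGQ)
      rw [show F = φ.symm ⟨G, hG⟩ from Subtype.ext h4]
      simp
    · rintro ⟨h1, h2, h3⟩
      refine ⟨F.2, (hne F).2 h2, fun G hG hFG hGP => ?_⟩
      have h4 := h3 (φ ⟨G, hG⟩).1 (φ ⟨G, hG⟩).2 ((hφ F ⟨G, hG⟩).1 hFG) ((hne ⟨G, hG⟩).1 hGP)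
      exact congrArg Subtype.val (φ.injective (Subtype.ext h4))
  constructor
  · refine ncard_congr (fun F hF => (φ ⟨F, hF.1⟩).1) (fun F hF => (hco ⟨F, hF.1⟩).1 hF) ?_ ?_
    · intro F G hF hG h
      exact congrArg Subtype.val (φ.injective (Subtype.ext h))
    · intro G hG
      refine ⟨(φ.symm ⟨G, hG.1⟩).1, (hco _).2 (by simpa using hG), by simp⟩
  · intro hfin
    refine (hfin.preimage (f := fun F : {F // IsFaceOf F P} => (φ F).1)
      (fun F _ G _ h => φ.injective (Subtype.ext h))).image Subtype.val |>.subset ?_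
    intro F hF
    exact ⟨⟨F, hF.1⟩, (hco _).1 hF, rfl⟩

/-- A set combinatorially equivalent to a polytope cut out by `n` inequalities has at most
`n` facets. -/
theorem CombEquiv.facetCount_le {M N : ℕ} {P : Set (Fin M → ℝ)} {ι : Type*} [Fintype ι] [Nonempty ι]
    {R : Submodule ℝ ((Fin N → ℝ) × ℝ)} {G : ι → (Fin N → ℝ) × ℝ →ₗ[ℝ] ℝ}
    (h : CombEquiv P (cutOut R G)) : facetCount P ≤ Fintype.card ι := by
  refine le_trans ?_ (h.ncard_coatoms.1.le.trans (cutOut_coatoms_ncard_le R G))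
  exact ncard_le_ncard (fun F hF => IsFacetOf.isCoatomFace hF)
    (h.ncard_coatoms.2 (cutOut_coatoms_finite R G))

/-! ### Faces of a convex hull in terms of index sets -/

theorem nonneg_of_mem_convexHull_range {N : ℕ} {X : Type*} [Fintype X] {p : X → Fin N → ℝ}
    {ψ : (Fin N → ℝ) × ℝ →ₗ[ℝ] ℝ} (hψ : ∀ x, 0 ≤ ψ (hom (p x))) {y : Fin N → ℝ}
    (hy : y ∈ convexHull ℝ (range p)) : 0 ≤ ψ (hom y) := by
  obtain ⟨c, hc, hcy⟩ := (mem_convexHull_range_iff_hom p y).1 hy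
  rw [← hcy, map_sum]
  refine Finset.sum_nonneg fun i hi => ?_
  rw [map_smul]
  exact mul_nonneg (hc i hi) (hψ i)

theorem face_convexHull_range {N : ℕ} {X : Type*} [Fintype X] {p : X → Fin N → ℝ}
    {ψ : (Fin N → ℝ) × ℝ →ₗ[ℝ] ℝ} (hψ : ∀ x, 0 ≤ ψ (hom (p x))) :
    {y ∈ convexHull ℝ (range p) | ψ (hom y) = 0} =
      convexHull ℝ (p '' {x | ψ (hom (p x)) = 0}) := by
  classical
  apply Subset.antisymm
  · rintro y ⟨hy, hy0⟩
    obtain ⟨c, hc, hcy⟩ := (mem_convexHull_range_iff_hom p y).1 hy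
    rw [← hcy, map_sum, Finset.sum_eq_zero_iff_of_nonneg (fun i hi => by
      rw [map_smul]; exact mul_nonneg (hc i hi) (hψ i))] at hy0
    have hci : ∀ i, ψ (hom (p i)) ≠ 0 → c i = 0 := fun i hi => by
      have := hy0 i (Finset.mem_univ i)
      rw [map_smul, smul_eq_mul, mul_eq_zero] at this
      exact this.resolve_right hi
    have h1 : ∑ i with ψ (hom (p i)) = 0, c i • p i = y := by
      have : ∑ i, c i • p i = y := by
        simpa [hom, Prod.fst_sum] using congrArg Prod.fst hcy
      rw [← this]
      refine Finset.sum_subset (Finset.subset_univ _) fun i _ hi => ?_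
      rw [hci i (by simpa using hi), zero_smul]
    have h2 : ∑ i with ψ (hom (p i)) = 0, c i = 1 := by
      have : ∑ i, c i = 1 := by
        simpa [hom, Prod.snd_sum] using congrArg Prod.snd hcy
      rw [← this]
      exact Finset.sum_subset (Finset.subset_univ _) fun i _ hi => hci i (by simpa using hi)
    rw [← h1]
    exact (convex_convexHull ℝ _).sum_mem (fun i _ => hc i (Finset.mem_univ i)) h2
      fun i hi => subset_convexHull ℝ _ ⟨i, (Finset.mem_filter.1 hi).2, rfl⟩
  · intro y hy
    refine ⟨convexHull_mono (image_subset_range _ _) hy, ?_⟩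
    refine convexHull_min (t := {z | ψ (hom z) = 0}) ?_ ?_ hy
    · rintro _ ⟨x, hx, rfl⟩
      exact hx
    · intro u hu v hv a b _ _ hab
      have : hom (a • u + b • v) = a • hom u + b • hom v := by
        ext <;> simp [hom, hab]
      have hu : ψ (hom u) = 0 := hu
      have hv : ψ (hom v) = 0 := hv
      change ψ (hom (a • u + b • v)) = 0
      rw [this, map_add, map_smul, map_smul, hu, hv, smul_zero, smul_zero, add_zero]

/-- The index set `J` is cut out by a supporting hyperplane of the family `p`. -/
def IsExposedIndex {N : ℕ} {X : Type*} (p : X → Fin N → ℝ) (J : Set X) : Prop :=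
  ∃ ψ : (Fin N → ℝ) × ℝ →ₗ[ℝ] ℝ, ∀ x, 0 ≤ ψ (hom (p x)) ∧ (ψ (hom (p x)) = 0 ↔ x ∈ J)

theorem IsExposedIndex.isFaceOf {N : ℕ} {X : Type*} [Fintype X] {p : X → Fin N → ℝ} {J : Set X}
    (h : IsExposedIndex p J) : IsFaceOf (convexHull ℝ (p '' J)) (convexHull ℝ (range p)) ∧
      {x | p x ∈ convexHull ℝ (p '' J)} = J := by
  obtain ⟨ψ, hψ⟩ := h
  have hJ : {x | ψ (hom (p x)) = 0} = J := by
    ext x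
    exact (hψ x).2
  have hF := face_convexHull_range fun x => (hψ x).1
  rw [hJ] at hF
  refine ⟨isFaceOf_iff.2 ⟨ψ, fun y hy =>
    nonneg_of_mem_convexHull_range (fun x => (hψ x).1) hy, hF.symm⟩, ?_⟩
  rw [← hF]
  ext x
  rw [← (hψ x).2]
  exact ⟨fun h => h.2, fun h => ⟨subset_convexHull ℝ _ ⟨x, rfl⟩, h⟩⟩

theorem IsFaceOf.isExposedIndex {N : ℕ} {X : Type*} [Fintype X] {p : X → Fin N → ℝ}
    {F : Set (Fin N → ℝ)} (h : IsFaceOf F (convexHull ℝ (range p))) :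
    IsExposedIndex p {x | p x ∈ F} ∧ F = convexHull ℝ (p '' {x | p x ∈ F}) := by
  obtain ⟨ψ, hψ, rfl⟩ := isFaceOf_iff.1 h
  have hp : ∀ x, p x ∈ convexHull ℝ (range p) := fun x => subset_convexHull ℝ _ ⟨x, rfl⟩
  have hJ : {x | p x ∈ {y ∈ convexHull ℝ (range p) | ψ (hom y) = 0}} =
      {x | ψ (hom (p x)) = 0} := by
    ext x
    exact ⟨fun h => h.2, fun h => ⟨hp x, h⟩⟩
  rw [hJ]
  exact ⟨⟨ψ, fun x => ⟨hψ _ (hp x), Iff.rfl⟩⟩, face_convexHull_range fun x => hψ _ (hp x)⟩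

theorem combEquiv_of_isExposedIndex_iff {M N : ℕ} {X : Type*} [Fintype X] (p : X → Fin M → ℝ)
    (q : X → Fin N → ℝ) (h : ∀ J, IsExposedIndex p J ↔ IsExposedIndex q J) :
    CombEquiv (convexHull ℝ (range p)) (convexHull ℝ (range q)) := by
  refine ⟨{
    toFun := fun F => ⟨convexHull ℝ (q '' {x | p x ∈ F.1}),
      ((h _).1 F.2.isExposedIndex.1).isFaceOf.1⟩
    invFun := fun F => ⟨convexHull ℝ (p '' {x | q x ∈ F.1}),
      ((h _).2 F.2.isExposedIndex.1).isFaceOf.1⟩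
    left_inv := fun F => ?_
    right_inv := fun F => ?_ }, fun F₁ F₂ => ?_⟩
  · refine Subtype.ext ?_
    change convexHull ℝ (p '' {x | q x ∈ convexHull ℝ (q '' {x | p x ∈ F.1})}) = F.1
    rw [((h _).1 F.2.isExposedIndex.1).isFaceOf.2]
    exact F.2.isExposedIndex.2.symm
  · refine Subtype.ext ?_
    change convexHull ℝ (q '' {x | p x ∈ convexHull ℝ (p '' {x | q x ∈ F.1})}) = F.1
    rw [((h _).2 F.2.isExposedIndex.1).isFaceOf.2]
    exact F.2.isExposedIndex.2.symm
  · change F₁.1 ⊆ F₂.1 ↔ convexHull ℝ (q '' {x | p x ∈ F₁.1}) ⊆ convexHull ℝ (q '' {x | p x ∈ F₂.1})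
    constructor
    · intro h12
      exact convexHull_mono (image_mono fun x hx => h12 hx)
    · intro h12
      rw [F₁.2.isExposedIndex.2, F₂.2.isExposedIndex.2]
      refine convexHull_mono (image_mono ?_)
      rw [← ((h _).1 F₁.2.isExposedIndex.1).isFaceOf.2,
        ← ((h _).1 F₂.2.isExposedIndex.1).isFaceOf.2]
      exact fun x hx => h12 hx

/-! ### The triangular prism -/

/-- After a positive rescaling, the linear functionals take on the homogenized family exactly
the values `s i + t j`. -/
def IsPrismFamily {N : ℕ} (p : Fin 2 × Fin 3 → Fin N → ℝ) : Prop :=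
  ∃ w : Fin 2 × Fin 3 → ℝ, (∀ x, 0 < w x) ∧
    (∀ ψ : (Fin N → ℝ) × ℝ →ₗ[ℝ] ℝ, ∃ (s : Fin 2 → ℝ) (t : Fin 3 → ℝ),
      ∀ x, w x * ψ (hom (p x)) = s x.1 + t x.2) ∧
    ∀ (s : Fin 2 → ℝ) (t : Fin 3 → ℝ), ∃ ψ : (Fin N → ℝ) × ℝ →ₗ[ℝ] ℝ,
      ∀ x, w x * ψ (hom (p x)) = s x.1 + t x.2

theorem IsPrismFamily.isExposedIndex_iff {N : ℕ} {p : Fin 2 × Fin 3 → Fin N → ℝ}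
    (h : IsPrismFamily p) (J : Set (Fin 2 × Fin 3)) :
    IsExposedIndex p J ↔ ∃ (s : Fin 2 → ℝ) (t : Fin 3 → ℝ),
      ∀ x, 0 ≤ s x.1 + t x.2 ∧ (s x.1 + t x.2 = 0 ↔ x ∈ J) := by
  obtain ⟨w, hw, h1, h2⟩ := h
  have key : ∀ x (r : ℝ), (0 ≤ r ↔ 0 ≤ w x * r) ∧ (r = 0 ↔ w x * r = 0) := fun x r =>
    ⟨(mul_nonneg_iff_of_pos_left (hw x)).symm, by simp [(hw x).ne']⟩
  constructor
  · rintro ⟨ψ, hψ⟩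
    obtain ⟨s, t, hst⟩ := h1 ψ
    refine ⟨s, t, fun x => ?_⟩
    rw [← hst, ← (key x _).1, ← (key x _).2]
    exact hψ x
  · rintro ⟨s, t, hst⟩
    obtain ⟨ψ, hψ⟩ := h2 s t
    refine ⟨ψ, fun x => ?_⟩
    rw [(key x _).1, (key x _).2, hψ]
    exact hst x

def prismVertex₁ : Fin 2 → Fin 1 → ℝ := ![![1], ![-1]]

def prismVertex₂ : Fin 3 → Fin 2 → ℝ := ![![1, 0], ![0, 1], ![-1, -1]]

def prismVertex (x : Fin 2 × Fin 3) : Fin (1 + 2) → ℝ :=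
  Fin.append (prismVertex₁ x.1) (prismVertex₂ x.2)

theorem simplexF_one : simplexF 1 = convexHull ℝ (range prismVertex₁) := by
  rw [simplexF]
  congr 1
  ext a
  constructor
  · rintro (⟨i, rfl⟩ | rfl)
    · exact ⟨0, by ext j; fin_cases i; fin_cases j; simp [prismVertex₁]⟩
    · exact ⟨1, by ext j; fin_cases j; simp [prismVertex₁]⟩
  · rintro ⟨i, rfl⟩
    fin_cases i
    · exact Or.inl ⟨0, by ext j; fin_cases j; simp [prismVertex₁]⟩
    · exact Or.inr (by ext j; fin_cases j; simp [prismVertex₁])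

theorem simplexF_two : simplexF 2 = convexHull ℝ (range prismVertex₂) := by
  rw [simplexF]
  congr 1
  ext a
  constructor
  · rintro (⟨i, rfl⟩ | rfl)
    · fin_cases i
      · exact ⟨0, by ext j; fin_cases j <;> simp [prismVertex₂]⟩
      · exact ⟨1, by ext j; fin_cases j <;> simp [prismVertex₂]⟩
    · exact ⟨2, by ext j; fin_cases j <;> simp [prismVertex₂]⟩
  · rintro ⟨i, rfl⟩
    fin_cases i
    · exact Or.inl ⟨0, by ext j; fin_cases j <;> simp [prismVertex₂]⟩
    · exact Or.inl ⟨1, by ext j; fin_cases j <;> simp [prismVertex₂]⟩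
    · exact Or.inr (by ext j; fin_cases j <;> simp [prismVertex₂])

/-- `Fin.append` as a linear map. -/
def appendLinear (m n : ℕ) : (Fin m → ℝ) × (Fin n → ℝ) →ₗ[ℝ] (Fin (m + n) → ℝ) where
  toFun z := Fin.append z.1 z.2
  map_add' y z := by
    ext i
    refine Fin.addCases (fun i => ?_) (fun i => ?_) i <;> simp
  map_smul' c z := by
    ext i
    refine Fin.addCases (fun i => ?_) (fun i => ?_) i <;> simp

theorem prodP_one_two : prodP 1 2 = convexHull ℝ (range prismVertex) := by
  have h1 : prodP 1 2 = appendLinear 1 2 '' (simplexF 1 ×ˢ simplexF 2) := by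
    ext z
    constructor
    · rintro ⟨a, ha, b, hb, rfl⟩
      exact ⟨(a, b), ⟨ha, hb⟩, rfl⟩
    · rintro ⟨⟨a, b⟩, ⟨ha, hb⟩, rfl⟩
      exact ⟨a, ha, b, hb, rfl⟩
  rw [h1, simplexF_one, simplexF_two, ← convexHull_prod, LinearMap.image_convexHull,
    ← range_prodMap, ← range_comp]
  rfl

theorem isPrismFamily_prismVertex : IsPrismFamily prismVertex := by
  refine ⟨fun _ => 1, fun _ => one_pos, fun ψ => ?_, fun s t => ?_⟩
  · refine ⟨fun i => ψ (Fin.append (prismVertex₁ i) 0, 0),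
      fun j => ψ (Fin.append 0 (prismVertex₂ j), 1), fun x => ?_⟩
    rw [one_mul, ← map_add]
    congr 1
    ext i
    · refine Fin.addCases (fun i => ?_) (fun i => ?_) i <;> simp [hom, prismVertex]
    · simp [hom]
  · let g := (t 0 + t 1 + t 2) / 3
    let pr : Fin (1 + 2) → (Fin (1 + 2) → ℝ) × ℝ →ₗ[ℝ] ℝ := fun i =>
      LinearMap.proj i ∘ₗ LinearMap.fst ℝ _ _
    refine ⟨((s 0 - s 1) / 2) • pr (Fin.castAdd 2 0) + (t 0 - g) • pr (Fin.natAdd 1 0) +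
      (t 1 - g) • pr (Fin.natAdd 1 1) + ((s 0 + s 1) / 2 + g) • LinearMap.snd ℝ _ _, ?_⟩
    rintro ⟨i, j⟩
    simp only [one_mul, LinearMap.add_apply, LinearMap.smul_apply, pr, LinearMap.comp_apply,
      LinearMap.fst_apply, LinearMap.proj_apply, LinearMap.snd_apply, hom, prismVertex,
      Fin.append_left, Fin.append_right, smul_eq_mul]
    fin_cases i <;> fin_cases j <;> simp [prismVertex₁, prismVertex₂, g] <;> ring

theorem IsPrismFamily.combEquiv {N : ℕ} {p : Fin 2 × Fin 3 → Fin N → ℝ} (h : IsPrismFamily p) :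
    CombEquiv (convexHull ℝ (range p)) (prodP 1 2) := by
  rw [prodP_one_two]
  exact combEquiv_of_isExposedIndex_iff p prismVertex fun J => by
    rw [h.isExposedIndex_iff, isPrismFamily_prismVertex.isExposedIndex_iff]

/-- The five facet-defining functionals of the standard prism. -/
def prismFacet : Fin 5 → (Fin (1 + 2) → ℝ) × ℝ →ₗ[ℝ] ℝ :=
  let a : (Fin (1 + 2) → ℝ) × ℝ →ₗ[ℝ] ℝ := LinearMap.proj (Fin.castAdd 2 0) ∘ₗ LinearMap.fst ℝ _ _
  let b : Fin 2 → (Fin (1 + 2) → ℝ) × ℝ →ₗ[ℝ] ℝ := fun j =>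
    LinearMap.proj (Fin.natAdd 1 j) ∘ₗ LinearMap.fst ℝ _ _
  let c : (Fin (1 + 2) → ℝ) × ℝ →ₗ[ℝ] ℝ := LinearMap.snd ℝ _ _
  ![c + a, c - a, c - b 0 - b 1, c + (2 : ℝ) • b 0 - b 1, c - b 0 + (2 : ℝ) • b 1]

theorem prismFacet_hom_append (k : Fin 5) (a : Fin 1 → ℝ) (b : Fin 2 → ℝ) :
    prismFacet k (hom (Fin.append a b)) =
      ![1 + a 0, 1 - a 0, 1 - b 0 - b 1, 1 + 2 * b 0 - b 1, 1 - b 0 + 2 * b 1] k := by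
  have h0 : Fin.append a b 0 = a 0 := rfl
  have h1 : Fin.append a b 1 = b 0 := rfl
  have h2 : Fin.append a b 2 = b 1 := rfl
  fin_cases k <;> simp [prismFacet, hom, h0, h1, h2]

theorem prodP_one_two_eq_cutOut : prodP 1 2 = cutOut ⊤ prismFacet := by
  apply Subset.antisymm
  · rw [prodP_one_two]
    intro z hz
    refine ⟨Submodule.mem_top, fun k => nonneg_of_mem_convexHull_range ?_ hz⟩
    rintro ⟨i, j⟩
    rw [prismVertex, prismFacet_hom_append]
    fin_cases k <;> fin_cases i <;> fin_cases j <;> norm_num [prismVertex₁, prismVertex₂]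
  · rintro z ⟨-, hz⟩
    have h0 := hz 0
    have h1 := hz 1
    have h2 := hz 2
    have h3 := hz 3
    have h4 := hz 4
    simp [prismFacet, hom] at h0 h1 h2 h3 h4
    refine ⟨fun i => z (Fin.castAdd 2 i), ?_, fun i => z (Fin.natAdd 1 i), ?_, ?_⟩
    · rw [simplexF_one]
      have := (convex_convexHull ℝ (range prismVertex₁)) (subset_convexHull ℝ _ ⟨0, rfl⟩)
        (subset_convexHull ℝ _ ⟨1, rfl⟩)
        (a := (1 + z 0) / 2) (b := (1 - z 0) / 2) (by linarith) (by linarith) (by ring)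
      convert this using 1
      ext j
      fin_cases j
      simp [prismVertex₁]
      ring
    · rw [simplexF_two]
      have := (convex_convexHull ℝ (range prismVertex₂)).sum_mem (t := Finset.univ)
        (w := ![(1 + 2 * z 1 - z 2) / 3, (1 - z 1 + 2 * z 2) / 3, (1 - z 1 - z 2) / 3])
        (z := prismVertex₂) (by
          intro i _
          fin_cases i <;> simp <;> linarith) (by simp [Fin.sum_univ_three]; ring)
        (fun i _ => subset_convexHull ℝ _ ⟨i, rfl⟩)
      convert this using 1
      ext j
      fin_cases j <;> simp [prismVertex₂, Fin.sum_univ_three] <;> ring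
    · ext i
      refine Fin.addCases (fun i => ?_) (fun i => ?_) i <;> simp

theorem facetCount_le_of_combEquiv_prism {N : ℕ} {P : Set (Fin N → ℝ)}
    (h : CombEquiv P (prodP 1 2)) : facetCount P ≤ 5 := by
  rw [prodP_one_two_eq_cutOut] at h
  simpa using h.facetCount_le

theorem hasLift_of_prism {N d : ℕ} {P : Set (Fin N → ℝ)} (hP : IsPolytope P)
    (hv : vertexCount P = d + 4) {S : Finset (Fin N → ℝ)}
    (hS : (S : Set (Fin N → ℝ)) ⊆ vertexSet P) (hcard : S.card = 6)
    (h : CombEquiv (convexHull ℝ (S : Set (Fin N → ℝ))) (prodP 1 2)) : HasLift P (d + 3) := by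
  classical
  have hfin : (vertexSet P).Finite := finite_of_ncard_pos (by rw [vertexCount] at hv; omega)
  have hsub : S ⊆ hfin.toFinset := fun x hx => hfin.mem_toFinset.2 (hS hx)
  have hc : hfin.toFinset.card = d + 4 := by
    rw [← hv, vertexCount, ncard_eq_toFinset_card _ hfin]
  have hc' : (hfin.toFinset \ S).card = d + 4 - 6 := by
    rw [Finset.card_sdiff_of_subset hsub, hc, hcard]
  have h6 : 6 ≤ d + 4 := by
    rw [← hc, ← hcard]
    exact Finset.card_le_card hsub
  have hlift : HasLift (convexHull ℝ (S : Set (Fin N → ℝ))) 5 := by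
    obtain ⟨ι, i, L, ρ, T, hle, hL⟩ := IsPolytope.hasLift (P := convexHull ℝ
      (S : Set (Fin N → ℝ))) ⟨S, rfl⟩
    exact ⟨ι, i, L, ρ, T, hle.trans (facetCount_le_of_combEquiv_prism h), hL⟩
  have := hlift.union_finset (hfin.toFinset \ S)
  rw [hc', ← Finset.coe_union, Finset.union_sdiff_of_subset hsub, hfin.coe_toFinset,
    ← hP.eq_convexHull_vertexSet] at this
  convert this using 1
  omega

/-! ### Generators of the nonnegative part of a hyperplane -/

theorem coneOf_sum {ι κ V : Type*} [AddCommGroup V] [Module ℝ V] {s : Finset ι} {p : ι → V}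
    (t : Finset κ) {f : κ → V} (h : ∀ k ∈ t, f k ∈ coneOf s p) : ∑ k ∈ t, f k ∈ coneOf s p := by
  classical
  induction t using Finset.induction with
  | empty => exact ⟨0, by simp, by simp⟩
  | insert a t ha ih =>
    rw [Finset.sum_insert ha]
    exact coneOf_add (h a (Finset.mem_insert_self a t))
      (ih fun k hk => h k (Finset.mem_insert_of_mem hk))

theorem mem_coneOf_univ {ι V : Type*} [Fintype ι] [AddCommGroup V] [Module ℝ V] (p : ι → V)
    (i : ι) : p i ∈ coneOf Finset.univ p := by
  classical
  refine ⟨Pi.single i 1, fun j _ => ?_, by simp [Pi.single_apply, ite_smul]⟩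
  by_cases hj : j = i
  · simp [hj]
  · simp [hj]

/-- Index type for the extreme rays of the nonnegative part of the hyperplane normal to `α`. -/
abbrev RayIndex {ι : Type*} (α : ι → ℝ) : Type _ :=
  ({i // 0 < α i} × {i // α i < 0}) ⊕ {i // α i = 0}

/-- The support of an extreme ray. -/
def raySupp {ι : Type*} {α : ι → ℝ} : RayIndex α → Set ι :=
  Sum.elim (fun x => {x.1.1, x.2.1}) (fun k => {k.1})

/-- The weights normalizing the hyperplane normal to `α` to have coefficients in `{-1, 0, 1}`. -/
def rayWeight {ι : Type*} (α : ι → ℝ) (l : ι) : ℝ :=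
  if α l = 0 then 1 else |α l|⁻¹

/-- The extreme ray generators of the nonnegative part of the hyperplane normal to `α`. -/
def rayVec {ι : Type*} (α : ι → ℝ) (x : RayIndex α) : ι → ℝ :=
  (raySupp x).indicator (rayWeight α)

theorem rayWeight_pos {ι : Type*} (α : ι → ℝ) (l : ι) : 0 < rayWeight α l := by
  rw [rayWeight]
  split_ifs with h
  · exact one_pos
  · positivity

theorem rayWeight_of_pos {ι : Type*} {α : ι → ℝ} {l : ι} (h : 0 < α l) :
    rayWeight α l = (α l)⁻¹ := by
  rw [rayWeight, if_neg h.ne', abs_of_pos h]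

theorem rayWeight_of_neg {ι : Type*} {α : ι → ℝ} {l : ι} (h : α l < 0) :
    rayWeight α l = (-α l)⁻¹ := by
  rw [rayWeight, if_neg h.ne, abs_of_neg h]

theorem rayVec_nonneg {ι : Type*} (α : ι → ℝ) (x : RayIndex α) (l : ι) : 0 ≤ rayVec α x l :=
  indicator_nonneg (fun l _ => (rayWeight_pos α l).le) l

theorem rayVec_eq_zero_iff {ι : Type*} {α : ι → ℝ} {x : RayIndex α} {l : ι} :
    rayVec α x l = 0 ↔ l ∉ raySupp x := by
  rw [rayVec, indicator_apply_eq_zero]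
  exact ⟨fun h hl => (rayWeight_pos α l).ne' (h hl), fun h hl => absurd hl h⟩

theorem raySupp_nonempty {ι : Type*} {α : ι → ℝ} (x : RayIndex α) : (raySupp x).Nonempty := by
  rcases x with x | k
  · exact ⟨x.1.1, Or.inl rfl⟩
  · exact ⟨k.1, rfl⟩

theorem rayVec_ne_zero {ι : Type*} {α : ι → ℝ} (x : RayIndex α) : rayVec α x ≠ 0 := by
  intro h
  obtain ⟨l, hl⟩ := raySupp_nonempty x
  exact rayVec_eq_zero_iff.1 (congrFun h l) hl

theorem raySupp_injective {ι : Type*} {α : ι → ℝ} {x y : RayIndex α}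
    (h : raySupp x ⊆ raySupp y) : x = y := by
  rcases x with ⟨⟨i, hi⟩, ⟨j, hj⟩⟩ | ⟨k, hk⟩ <;> rcases y with ⟨⟨i', hi'⟩, ⟨j', hj'⟩⟩ | ⟨k', hk'⟩
  · have h1 : i = i' := by
      rcases h (Or.inl rfl : i ∈ _) with h | h
      · exact h
      · have h : i = j' := h
        subst h
        exact absurd hi hj'.not_gt
    have h2 : j = j' := by
      rcases h (Or.inr rfl : j ∈ _) with h | h
      · have h : j = i' := h
        subst h
        exact absurd hj hi'.not_gt
      · exact h
    subst h1 h2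
    rfl
  · have h1 : i = k' := h (Or.inl rfl : i ∈ _)
    subst h1
    exact absurd hk' hi.ne'
  · rcases h (rfl : k ∈ ({k} : Set ι)) with h | h
    · have h : k = i' := h
      subst h
      exact absurd hk hi'.ne'
    · have h : k = j' := h
      subst h
      exact absurd hk hj'.ne
  · have h1 : k = k' := h (rfl : k ∈ ({k} : Set ι))
    subst h1
    rfl

section Rays

variable {ι : Type*} [DecidableEq ι] {α : ι → ℝ}

theorem rayVec_inl (i : {i // 0 < α i}) (j : {i // α i < 0}) :
    rayVec α (Sum.inl (i, j)) = Pi.single i.1 (rayWeight α i.1) + Pi.single j.1 (rayWeight α j.1) := by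
  have hij : i.1 ≠ j.1 := fun h => by
    have h1 := i.2
    have h2 := j.2
    rw [h] at h1
    exact lt_asymm h1 h2
  ext l
  simp only [rayVec, raySupp, Sum.elim_inl, indicator_apply, mem_insert_iff, mem_singleton_iff,
    Pi.add_apply, Pi.single_apply]
  by_cases h1 : l = i.1
  · subst h1
    simp [hij]
  · by_cases h2 : l = j.1
    · subst h2
      simp [h1]
    · simp [h1, h2]

theorem rayVec_inr (k : {i // α i = 0}) : rayVec α (Sum.inr k) = Pi.single k.1 (rayWeight α k.1) := by
  ext l
  simp only [rayVec, raySupp, Sum.elim_inr, indicator_apply, mem_singleton_iff, Pi.single_apply]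
  by_cases h1 : l = k.1
  · subst h1
    simp
  · simp [h1]

variable [Fintype ι]

theorem sum_mul_rayVec (x : RayIndex α) : ∑ l, α l * rayVec α x l = 0 := by
  have hs : ∀ i, ∑ l, α l * Pi.single (M := fun _ => ℝ) i (rayWeight α i) l =
      α i * rayWeight α i := by
    intro i
    simp [Pi.single_apply]
  rcases x with ⟨i, j⟩ | k
  · simp only [rayVec_inl, Pi.add_apply, mul_add, Finset.sum_add_distrib, hs]
    have h1 := i.2
    have h2 := j.2
    rw [rayWeight_of_pos h1, rayWeight_of_neg h2, mul_inv_cancel₀ h1.ne']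
    rw [inv_neg, mul_neg, mul_inv_cancel₀ h2.ne, add_neg_cancel]
  · rw [rayVec_inr, hs, k.2, zero_mul]

theorem sum_eq_sum_sign {ι V : Type*} [Fintype ι] [AddCommGroup V] (α : ι → ℝ) (f : ι → V) :
    ∑ l, f l = ∑ l with 0 < α l, f l + ∑ l with α l < 0, f l + ∑ l with α l = 0, f l := by
  simp only [Finset.sum_filter, ← Finset.sum_add_distrib]
  refine Finset.sum_congr rfl fun l _ => ?_
  rcases lt_trichotomy (α l) 0 with h | h | h
  · simp [h, h.not_gt, h.ne]
  · simp [h]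
  · simp [h, h.not_gt, h.ne.symm]

/-- The rays generate the nonnegative part of the hyperplane. -/
theorem mem_coneOf_rayVec {y : ι → ℝ} (hy0 : ∀ l, 0 ≤ y l) (hy : ∑ l, α l * y l = 0) :
    y ∈ coneOf Finset.univ (rayVec α) := by
  let a : ι → ℝ := fun l => y l / rayWeight α l
  let e : ι → ι → ℝ := fun l => Pi.single l (rayWeight α l)
  have ha0 : ∀ l, 0 ≤ a l := fun l => div_nonneg (hy0 l) (rayWeight_pos α l).le
  have hya : y = ∑ l, a l • e l := by
    ext k
    simp [e, a, Finset.sum_apply, Pi.single_apply, (rayWeight_pos α k).ne']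
  let A := Finset.univ.filter fun l => 0 < α l
  let B := Finset.univ.filter fun l => α l < 0
  let Z := Finset.univ.filter fun l => α l = 0
  set σ := ∑ l ∈ A, a l with hσ
  have hσB : ∑ l ∈ B, a l = σ := by
    have h1 := sum_eq_sum_sign α fun l => α l * y l
    rw [hy] at h1
    change 0 = ∑ l ∈ A, α l * y l + ∑ l ∈ B, α l * y l + ∑ l ∈ Z, α l * y l at h1
    have h2 : ∑ l ∈ A, α l * y l = σ := Finset.sum_congr rfl fun l hl => by
      simp only [a]
      rw [rayWeight_of_pos (Finset.mem_filter.1 hl).2, div_inv_eq_mul, mul_comm]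
    have h3 : ∑ l ∈ B, α l * y l = -∑ l ∈ B, a l := by
      rw [← Finset.sum_neg_distrib]
      refine Finset.sum_congr rfl fun l hl => ?_
      simp only [a]
      rw [rayWeight_of_neg (Finset.mem_filter.1 hl).2, div_inv_eq_mul]
      ring
    have h4 : ∑ l ∈ Z, α l * y l = 0 := Finset.sum_eq_zero fun l hl => by
      rw [(Finset.mem_filter.1 hl).2, zero_mul]
    rw [h2, h3, h4] at h1
    linarith
  have hcancel : ∀ s : Finset ι, ∑ l ∈ s, a l = σ → ∀ l ∈ s, a l / σ * σ = a l := by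
    intro s hs l hl
    by_cases h0 : σ = 0
    · rw [h0] at hs
      rw [(Finset.sum_eq_zero_iff_of_nonneg fun l _ => ha0 l).1 hs l hl, zero_div, zero_mul]
    · exact div_mul_cancel₀ _ h0
  have hAB : ∑ l ∈ A, a l • e l + ∑ l ∈ B, a l • e l =
      ∑ i ∈ A, ∑ j ∈ B, (a i * a j / σ) • (e i + e j) := by
    simp only [smul_add, Finset.sum_add_distrib]
    congr 1
    · refine Finset.sum_congr rfl fun i hi => ?_
      rw [← Finset.sum_smul, ← Finset.sum_div, ← Finset.mul_sum, hσB, mul_div_right_comm,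
        hcancel A rfl i hi]
    · rw [Finset.sum_comm]
      refine Finset.sum_congr rfl fun j hj => ?_
      rw [← Finset.sum_smul, ← Finset.sum_div, ← Finset.sum_mul, ← hσ, mul_comm σ,
        mul_div_right_comm, hcancel B hσB j hj]
  have hσ0 : 0 ≤ σ := Finset.sum_nonneg fun l _ => ha0 l
  have hy' := sum_eq_sum_sign α fun l => a l • e l
  rw [← hya] at hy'
  rw [hy']
  change ∑ l ∈ A, a l • e l + ∑ l ∈ B, a l • e l + ∑ l ∈ Z, a l • e l ∈ _
  rw [hAB]
  refine coneOf_add (coneOf_sum _ fun i hi => coneOf_sum _ fun j hj => ?_)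
    (coneOf_sum _ fun k hk => ?_)
  · refine coneOf_smul ?_ (div_nonneg (mul_nonneg (ha0 i) (ha0 j)) hσ0)
    have h := mem_coneOf_univ (rayVec α)
      (Sum.inl (⟨i, (Finset.mem_filter.1 hi).2⟩, ⟨j, (Finset.mem_filter.1 hj).2⟩))
    rwa [rayVec_inl] at h
  · refine coneOf_smul ?_ (ha0 k)
    have h := mem_coneOf_univ (rayVec α) (Sum.inr ⟨k, (Finset.mem_filter.1 hk).2⟩)
    rwa [rayVec_inr] at h

end Rays

/-- A slack lift from generators of the nonnegative part of `L`. -/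
theorem isSlackLift_of_generators {ι X : Type*} [Fintype X] {N : ℕ}
    {L : Submodule ℝ (ι → ℝ)} {ρ : (ι → ℝ) →ₗ[ℝ] ℝ} {T : (ι → ℝ) →ₗ[ℝ] (Fin N → ℝ)}
    (g : X → ι → ℝ) (hgL : ∀ x, g x ∈ L) (hg0 : ∀ x i, 0 ≤ g x i) (hgρ : ∀ x, 0 < ρ (g x))
    (hgen : ∀ y ∈ L, (∀ i, 0 ≤ y i) → y ∈ coneOf Finset.univ g) :
    IsSlackLift (convexHull ℝ (range fun x => (ρ (g x))⁻¹ • T (g x))) L ρ T := by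
  classical
  have hslack : slackSet L ρ = convexHull ℝ (range fun x => (ρ (g x))⁻¹ • g x) := by
    apply Subset.antisymm
    · rintro y ⟨hy, hy0, hy1⟩
      obtain ⟨c, hc, rfl⟩ := hgen y hy hy0
      have h1 : ∑ x, c x * ρ (g x) = 1 := by
        rw [← hy1, map_sum]
        simp
      have h2 : ∑ x, c x • g x = ∑ x, (c x * ρ (g x)) • ((ρ (g x))⁻¹ • g x) :=
        Finset.sum_congr rfl fun x _ => by
          rw [smul_smul, mul_assoc, mul_inv_cancel₀ (hgρ x).ne', mul_one]
      rw [h2]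
      exact (convex_convexHull ℝ _).sum_mem (fun x hx => mul_nonneg (hc x hx) (hgρ x).le) h1
        fun x _ => subset_convexHull ℝ _ ⟨x, rfl⟩
    · refine convexHull_min ?_ (convex_slackSet L ρ)
      rintro _ ⟨x, rfl⟩
      refine ⟨L.smul_mem _ (hgL x), fun i => mul_nonneg (inv_nonneg.2 (hgρ x).le) (hg0 x i), ?_⟩
      rw [map_smul, smul_eq_mul, inv_mul_cancel₀ (hgρ x).ne']
  refine ⟨fun y hy hy0 hne => ?_, ⟨Finset.univ.image fun x => (ρ (g x))⁻¹ • g x, ?_⟩, ?_⟩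
  · obtain ⟨c, hc, rfl⟩ := hgen y hy hy0
    rw [map_sum]
    obtain ⟨x, -, hx⟩ := Finset.exists_ne_zero_of_sum_ne_zero hne
    have hcx : c x ≠ 0 := fun h => hx (by rw [h, zero_smul])
    refine Finset.sum_pos' (fun x hx => ?_) ⟨x, Finset.mem_univ _, ?_⟩
    · rw [map_smul]
      exact mul_nonneg (hc x hx) (hgρ x).le
    · rw [map_smul]
      exact mul_pos (lt_of_le_of_ne (hc x (Finset.mem_univ _)) hcx.symm) (hgρ x)
  · rw [hslack, Finset.coe_image, Finset.coe_univ, image_univ]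
  · rw [hslack, LinearMap.image_convexHull, ← range_comp]
    simp [Function.comp_def]

/-! ### Desarguian hexagons -/

theorem hasLift_of_concurrent {N : ℕ} (p : Fin 2 × Fin 3 → Fin N → ℝ) (c : Fin 2 × Fin 3 → ℝ)
    (hc : ∀ x, 0 < c x) (w : (Fin N → ℝ) × ℝ)
    (hw : ∀ j, w = c (0, j) • hom (p (0, j)) - c (1, j) • hom (p (1, j))) :
    HasLift (convexHull ℝ (range p)) 5 := by
  let α : Fin 2 ⊕ Fin 3 → ℝ := Sum.elim (fun _ => 1) (fun _ => -1)
  let Φ : (Fin 2 ⊕ Fin 3 → ℝ) →ₗ[ℝ] (Fin N → ℝ) × ℝ :=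
    ∑ j, (LinearMap.proj (Sum.inr j)).smulRight (c (0, j) • hom (p (0, j))) -
      (LinearMap.proj (Sum.inl 1)).smulRight w
  let L : Submodule ℝ (Fin 2 ⊕ Fin 3 → ℝ) :=
    LinearMap.ker (∑ l, α l • (LinearMap.proj l : (Fin 2 ⊕ Fin 3 → ℝ) →ₗ[ℝ] ℝ))
  let g : Fin 2 × Fin 3 → Fin 2 ⊕ Fin 3 → ℝ :=
    fun x => Pi.single (Sum.inl x.1) 1 + Pi.single (Sum.inr x.2) 1
  have hL : ∀ y, y ∈ L ↔ ∑ l, α l * y l = 0 := fun y => by simp [L, LinearMap.mem_ker]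
  have hΦ : ∀ x, Φ (g x) = c x • hom (p x) := by
    rintro ⟨i, j⟩
    have h1 : ∀ y, Φ y = ∑ j, y (Sum.inr j) • c (0, j) • hom (p (0, j)) - y (Sum.inl 1) • w :=
      fun y => by simp [Φ]
    rw [h1]
    fin_cases i
    · simp [g, Pi.single_apply, ite_smul]
    · have h2 := hw j
      simp [g, Pi.single_apply, ite_smul]
      rw [h2]
      abel
  have h := isSlackLift_of_generators (L := L) (ρ := LinearMap.snd ℝ _ _ ∘ₗ Φ)
    (T := LinearMap.fst ℝ _ _ ∘ₗ Φ) g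
    (fun x => by
      rw [hL, Fintype.sum_sum_type]
      simp [g, α, Pi.single_apply])
    (fun x l => by
      rcases l with l | l <;> simp [g, Pi.single_apply] <;> split_ifs <;> norm_num)
    (fun x => by
      rw [LinearMap.comp_apply, hΦ]
      simpa [hom] using hc x)
    (fun y hy hy0 => by
      obtain ⟨t, ht, rfl⟩ := mem_coneOf_rayVec hy0 ((hL y).1 hy)
      refine coneOf_sum _ fun x _ => coneOf_smul ?_ (ht x (Finset.mem_univ x))
      rcases x with ⟨⟨i | i, hi⟩, ⟨j | j, hj⟩⟩ | ⟨k | k, hk⟩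
      · norm_num [α] at hj
      · rw [rayVec_inl]
        have h := mem_coneOf_univ g (i, j)
        simpa [g, rayWeight, α] using h
      · norm_num [α] at hi
      · norm_num [α] at hi
      · norm_num [α] at hk
      · norm_num [α] at hk)
  have hp : (fun x => ((LinearMap.snd ℝ _ _ ∘ₗ Φ) (g x))⁻¹ • (LinearMap.fst ℝ _ _ ∘ₗ Φ) (g x)) =
      p := by
    funext x
    simp only [LinearMap.comp_apply, hΦ]
    simp [hom, smul_smul, (hc x).ne']
  rw [hp] at h
  exact ⟨_, inferInstance, L, _, _, by simp, h⟩

theorem eq_or_eq_of_isVertexOf_of_mem_segment {N : ℕ} {P : Set (Fin N → ℝ)} {v a b : Fin N → ℝ}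
    (hv : IsVertexOf v P) (ha : a ∈ P) (hb : b ∈ P) (h : v ∈ segment ℝ a b) : v = a ∨ v = b := by
  obtain ⟨ψ, hψ, hvψ⟩ := isFaceOf_iff.1 hv
  have hz : ∀ x ∈ P, ψ (hom x) = 0 → v = x := fun x hx h0 => by
    have : x ∈ ({v} : Set (Fin N → ℝ)) := hvψ ▸ ⟨hx, h0⟩
    exact this.symm
  have h0 : ψ (hom v) = 0 := by
    have h1 : v ∈ ({v} : Set (Fin N → ℝ)) := rfl
    rw [hvψ] at h1
    exact h1.2
  obtain ⟨s, t, hs, ht, hst, rfl⟩ := h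
  have h2 : hom (s • a + t • b) = s • hom a + t • hom b := by
    simp [hom, hst]
  rw [h2, map_add, map_smul, map_smul, smul_eq_mul, smul_eq_mul] at h0
  have h3 := mul_nonneg hs (hψ a ha)
  have h4 := mul_nonneg ht (hψ b hb)
  rcases mul_eq_zero.1 (show s * ψ (hom a) = 0 by linarith) with h5 | h5
  · rcases mul_eq_zero.1 (show t * ψ (hom b) = 0 by linarith) with h6 | h6
    · linarith
    · exact Or.inr (hz b hb h6)
  · exact Or.inl (hz a ha h5)

theorem hom_lineMap {N : ℕ} (a b : Fin N → ℝ) (t : ℝ) :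
    hom (AffineMap.lineMap a b t) = (1 - t) • hom a + t • hom b := by
  rw [AffineMap.lineMap_apply_module]
  simp [hom]

theorem ConcurrentLines.exists_hom {N : ℕ} {a b c d e f : Fin N → ℝ} (hab : a ≠ b)
    (h : ConcurrentLines (affineSpan ℝ {a, b}) (affineSpan ℝ {c, d}) (affineSpan ℝ {e, f})) :
    ∃ w : (Fin N → ℝ) × ℝ, w ≠ 0 ∧ (∃ s t : ℝ, w = s • hom a + t • hom b) ∧
      (∃ s t : ℝ, w = s • hom c + t • hom d) ∧ ∃ s t : ℝ, w = s • hom e + t • hom f := by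
  have hmem : ∀ {x p q : Fin N → ℝ}, x ∈ affineSpan ℝ {p, q} →
      ∃ s t : ℝ, hom x = s • hom p + t • hom q := by
    intro x p q hx
    obtain ⟨t, rfl⟩ := mem_affineSpan_pair_iff_exists_lineMap_eq.1 hx
    exact ⟨_, _, hom_lineMap p q t⟩
  rcases h with ⟨x, h1, h2, h3⟩ | ⟨h1, -, h2⟩
  · refine ⟨hom x, fun h => ?_, hmem h1, hmem h2, hmem h3⟩
    have := congrArg Prod.snd h
    simp [hom] at this
  · have hpar : ∀ {p q : Fin N → ℝ}, AffineSubspace.Parallel (affineSpan ℝ {a, b})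
        (affineSpan ℝ {p, q}) → ∃ s t : ℝ, hom a - hom b = s • hom p + t • hom q := by
      intro p q hpq
      have h3 := AffineSubspace.affineSpan_pair_parallel_iff_vectorSpan_eq.1 hpq
      have h4 : a - b ∈ vectorSpan ℝ {p, q} := by
        rw [← h3]
        exact vsub_mem_vectorSpan ℝ (by simp) (by simp)
      obtain ⟨t, ht⟩ := mem_vectorSpan_pair.1 h4
      refine ⟨t, -t, ?_⟩
      rw [vsub_eq_sub] at ht
      have h5 : hom a - hom b = (a - b, 0) := by simp [hom]
      rw [h5, ← ht]
      simp [hom, sub_eq_add_neg]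
    refine ⟨hom a - hom b, fun h => ?_, ⟨1, -1, by simp [sub_eq_add_neg]⟩, hpar h1, hpar h2⟩
    have := congrArg Prod.fst h
    simp [hom, sub_eq_zero] at this
    exact hab this

/-- The labels of the vertices of a hexagon as seen from three concurrent lines. -/
def hexLabel (x : Fin 2 × Fin 3) : Fin 6 :=
  ![![0, 5, 4], ![1, 2, 3]] x.1 x.2

theorem hexLabel_surjective : Function.Surjective hexLabel := by
  decide

theorem Desarguian.hasLift {N : ℕ} {H : Set (Fin N → ℝ)} (hH : IsPolytope H)
    (hD : Desarguian H) : HasLift H 5 := by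
  obtain ⟨p, ⟨hinj, hrange, hedge⟩, hconc⟩ := hD
  have hpv : ∀ i, IsVertexOf (p i) H := fun i => by
    have : p i ∈ vertexSet H := hrange ▸ mem_range_self i
    exact this
  have hpH : ∀ i, p i ∈ H := fun i => (hpv i).subset rfl
  have hφ : ∀ i, ∃ φ : (Fin N → ℝ) × ℝ →ₗ[ℝ] ℝ, φ (hom (p i)) = 0 ∧ φ (hom (p (i + 1))) = 0 ∧
      ∀ j, j ≠ i → j ≠ i + 1 → 0 < φ (hom (p j)) := by
    intro i
    obtain ⟨φ, hφ, hseg⟩ := isFaceOf_iff.1 (hedge i)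
    have h0 : ∀ x ∈ segment ℝ (p i) (p (i + 1)), φ (hom x) = 0 := fun x hx => by
      rw [hseg] at hx
      exact hx.2
    refine ⟨φ, h0 _ (left_mem_segment ℝ _ _), h0 _ (right_mem_segment ℝ _ _), fun j hj hj' => ?_⟩
    refine lt_of_le_of_ne (hφ _ (hpH j)) fun h => ?_
    have hmem : p j ∈ segment ℝ (p i) (p (i + 1)) := by
      rw [hseg]
      exact ⟨hpH j, h.symm⟩
    rcases eq_or_eq_of_isVertexOf_of_mem_segment (hpv j) (hpH i) (hpH (i + 1)) hmem with h | h
    · exact hj (hinj h)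
    · exact hj' (hinj h)
  have hHp : H = convexHull ℝ (range fun x => p (hexLabel x)) := by
    have h : (range fun x => p (hexLabel x)) = vertexSet H :=
      (hexLabel_surjective.range_comp p).trans hrange
    rw [h]
    exact hH.eq_convexHull_vertexSet
  obtain ⟨φ₀, h00, h01, h0⟩ := hφ 0
  obtain ⟨φ₁, h11, h12, h1⟩ := hφ 1
  obtain ⟨φ₂, h22, h23, h2⟩ := hφ 2
  obtain ⟨φ₃, h33, h34, h3⟩ := hφ 3
  have main : ∀ (w : (Fin N → ℝ) × ℝ) (a0 a1 b0 b1 c0 c1 : ℝ),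
      w = a0 • hom (p 0) - a1 • hom (p 1) → w = b0 • hom (p 5) - b1 • hom (p 2) →
      w = c0 • hom (p 4) - c1 • hom (p 3) → (0 < a0 → HasLift H 5) ∧ (a0 = 0 → w = 0) := by
    intro w a0 a1 b0 b1 c0 c1 ha hb hc
    have key : ∀ φ : (Fin N → ℝ) × ℝ →ₗ[ℝ] ℝ,
        a0 * φ (hom (p 0)) - a1 * φ (hom (p 1)) = b0 * φ (hom (p 5)) - b1 * φ (hom (p 2)) ∧
        b0 * φ (hom (p 5)) - b1 * φ (hom (p 2)) = c0 * φ (hom (p 4)) - c1 * φ (hom (p 3)) := by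
      intro φ
      have h1 := congrArg φ (ha.symm.trans hb)
      have h2 := congrArg φ (hb.symm.trans hc)
      simpa using And.intro h1 h2
    have k0 := key φ₀
    have k1 := key φ₁
    have k2 := key φ₂
    have k3 := key φ₃
    have h01' : φ₀ (hom (p 1)) = 0 := h01
    have h12' : φ₁ (hom (p 2)) = 0 := h12
    have h23' : φ₂ (hom (p 3)) = 0 := h23
    have h34' : φ₃ (hom (p 4)) = 0 := h34
    rw [h00, h01'] at k0
    rw [h11, h12'] at k1
    rw [h22, h23'] at k2
    rw [h33, h34'] at k3
    have q05 := h0 5 (by decide) (by decide)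
    have q02 := h0 2 (by decide) (by decide)
    have q04 := h0 4 (by decide) (by decide)
    have q03 := h0 3 (by decide) (by decide)
    have q30 := h3 0 (by decide) (by decide)
    have q31 := h3 1 (by decide) (by decide)
    have q10 := h1 0 (by decide) (by decide)
    have q15 := h1 5 (by decide) (by decide)
    have q25 := h2 5 (by decide) (by decide)
    have q24 := h2 4 (by decide) (by decide)
    have aux : ∀ {s t x y : ℝ}, 0 < x → 0 < y → 0 < s → s * x = t * y → 0 < t := by
      intro s t x y hx hy hs h
      exact pos_of_mul_pos_left (h ▸ mul_pos hs hx) hy.le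
    constructor
    · intro ha0
      have hb0 : 0 < b0 := aux q10 q15 ha0 (by linarith [k1.1])
      have hc0 : 0 < c0 := aux q25 q24 hb0 (by linarith [k2.2])
      have ha1 : 0 < a1 := aux q30 q31 ha0 (by linarith [k3.1, k3.2])
      have hb1 : 0 < b1 := aux q05 q02 hb0 (by linarith [k0.1])
      have hc1 : 0 < c1 := aux q04 q03 hc0 (by linarith [k0.1, k0.2])
      rw [hHp]
      refine hasLift_of_concurrent _ (fun x => ![![a0, b0, c0], ![a1, b1, c1]] x.1 x.2) ?_ w ?_
      · rintro ⟨i, j⟩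
        fin_cases i <;> fin_cases j <;> simpa
      · intro j
        fin_cases j
        · exact ha
        · exact hb
        · exact hc
    · rintro rfl
      have ha1 : a1 = 0 := by
        have : a1 * φ₃ (hom (p 1)) = 0 := by linarith [k3.1, k3.2]
        exact (mul_eq_zero.1 this).resolve_right q31.ne'
      rw [ha, ha1]
      simp
  obtain ⟨w, hw, ⟨a0, a1, ha⟩, ⟨b0, b1, hb⟩, c1, c0, hc⟩ :=
    hconc.exists_hom (hinj.ne (by decide))
  rcases lt_trichotomy a0 0 with h | h | h
  · refine (main (-w) (-a0) a1 (-b0) b1 (-c0) c1 ?_ ?_ ?_).1 (by linarith)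
    · rw [ha]; module
    · rw [hb]; module
    · rw [hc]; module
  · exfalso
    refine hw ((main w a0 (-a1) b0 (-b1) c0 (-c1) ?_ ?_ ?_).2 h)
    · rw [ha]; module
    · rw [hb]; module
    · rw [hc]; module
  · refine (main w a0 (-a1) b0 (-b1) c0 (-c1) ?_ ?_ ?_).1 h
    · rw [ha]; module
    · rw [hb]; module
    · rw [hc]; module

theorem hasLift_of_desarguian {N d : ℕ} {P H : Set (Fin N → ℝ)} (hdP : pdim P = d)
    (hH : IsHexagon H) (hD : Desarguian H) (h : IsKFoldPyramidOver (d - 2) P H) :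
    HasLift P (d + 3) := by
  have h1 := IsKFoldPyramidOver.hasLift (hD.hasLift hH.1) h
  have h2 := pdim_add_one H
  have h3 := pdim_add_one P
  have h4 := Submodule.finrank_mono (R := ℝ)
    (Submodule.span_mono (image_mono (f := hom) h.base_subset))
  have h5 := hH.2.1
  have h6 : 5 + (d - 2) = d + 3 := by omega
  rwa [h6] at h1

/-! ### Slack lifts on a hyperplane with a one-dimensional kernel -/

/-- The points of the projected polytope below the extreme rays. -/
def rayPoint {ι : Type*} {N : ℕ} (ρ : (ι → ℝ) →ₗ[ℝ] ℝ) (T : (ι → ℝ) →ₗ[ℝ] (Fin N → ℝ))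
    (α : ι → ℝ) (x : RayIndex α) : Fin N → ℝ :=
  (ρ (rayVec α x))⁻¹ • T (rayVec α x)

/-- A slack lift on the hyperplane normal to `α` whose kernel is spanned by `κ`. -/
structure IsKernelLift {ι : Type*} [Fintype ι] {N : ℕ} (P : Set (Fin N → ℝ))
    (L : Submodule ℝ (ι → ℝ)) (ρ : (ι → ℝ) →ₗ[ℝ] ℝ) (T : (ι → ℝ) →ₗ[ℝ] (Fin N → ℝ))
    (α κ : ι → ℝ) : Prop where
  lift : IsSlackLift P L ρ T
  mem_iff : ∀ y, y ∈ L ↔ ∑ l, α l * y l = 0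
  mem : κ ∈ L
  map_eq_zero : T.prod ρ κ = 0
  ker : ∀ y ∈ L, T.prod ρ y = 0 → ∃ t : ℝ, y = t • κ
  exists_pos : ∃ l, 0 < κ l
  exists_neg : ∃ l, κ l < 0

namespace IsKernelLift

variable {ι : Type*} [Fintype ι] {N : ℕ} {P : Set (Fin N → ℝ)}
  {L : Submodule ℝ (ι → ℝ)} {ρ : (ι → ℝ) →ₗ[ℝ] ℝ} {T : (ι → ℝ) →ₗ[ℝ] (Fin N → ℝ)} {α κ : ι → ℝ}

theorem neg_ker (h : IsKernelLift P L ρ T α κ) : IsKernelLift P L ρ T α (-κ) where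
  lift := h.lift
  mem_iff := h.mem_iff
  mem := L.neg_mem h.mem
  map_eq_zero := by rw [map_neg, h.map_eq_zero, neg_zero]
  ker y hy hy0 := by
    obtain ⟨t, rfl⟩ := h.ker y hy hy0
    exact ⟨-t, by simp⟩
  exists_pos := by simpa using h.exists_neg
  exists_neg := by simpa using h.exists_pos

theorem neg_normal (h : IsKernelLift P L ρ T α κ) : IsKernelLift P L ρ T (-α) κ where
  lift := h.lift
  mem_iff y := by simp [h.mem_iff]
  mem := h.mem
  map_eq_zero := h.map_eq_zero
  ker := h.ker
  exists_pos := h.exists_pos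
  exists_neg := h.exists_neg

theorem rayVec_mem (h : IsKernelLift P L ρ T α κ) (x : RayIndex α) : rayVec α x ∈ L := by
  classical
  exact (h.mem_iff _).2 (sum_mul_rayVec x)

theorem rayScale_pos (h : IsKernelLift P L ρ T α κ) (x : RayIndex α) : 0 < ρ (rayVec α x) :=
  h.lift.pos _ (h.rayVec_mem x) (rayVec_nonneg α x) (rayVec_ne_zero x)

theorem map_rayVec (h : IsKernelLift P L ρ T α κ) (x : RayIndex α) :
    T.prod ρ (rayVec α x) = ρ (rayVec α x) • hom (rayPoint ρ T α x) :=
  (h.lift.exists_scale (h.rayVec_mem x) (rayVec_nonneg α x) (rayVec_ne_zero x)).2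

theorem eq_convexHull (h : IsKernelLift P L ρ T α κ) :
    P = convexHull ℝ (range (rayPoint ρ T α)) := by
  classical
  exact h.lift.eq_convexHull_range (rayVec α) h.rayVec_mem (rayVec_nonneg α) rayVec_ne_zero
    fun y hy hy0 => mem_coneOf_rayVec hy0 ((h.mem_iff y).1 hy)

theorem exists_functional (h : IsKernelLift P L ρ T α κ) {φ : (ι → ℝ) →ₗ[ℝ] ℝ} (hφ : φ κ = 0) :
    ∃ ψ : (Fin N → ℝ) × ℝ →ₗ[ℝ] ℝ, ∀ y ∈ L, ψ (T.prod ρ y) = φ y :=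
  exists_descent L (T.prod ρ) φ fun y hy hy0 => by
    obtain ⟨t, rfl⟩ := h.ker y hy hy0
    rw [map_smul, hφ, smul_zero]

theorem exists_functional_rayPoint (h : IsKernelLift P L ρ T α κ) {φ : (ι → ℝ) →ₗ[ℝ] ℝ}
    (hφ : φ κ = 0) : ∃ ψ : (Fin N → ℝ) × ℝ →ₗ[ℝ] ℝ,
      ∀ x, ρ (rayVec α x) * ψ (hom (rayPoint ρ T α x)) = φ (rayVec α x) := by
  obtain ⟨ψ, hψ⟩ := h.exists_functional hφ
  refine ⟨ψ, fun x => ?_⟩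
  rw [← hψ _ (h.rayVec_mem x), h.map_rayVec, map_smul, smul_eq_mul]

/-- If `κ` takes both signs outside `I`, the rays supported in `I` are exposed. -/
theorem exists_exposing (h : IsKernelLift P L ρ T α κ) {I : Set ι} (hpos : ∃ l ∉ I, 0 < κ l)
    (hneg : ∃ l ∉ I, κ l < 0) : ∃ ψ : (Fin N → ℝ) × ℝ →ₗ[ℝ] ℝ,
      ∀ x, 0 ≤ ψ (hom (rayPoint ρ T α x)) ∧
        (ψ (hom (rayPoint ρ T α x)) = 0 ↔ raySupp x ⊆ I) := by
  classical
  let u : ι → ℝ := fun l => if l ∈ I then 0 else max (κ l) 0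
  let v : ι → ℝ := fun l => if l ∈ I then 0 else max (-κ l) 0
  have hu0 : ∀ l, 0 ≤ u l := fun l => by
    simp only [u]
    split_ifs
    · rfl
    · exact le_max_right _ _
  have hv0 : ∀ l, 0 ≤ v l := fun l => by
    simp only [v]
    split_ifs
    · rfl
    · exact le_max_right _ _
  have hu : 0 < ∑ l, u l := by
    obtain ⟨l, hl, hκl⟩ := hpos
    exact Finset.sum_pos' (fun l _ => hu0 l) ⟨l, Finset.mem_univ l, by simp [u, hl, hκl]⟩
  have hv : 0 < ∑ l, v l := by
    obtain ⟨l, hl, hκl⟩ := hneg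
    exact Finset.sum_pos' (fun l _ => hv0 l) ⟨l, Finset.mem_univ l, by simp [v, hl, hκl]⟩
  let c : ι → ℝ := fun l => if l ∈ I then 0 else if 0 < κ l then ∑ l, v l else
    if κ l < 0 then ∑ l, u l else 1
  have hcI : ∀ l ∈ I, c l = 0 := fun l hl => if_pos hl
  have hc : ∀ l ∉ I, 0 < c l := fun l hl => by
    simp only [c, if_neg hl]
    split_ifs
    · exact hv
    · exact hu
    · exact one_pos
  have hcκ : ∑ l, c l * κ l = 0 := by
    have h1 : ∀ l, c l * κ l = (∑ l, v l) * u l - (∑ l, u l) * v l := fun l => by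
      by_cases hl : l ∈ I
      · simp [c, u, v, hl]
      · rcases lt_trichotomy (κ l) 0 with h | h | h
        · have h2 : max (κ l) 0 = 0 := max_eq_right h.le
          have h3 : max (-κ l) 0 = -κ l := max_eq_left (by linarith)
          simp only [c, u, v, if_neg hl, if_neg h.not_gt, if_pos h, h2, h3]
          ring
        · simp [u, v, hl, h]
        · have h2 : max (κ l) 0 = κ l := max_eq_left h.le
          have h3 : max (-κ l) 0 = 0 := max_eq_right (by linarith)
          simp only [c, u, v, if_neg hl, if_pos h, h2, h3]
          ring
    simp only [h1, Finset.sum_sub_distrib, ← Finset.mul_sum]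
    ring
  obtain ⟨ψ, hψ⟩ := h.exists_functional_rayPoint
    (φ := ∑ l, c l • (LinearMap.proj l : (ι → ℝ) →ₗ[ℝ] ℝ)) (by simpa using hcκ)
  have hψ' : ∀ x, ρ (rayVec α x) * ψ (hom (rayPoint ρ T α x)) = ∑ l, c l * rayVec α x l :=
    fun x => by simpa using hψ x
  have hc0 : ∀ l, 0 ≤ c l := fun l => by
    by_cases hl : l ∈ I
    · exact (hcI l hl).ge
    · exact (hc l hl).le
  have hterm : ∀ x l, 0 ≤ c l * rayVec α x l := fun x l => mul_nonneg (hc0 l) (rayVec_nonneg α x l)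
  refine ⟨ψ, fun x => ⟨?_, ?_⟩⟩
  · refine nonneg_of_mul_nonneg_right ?_ (h.rayScale_pos x)
    rw [hψ']
    exact Finset.sum_nonneg fun l _ => hterm x l
  · rw [← mul_eq_zero_iff_left (h.rayScale_pos x).ne', hψ',
      Finset.sum_eq_zero_iff_of_nonneg fun l _ => hterm x l]
    constructor
    · intro h0 l hl
      by_contra hlI
      rcases mul_eq_zero.1 (h0 l (Finset.mem_univ l)) with h1 | h1
      · exact (hc l hlI).ne' h1
      · exact rayVec_eq_zero_iff.1 h1 hl
    · intro hx l _
      by_cases hl : l ∈ raySupp x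
      · rw [hcI l (hx hl), zero_mul]
      · rw [rayVec_eq_zero_iff.2 hl, mul_zero]

/-- If `κ` takes both signs outside the support of a ray, the ray projects to a vertex
and no other ray projects to the same vertex. -/
theorem isVertexOf_rayPoint (h : IsKernelLift P L ρ T α κ) {x : RayIndex α}
    (hpos : ∃ l ∉ raySupp x, 0 < κ l) (hneg : ∃ l ∉ raySupp x, κ l < 0) :
    IsVertexOf (rayPoint ρ T α x) P ∧
      ∀ y, rayPoint ρ T α y = rayPoint ρ T α x → y = x := by
  obtain ⟨ψ, hψ⟩ := h.exists_exposing hpos hneg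
  have h1 := face_convexHull_range (p := rayPoint ρ T α) fun x => (hψ x).1
  have h2 : {y | ψ (hom (rayPoint ρ T α y)) = 0} = {x} := by
    ext y
    rw [mem_ofPred_eq, (hψ y).2, mem_singleton_iff]
    exact ⟨raySupp_injective, fun hy => hy ▸ Subset.rfl⟩
  constructor
  · rw [IsVertexOf, isFaceOf_iff]
    refine ⟨ψ, fun z hz => ?_, ?_⟩
    · rw [h.eq_convexHull] at hz
      exact nonneg_of_mem_convexHull_range (fun x => (hψ x).1) hz
    · rw [h2, ← h.eq_convexHull, image_singleton, convexHull_singleton] at h1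
      exact h1.symm
  · intro y hy
    have h3 : y ∈ {y | ψ (hom (rayPoint ρ T α y)) = 0} := by
      rw [mem_ofPred_eq, hy]
      exact ((hψ x).2).2 Subset.rfl
    rwa [h2] at h3

/-- If all positive coordinates of `κ` lie in the support of a ray but some negative one does not,
the ray does not project injectively to a vertex. -/
theorem exists_rayPoint_eq (h : IsKernelLift P L ρ T α κ) {x : RayIndex α}
    (hpos : ∀ l, 0 < κ l → l ∈ raySupp x) (hneg : ∃ l ∉ raySupp x, κ l < 0)
    (hx : IsVertexOf (rayPoint ρ T α x) P) :
    ∃ y, y ≠ x ∧ rayPoint ρ T α y = rayPoint ρ T α x := by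
  classical
  obtain ⟨k, hkx, hk⟩ := hneg
  obtain ⟨ψ, hψ, hface⟩ := isFaceOf_iff.1 hx
  have hP : ∀ y, rayPoint ρ T α y ∈ P := fun y => by
    rw [h.eq_convexHull]
    exact subset_convexHull ℝ _ (mem_range_self y)
  have hψx : ψ (hom (rayPoint ρ T α x)) = 0 := by
    have h1 : rayPoint ρ T α x ∈ ({rayPoint ρ T α x} : Set _) := rfl
    rw [hface] at h1
    exact h1.2
  obtain ⟨ε, hε0, hε⟩ := exists_pos_forall_mul_le (Finset.univ.filter fun l => l ∈ raySupp x)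
    κ (rayVec α x) (fun l _ => rayVec_nonneg α x l)
    fun l hl h0 => absurd (Finset.mem_filter.1 hl).2 (rayVec_eq_zero_iff.1 h0)
  let y : ι → ℝ := rayVec α x - ε • κ
  have hyL : y ∈ L := L.sub_mem (h.rayVec_mem x) (L.smul_mem ε h.mem)
  have hy0 : ∀ l, 0 ≤ y l := fun l => by
    by_cases hl : l ∈ raySupp x
    · exact sub_nonneg.2 (hε l (Finset.mem_filter.2 ⟨Finset.mem_univ l, hl⟩))
    · have h1 : κ l ≤ 0 := not_lt.1 fun h1 => hl (hpos l h1)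
      simp only [y, Pi.sub_apply, Pi.smul_apply, smul_eq_mul, rayVec_eq_zero_iff.2 hl, zero_sub]
      exact neg_nonneg.2 (mul_nonpos_of_nonneg_of_nonpos hε0.le h1)
  have hyk : y k ≠ 0 := by
    simp only [y, Pi.sub_apply, Pi.smul_apply, smul_eq_mul, rayVec_eq_zero_iff.2 hkx, zero_sub]
    exact neg_ne_zero.2 (mul_ne_zero hε0.ne' hk.ne)
  have hψy : ψ (T.prod ρ y) = 0 := by
    rw [map_sub, map_smul, h.map_eq_zero, smul_zero, sub_zero, h.map_rayVec, map_smul, hψx,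
      smul_zero]
  obtain ⟨c, hc, hcy⟩ := mem_coneOf_rayVec hy0 ((h.mem_iff y).1 hyL)
  have hψz : ∀ z, 0 ≤ c z * (ρ (rayVec α z) * ψ (hom (rayPoint ρ T α z))) := fun z =>
    mul_nonneg (hc z (Finset.mem_univ z)) (mul_nonneg (h.rayScale_pos z).le (hψ _ (hP z)))
  have hsum : ∑ z, c z * (ρ (rayVec α z) * ψ (hom (rayPoint ρ T α z))) = 0 := by
    refine Eq.trans ?_ hψy
    rw [← hcy, map_sum, map_sum]
    refine Finset.sum_congr rfl fun z _ => ?_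
    rw [map_smul, map_smul, h.map_rayVec, map_smul, smul_eq_mul, smul_eq_mul]
  rw [← hcy, Finset.sum_apply] at hyk
  obtain ⟨z, -, hz⟩ := Finset.exists_ne_zero_of_sum_ne_zero hyk
  rw [Pi.smul_apply, smul_eq_mul] at hz
  refine ⟨z, ?_, ?_⟩
  · rintro rfl
    exact right_ne_zero_of_mul hz (rayVec_eq_zero_iff.2 hkx)
  · have h1 := (Finset.sum_eq_zero_iff_of_nonneg fun z _ => hψz z).1 hsum z (Finset.mem_univ z)
    have h2 : ψ (hom (rayPoint ρ T α z)) = 0 := by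
      simpa [left_ne_zero_of_mul hz, (h.rayScale_pos z).ne'] using h1
    have h3 : rayPoint ρ T α z ∈ ({rayPoint ρ T α x} : Set _) := by
      rw [hface]
      exact ⟨hP z, h2⟩
    exact h3

end IsKernelLift

namespace IsKernelLift

variable {ι : Type*} [Fintype ι] {N : ℕ} {P : Set (Fin N → ℝ)}
  {L : Submodule ℝ (ι → ℝ)} {ρ : (ι → ℝ) →ₗ[ℝ] ℝ} {T : (ι → ℝ) →ₗ[ℝ] (Fin N → ℝ)} {α κ : ι → ℝ}

theorem exists_prism (h : IsKernelLift P L ρ T α κ) {a : Fin 2 → {l // 0 < α l}}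
    {b : Fin 3 → {l // α l < 0}} (ha : Function.Injective a) (hb : Function.Injective b) {m : ι}
    (hm : κ m ≠ 0) (hma : ∀ i, m ≠ a i) (hmb : ∀ j, m ≠ b j)
    (hvert : ∀ x : Fin 2 × Fin 3, IsVertexOf (rayPoint ρ T α (Sum.inl (a x.1, b x.2))) P)
    (hinj : Function.Injective fun x : Fin 2 × Fin 3 => rayPoint ρ T α (Sum.inl (a x.1, b x.2))) :
    ∃ S : Finset (Fin N → ℝ), (S : Set (Fin N → ℝ)) ⊆ vertexSet P ∧ S.card = 6 ∧
      CombEquiv (convexHull ℝ (S : Set (Fin N → ℝ))) (prodP 1 2) := by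
  classical
  have hab : ∀ i j, (a i).1 ≠ (b j).1 := fun i j hij => by
    have h1 := (a i).2
    rw [hij] at h1
    exact lt_asymm h1 (b j).2
  have hpr : IsPrismFamily fun x : Fin 2 × Fin 3 => rayPoint ρ T α (Sum.inl (a x.1, b x.2)) := by
    refine ⟨fun x => ρ (rayVec α (Sum.inl (a x.1, b x.2))), fun x => h.rayScale_pos _,
      fun ψ => ⟨fun i => ψ (T.prod ρ (Pi.single (a i).1 (rayWeight α (a i)))),
        fun j => ψ (T.prod ρ (Pi.single (b j).1 (rayWeight α (b j)))), fun x => ?_⟩,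
      fun s t => ?_⟩
    · rw [← map_add, ← map_add, ← rayVec_inl, h.map_rayVec, map_smul, smul_eq_mul]
    · let φ₀ : (ι → ℝ) →ₗ[ℝ] ℝ :=
        ∑ i, (s i / rayWeight α (a i)) • LinearMap.proj (a i).1 +
          ∑ j, (t j / rayWeight α (b j)) • LinearMap.proj (b j).1
      obtain ⟨ψ, hψ⟩ := h.exists_functional_rayPoint
        (φ := φ₀ - (φ₀ κ / κ m) • (LinearMap.proj m : (ι → ℝ) →ₗ[ℝ] ℝ)) (by simp [hm])
      refine ⟨ψ, fun x => ?_⟩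
      rw [hψ]
      have h1 : rayVec α (Sum.inl (a x.1, b x.2)) m = 0 := by
        simp [rayVec_inl, hma, hmb]
      have h2 : ∀ i, rayVec α (Sum.inl (a x.1, b x.2)) (a i) =
          if i = x.1 then rayWeight α (a i) else 0 := fun i => by
        by_cases hi : i = x.1
        · subst hi
          simp [rayVec_inl, hab]
        · simp [rayVec_inl, hab, hi, ← Subtype.ext_iff, ha.eq_iff]
      have h3 : ∀ j, rayVec α (Sum.inl (a x.1, b x.2)) (b j) =
          if j = x.2 then rayWeight α (b j) else 0 := fun j => by
        by_cases hj : j = x.2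
        · subst hj
          simp [rayVec_inl, (hab _ _).symm]
        · simp [rayVec_inl, (hab _ _).symm, hj, ← Subtype.ext_iff, hb.eq_iff]
      simp only [φ₀, LinearMap.sub_apply, LinearMap.add_apply, LinearMap.smul_apply,
        LinearMap.sum_apply, LinearMap.proj_apply, smul_eq_mul, h1, h2, h3, mul_zero, sub_zero,
        mul_ite, Finset.sum_ite_eq', Finset.mem_univ, if_true,
        div_mul_cancel₀ _ (rayWeight_pos α _).ne']
  refine ⟨Finset.univ.image fun x : Fin 2 × Fin 3 => rayPoint ρ T α (Sum.inl (a x.1, b x.2)),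
    ?_, ?_, ?_⟩
  · rw [Finset.coe_image, Finset.coe_univ, image_univ]
    rintro _ ⟨x, rfl⟩
    exact hvert x
  · rw [Finset.card_image_of_injective _ hinj]
    rfl
  · rw [Finset.coe_image, Finset.coe_univ, image_univ]
    exact hpr.combEquiv

end IsKernelLift

/-! ### Iterated pyramids -/

theorem pdim_convexHull {N : ℕ} (X : Set (Fin N → ℝ)) : pdim (convexHull ℝ X) = pdim X := by
  unfold pdim
  rw [affineSpan_convexHull]
  congr 1
  exact propext convexHull_nonempty_iff

theorem pdim_insert {N : ℕ} {X : Set (Fin N → ℝ)} {v : Fin N → ℝ}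
    (hv : hom v ∉ Submodule.span ℝ (hom '' X)) : pdim (insert v X) = pdim X + 1 := by
  have h1 := pdim_add_one (insert v X)
  have h2 := pdim_add_one X
  have hne : hom v ≠ 0 := fun h => hv (h ▸ Submodule.zero_mem _)
  have h3 := Submodule.finrank_sup_add_finrank_inf_eq (Submodule.span ℝ {hom v})
    (Submodule.span ℝ (hom '' X))
  have h4 : Submodule.span ℝ {hom v} ⊓ Submodule.span ℝ (hom '' X) = ⊥ := by
    rw [← disjoint_iff]
    exact (Submodule.disjoint_span_singleton' hne).2 hv |>.symm
  rw [h4, ← Submodule.span_insert, finrank_bot, finrank_span_singleton hne,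
    ← image_insert_eq] at h3
  omega

/-- Points separated by functionals vanishing on `X` span an iterated pyramid over `X`. -/
theorem isKFoldPyramidOver_convexHull {N : ℕ} {Z : Type*} [DecidableEq Z] {X : Set (Fin N → ℝ)}
    (z : Z → Fin N → ℝ) (hz : ∀ m, ∃ ψ : (Fin N → ℝ) × ℝ →ₗ[ℝ] ℝ, ψ (hom (z m)) ≠ 0 ∧
      (∀ x ∈ X, ψ (hom x) = 0) ∧ ∀ k, k ≠ m → ψ (hom (z k)) = 0) (s : Finset Z) :
    IsKFoldPyramidOver s.card (convexHull ℝ (X ∪ z '' s)) (convexHull ℝ X) ∧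
      pdim (convexHull ℝ (X ∪ z '' s)) = pdim (convexHull ℝ X) + s.card := by
  induction s using Finset.induction with
  | empty => simp [IsKFoldPyramidOver]
  | insert m s hm ih =>
    obtain ⟨ψ, hψm, hψX, hψs⟩ := hz m
    have hins : X ∪ z '' (insert m s : Finset Z) = insert (z m) (X ∪ z '' s) := by
      rw [Finset.coe_insert, image_insert_eq, union_insert]
    have hnot : hom (z m) ∉ Submodule.span ℝ (hom '' (X ∪ z '' s)) := fun hmem => by
      refine hψm ((Submodule.span_le (p := LinearMap.ker ψ)).2 ?_ hmem)
      rintro _ ⟨x, hx | ⟨k, hk, rfl⟩, rfl⟩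
      · exact hψX x hx
      · exact hψs k fun hkm => hm (hkm ▸ hk)
    rw [hins, Finset.card_insert_of_notMem hm]
    refine ⟨⟨_, ⟨z m, fun hmem => ?_, ?_⟩, ih.1⟩, ?_⟩
    · rw [affineSpan_convexHull] at hmem
      exact hnot (hom_mem_span_of_mem_affineSpan hmem)
    · rw [insert_eq, union_comm]
      exact (convexHull_convexHull_union_left _ _).symm
    · rw [pdim_convexHull, pdim_insert hnot, ← pdim_convexHull, ih.2]
      push_cast
      ring

theorem affineSpan_pair_parallel_of_sub_eq_smul {N : ℕ} {a b c d : Fin N → ℝ} {s t : ℝ} (hs : s ≠ 0)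
    (ht : t ≠ 0) (h : s • (a - b) = t • (c - d)) :
    AffineSubspace.Parallel (affineSpan ℝ {a, b}) (affineSpan ℝ {c, d}) := by
  rw [AffineSubspace.affineSpan_pair_parallel_iff_vectorSpan_eq, vectorSpan_pair,
    vectorSpan_pair, vsub_eq_sub, vsub_eq_sub,
    ← Submodule.span_singleton_smul_eq hs.isUnit, h, Submodule.span_singleton_smul_eq ht.isUnit]

theorem concurrentLines_of_hom {N : ℕ} {p : Fin 2 × Fin 3 → Fin N → ℝ} {c : Fin 2 × Fin 3 → ℝ}
    (hc : ∀ x, 0 < c x) {w : (Fin N → ℝ) × ℝ}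
    (hw : ∀ j, w = c (0, j) • hom (p (0, j)) - c (1, j) • hom (p (1, j))) :
    ConcurrentLines (affineSpan ℝ {p (0, 1), p (1, 1)}) (affineSpan ℝ {p (0, 0), p (1, 0)})
      (affineSpan ℝ {p (1, 2), p (0, 2)}) := by
  have h1 : ∀ j, w.1 = c (0, j) • p (0, j) - c (1, j) • p (1, j) := fun j =>
    congrArg Prod.fst (hw j)
  have h2 : ∀ j, w.2 = c (0, j) - c (1, j) := fun j => by
    have := congrArg Prod.snd (hw j)
    simpa [hom] using this
  rw [pair_comm (p (1, 2))]
  by_cases h0 : w.2 = 0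
  · have h3 : ∀ j, c (0, j) • (p (0, j) - p (1, j)) = w.1 := fun j => by
      have h4 : c (1, j) = c (0, j) := by linarith [h2 j]
      rw [h1 j, h4, smul_sub]
    have hpar : ∀ i j, AffineSubspace.Parallel (affineSpan ℝ {p (0, i), p (1, i)})
        (affineSpan ℝ {p (0, j), p (1, j)}) := fun i j =>
      affineSpan_pair_parallel_of_sub_eq_smul (hc (0, i)).ne' (hc (0, j)).ne'
        ((h3 i).trans (h3 j).symm)
    exact Or.inr ⟨hpar _ _, hpar _ _, hpar _ _⟩
  · have hmem : ∀ j, w.2⁻¹ • w.1 ∈ affineSpan ℝ {p (0, j), p (1, j)} := fun j => by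
      have h3 : w.2⁻¹ • w.1 = AffineMap.lineMap (p (0, j)) (p (1, j)) (-(w.2⁻¹ * c (1, j))) := by
        have h4 : 1 - -(w.2⁻¹ * c (1, j)) = w.2⁻¹ * c (0, j) := by
          have h5 := h2 j
          field_simp
          linarith
        rw [AffineMap.lineMap_apply_module, h4, h1 j]
        module
      rw [h3]
      exact AffineMap.lineMap_mem_affineSpan_pair _ _ _
    exact Or.inl ⟨_, hmem 1, hmem 0, hmem 2⟩

/-- A cyclic order on the vertices of a hexagon obtained by projecting a triangular prism. -/
def hexCycle : Fin 6 → Fin 2 × Fin 3 :=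
  ![(0, 1), (1, 1), (1, 0), (1, 2), (0, 2), (0, 0)]

theorem hexCycle_bijective : Function.Bijective hexCycle := by
  decide

namespace IsKernelLift

variable {ι : Type*} [Fintype ι] {N : ℕ} {P : Set (Fin N → ℝ)}
  {L : Submodule ℝ (ι → ℝ)} {ρ : (ι → ℝ) →ₗ[ℝ] ℝ} {T : (ι → ℝ) →ₗ[ℝ] (Fin N → ℝ)} {α κ : ι → ℝ}

theorem isFaceOf_segment (h : IsKernelLift P L ρ T α κ) {a : Fin 2 → {l // 0 < α l}}
    {b : Fin 3 → {l // α l < 0}} (ha : Function.Injective a) (hb : Function.Injective b)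
    (s : Finset (Fin 2)) (t : Finset (Fin 3)) {u v : Fin 2 × Fin 3}
    (huv : ∀ x : Fin 2 × Fin 3, x.1 ∈ s ∧ x.2 ∈ t ↔ x = u ∨ x = v)
    (hpos : ∃ j ∉ t, 0 < κ (b j)) (hneg : (∃ i ∉ s, κ (a i) < 0) ∨ ∃ j ∉ t, κ (b j) < 0) :
    IsFaceOf (segment ℝ (rayPoint ρ T α (Sum.inl (a u.1, b u.2)))
        (rayPoint ρ T α (Sum.inl (a v.1, b v.2))))
      (convexHull ℝ (range fun x : Fin 2 × Fin 3 => rayPoint ρ T α (Sum.inl (a x.1, b x.2)))) := by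
  have hab : ∀ i j, (a i).1 ≠ (b j).1 := fun i j hij => by
    have h1 := (a i).2
    rw [hij] at h1
    exact lt_asymm h1 (b j).2
  let I : Set ι := {l | (∃ i ∈ s, (a i).1 = l) ∨ ∃ j ∈ t, (b j).1 = l}
  have hIa : ∀ i, (a i).1 ∈ I ↔ i ∈ s := fun i => by
    constructor
    · rintro (⟨k, hk, hki⟩ | ⟨k, hk, hki⟩)
      · exact ha (Subtype.ext hki) ▸ hk
      · exact absurd hki.symm (hab i k)
    · exact fun hi => Or.inl ⟨i, hi, rfl⟩
  have hIb : ∀ j, (b j).1 ∈ I ↔ j ∈ t := fun j => by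
    constructor
    · rintro (⟨k, hk, hkj⟩ | ⟨k, hk, hkj⟩)
      · exact absurd hkj (hab k j)
      · exact hb (Subtype.ext hkj) ▸ hk
    · exact fun hj => Or.inr ⟨j, hj, rfl⟩
  obtain ⟨ψ, hψ⟩ := h.exists_exposing (I := I)
    (by
      obtain ⟨j, hj, hκ⟩ := hpos
      exact ⟨b j, fun h => hj ((hIb j).1 h), hκ⟩)
    (by
      rcases hneg with ⟨i, hi, hκ⟩ | ⟨j, hj, hκ⟩
      · exact ⟨a i, fun h => hi ((hIa i).1 h), hκ⟩
      · exact ⟨b j, fun h => hj ((hIb j).1 h), hκ⟩)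
  have hexp : IsExposedIndex
      (fun x : Fin 2 × Fin 3 => rayPoint ρ T α (Sum.inl (a x.1, b x.2))) {u, v} := by
    refine ⟨ψ, fun x => ⟨(hψ _).1, (hψ _).2.trans ?_⟩⟩
    rw [mem_insert_iff, mem_singleton_iff, ← huv, ← hIa, ← hIb]
    exact pair_subset_iff
  have h1 := hexp.isFaceOf.1
  rwa [image_pair, convexHull_pair] at h1

theorem exists_hexagon (h : IsKernelLift P L ρ T α κ) {d : ℕ} (hdP : pdim P = d) (hd : 2 ≤ d)
    (hZ : Fintype.card {l // α l = 0} = d - 2) {a : Fin 2 → {l // 0 < α l}}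
    {b : Fin 3 → {l // α l < 0}} (ha : Function.Bijective a) (hb : Function.Bijective b)
    (ha0 : κ (a 0) < 0) (ha1 : κ (a 1) < 0) (hb0 : κ (b 0) < 0) (hb1 : 0 < κ (b 1))
    (hb2 : 0 < κ (b 2)) (hκZ : ∀ k, α k = 0 → κ k = 0)
    (hvert : ∀ x : Fin 2 × Fin 3, IsVertexOf (rayPoint ρ T α (Sum.inl (a x.1, b x.2))) P)
    (hinj : Function.Injective fun x : Fin 2 × Fin 3 => rayPoint ρ T α (Sum.inl (a x.1, b x.2))) :
    ∃ H : Set (Fin N → ℝ), IsHexagon H ∧ Desarguian H ∧ IsKFoldPyramidOver (d - 2) P H := by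
  classical
  set q : Fin 2 × Fin 3 → Fin N → ℝ := fun x => rayPoint ρ T α (Sum.inl (a x.1, b x.2)) with hq
  have hPq : P = convexHull ℝ (range q ∪
      (fun k => rayPoint ρ T α (Sum.inr k)) '' (Finset.univ : Finset {l // α l = 0})) := by
    rw [h.eq_convexHull]
    congr 1
    apply Subset.antisymm
    · rintro _ ⟨⟨i, j⟩ | k, rfl⟩
      · obtain ⟨i, rfl⟩ := ha.2 i
        obtain ⟨j, rfl⟩ := hb.2 j
        exact Or.inl ⟨(i, j), rfl⟩
      · exact Or.inr ⟨k, by simp, rfl⟩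
    · rintro _ (⟨x, rfl⟩ | ⟨k, -, rfl⟩)
      · exact mem_range_self _
      · exact mem_range_self _
  have hpyr := isKFoldPyramidOver_convexHull (X := range q)
    (fun k : {l // α l = 0} => rayPoint ρ T α (Sum.inr k)) (fun m => by
      obtain ⟨ψ, hψ⟩ := h.exists_functional_rayPoint
        (φ := (LinearMap.proj m.1 : (ι → ℝ) →ₗ[ℝ] ℝ)) (hκZ m.1 m.2)
      have hz : ∀ x, m.1 ∉ raySupp x → ψ (hom (rayPoint ρ T α x)) = 0 := fun x hx => by
        have h1 := hψ x
        rw [LinearMap.proj_apply, rayVec_eq_zero_iff.2 hx] at h1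
        exact (mul_eq_zero.1 h1).resolve_left (h.rayScale_pos x).ne'
      refine ⟨ψ, fun h0 => ?_, ?_, fun k hk => hz _ fun hmk => hk (Subtype.ext ?_)⟩
      · have h1 := hψ (Sum.inr m)
        rw [h0, mul_zero, LinearMap.proj_apply] at h1
        exact rayVec_eq_zero_iff.1 h1.symm rfl
      · rintro _ ⟨x, rfl⟩
        refine hz _ ?_
        rintro (h1 | h1)
        · exact (a x.1).2.ne' ((congrArg α h1).symm.trans m.2)
        · exact (b x.2).2.ne ((congrArg α h1).symm.trans m.2)
      · exact Eq.symm hmk) Finset.univ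
  rw [← hPq, Finset.card_univ, hZ] at hpyr
  have hsub : convexHull ℝ (range q) ⊆ P := by
    rw [hPq]
    exact convexHull_mono subset_union_left
  have hverts : vertexSet (convexHull ℝ (range q)) = range q := by
    refine Subset.antisymm (vertexSet_convexHull_range_subset q) ?_
    rintro _ ⟨x, rfl⟩
    have h1 := hvert x
    have hqx : q x ∈ convexHull ℝ (range q) := subset_convexHull ℝ _ (mem_range_self x)
    simp only [vertexSet, mem_ofPred_eq, IsVertexOf, isFaceOf_iff] at h1 ⊢
    obtain ⟨ψ, hψ, hface⟩ := h1
    refine ⟨ψ, fun z hz => hψ z (hsub hz), ?_⟩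
    ext z
    constructor
    · rintro rfl
      have h2 : q x ∈ ({q x} : Set (Fin N → ℝ)) := rfl
      rw [hface] at h2
      exact ⟨hqx, h2.2⟩
    · rintro ⟨hz, hz0⟩
      have h2 : z ∈ ({q x} : Set (Fin N → ℝ)) := hface ▸ ⟨hsub hz, hz0⟩
      exact h2
  refine ⟨convexHull ℝ (range q), ⟨⟨Finset.univ.image q, by simp⟩, ?_, ?_⟩, ?_, hpyr.1⟩
  · have h1 := hpyr.2
    omega
  · rw [vertexCount, hverts, ← image_univ, ncard_image_of_injective _ hinj, ncard_univ]
    simp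
  · refine ⟨q ∘ hexCycle, ⟨hinj.comp hexCycle_bijective.1, ?_, ?_⟩, ?_⟩
    · rw [hverts, hexCycle_bijective.2.range_comp]
    · intro i
      fin_cases i
      · exact h.isFaceOf_segment ha.1 hb.1 {0, 1} {1} (u := (0, 1)) (v := (1, 1)) (by decide)
          ⟨2, by decide, hb2⟩ (Or.inr ⟨0, by decide, hb0⟩)
      · exact h.isFaceOf_segment ha.1 hb.1 {1} {0, 1} (u := (1, 1)) (v := (1, 0)) (by decide)
          ⟨2, by decide, hb2⟩ (Or.inl ⟨0, by decide, ha0⟩)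
      · exact h.isFaceOf_segment ha.1 hb.1 {1} {0, 2} (u := (1, 0)) (v := (1, 2)) (by decide)
          ⟨1, by decide, hb1⟩ (Or.inl ⟨0, by decide, ha0⟩)
      · exact h.isFaceOf_segment ha.1 hb.1 {0, 1} {2} (u := (1, 2)) (v := (0, 2)) (by decide)
          ⟨1, by decide, hb1⟩ (Or.inr ⟨0, by decide, hb0⟩)
      · exact h.isFaceOf_segment ha.1 hb.1 {0} {0, 2} (u := (0, 2)) (v := (0, 0)) (by decide)
          ⟨1, by decide, hb1⟩ (Or.inl ⟨1, by decide, ha1⟩)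
      · exact h.isFaceOf_segment ha.1 hb.1 {0} {0, 1} (u := (0, 0)) (v := (0, 1)) (by decide)
          ⟨2, by decide, hb2⟩ (Or.inl ⟨1, by decide, ha1⟩)
    · refine concurrentLines_of_hom (p := q)
        (c := fun x => ρ (rayVec α (Sum.inl (a x.1, b x.2)))) (fun x => h.rayScale_pos _)
        (w := T.prod ρ (Pi.single (a 0).1 (rayWeight α (a 0)) -
          Pi.single (a 1).1 (rayWeight α (a 1)))) fun j => ?_
      simp only [hq]
      rw [← h.map_rayVec, ← h.map_rayVec, ← map_sub, rayVec_inl, rayVec_inl,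
        add_sub_add_right_eq_sub]

end IsKernelLift

/-! ### The forward direction -/

theorem ncard_raySupp_le {ι : Type*} {α : ι → ℝ} (x : RayIndex α) : (raySupp x).ncard ≤ 2 := by
  rcases x with x | x
  · exact (ncard_insert_le _ _).trans (by rw [ncard_singleton])
  · exact (ncard_singleton _).trans_le one_le_two

theorem card_pos_add_card_neg_add_card_zero {ι : Type*} [Fintype ι] (f : ι → ℝ) :
    Nat.card {l // 0 < f l} + Nat.card {l // f l < 0} + Nat.card {l // f l = 0} =
      Fintype.card ι := by
  have h := sum_eq_sum_sign f fun _ => (1 : ℤ)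
  simp only [Finset.sum_const, nsmul_eq_mul, mul_one, Finset.card_univ] at h
  simp only [Nat.card_eq_fintype_card, Fintype.card_subtype]
  exact_mod_cast h.symm

theorem two_le_sign_counts {p q z d : ℕ} (hsum : p + q + z = d + 3) (hle : d + 4 ≤ z + p * q) :
    2 ≤ p ∧ 2 ≤ q ∧ (3 ≤ p ∨ 3 ≤ q) := by
  have hp : 2 ≤ p := by
    by_contra! h
    interval_cases p <;> omega
  have hq : 2 ≤ q := by
    by_contra! h
    interval_cases q <;> omega
  refine ⟨hp, hq, ?_⟩
  by_contra! h
  obtain rfl : p = 2 := by omega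
  omega

theorem normal_sign_counts {a b z d : ℕ} (hab : a ≤ b) (hsum : a + b + z = d + 3)
    (hle : d + 4 ≤ a * b + z) (hge : a * b + z ≤ d + 5) : a = 2 ∧ (b = 3 ∨ b = 4) := by
  have ha : 2 ≤ a := by
    by_contra! h
    interval_cases a <;> omega
  have ha' : a < 3 := by
    by_contra! h
    nlinarith
  obtain rfl : a = 2 := by omega
  omega

theorem exists_injective_fin_of_le_card {σ : Type*} [Finite σ] {n : ℕ} (h : n ≤ Nat.card σ) :
    ∃ f : Fin n → σ, Function.Injective f :=
  ⟨_, (Finite.equivFin σ).symm.injective.comp (Fin.castLE_injective h)⟩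

theorem injective_bijective_of_card {σ : Type*} [Finite σ] {n : ℕ} {f : Fin n → σ}
    (hf : Function.Injective f) (h : Nat.card σ = n) : Function.Bijective f :=
  (Nat.bijective_iff_injective_and_card f).2 ⟨hf, by simp [h]⟩

namespace IsKernelLift

variable {ι : Type*} [Fintype ι] {N : ℕ} {P : Set (Fin N → ℝ)}
  {L : Submodule ℝ (ι → ℝ)} {ρ : (ι → ℝ) →ₗ[ℝ] ℝ} {T : (ι → ℝ) →ₗ[ℝ] (Fin N → ℝ)} {α κ : ι → ℝ}

theorem exists_neg_notMem_raySupp (hq : 3 ≤ Nat.card {l // κ l < 0}) (x : RayIndex α) :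
    ∃ l ∉ raySupp x, κ l < 0 := by
  by_contra! hcon
  have h1 : {l | κ l < 0} ⊆ raySupp x := fun l hl => by
    by_contra hlx
    exact absurd hl (not_lt.2 (hcon l hlx))
  have h2 := (ncard_le_ncard h1 (toFinite _)).trans (ncard_raySupp_le x)
  exact absurd (hq.trans h2) (by norm_num)

theorem isVertexOf_rayPoint_of_not_subset (h : IsKernelLift P L ρ T α κ)
    (hq : 3 ≤ Nat.card {l // κ l < 0}) {x : RayIndex α} (hx : ¬ {l | 0 < κ l} ⊆ raySupp x) :
    IsVertexOf (rayPoint ρ T α x) P ∧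
      ∀ y, rayPoint ρ T α y = rayPoint ρ T α x → y = x := by
  obtain ⟨l, hl, hlx⟩ := not_subset.1 hx
  exact h.isVertexOf_rayPoint ⟨l, hlx, hl⟩ (exists_neg_notMem_raySupp hq x)

theorem raySupp_eq_of_subset (hp : 2 ≤ Nat.card {l // 0 < κ l}) {x : RayIndex α}
    (hx : {l | 0 < κ l} ⊆ raySupp x) : {l | 0 < κ l} = raySupp x :=
  eq_of_subset_of_ncard_le hx ((ncard_raySupp_le x).trans hp) (toFinite _)

theorem vertexSet_subset_range (h : IsKernelLift P L ρ T α κ) :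
    vertexSet P ⊆ range (rayPoint ρ T α) := by
  rw [h.eq_convexHull]
  exact vertexSet_convexHull_range_subset _

theorem vertexCount_le_card (h : IsKernelLift P L ρ T α κ) :
    vertexCount P ≤ Nat.card (RayIndex α) := by
  refine (ncard_le_ncard h.vertexSet_subset_range (finite_range _)).trans ?_
  rw [← image_univ]
  exact (ncard_image_le finite_univ).trans (ncard_univ _).le

theorem ncard_not_subset_le (h : IsKernelLift P L ρ T α κ) (hq : 3 ≤ Nat.card {l // κ l < 0}) :
    {x : RayIndex α | ¬ {l | 0 < κ l} ⊆ raySupp x}.ncard ≤ vertexCount P :=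
  ncard_le_ncard_of_injOn (rayPoint ρ T α)
    (fun _ hx => (h.isVertexOf_rayPoint_of_not_subset hq hx).1)
    (fun _ _ _ hy hxy => (h.isVertexOf_rayPoint_of_not_subset hq hy).2 _ hxy)
    ((finite_range _).subset h.vertexSet_subset_range)

theorem card_le_vertexCount_add_one (h : IsKernelLift P L ρ T α κ)
    (hp : 2 ≤ Nat.card {l // 0 < κ l}) (hq : 3 ≤ Nat.card {l // κ l < 0}) :
    Nat.card (RayIndex α) ≤ vertexCount P + 1 := by
  have h1 := h.ncard_not_subset_le hq
  have h2 := ncard_add_ncard_compl {x : RayIndex α | ¬ {l | 0 < κ l} ⊆ raySupp x}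
  have h3 : {x : RayIndex α | ¬ {l | 0 < κ l} ⊆ raySupp x}ᶜ.ncard ≤ 1 := by
    refine (ncard_le_one_iff (toFinite _)).2 fun {x y} hx hy => ?_
    simp only [mem_compl_iff, mem_ofPred_eq, not_not] at hx hy
    refine raySupp_injective ?_
    rw [← raySupp_eq_of_subset hp hx]
    exact hy
  omega

theorem exists_subset_raySupp (h : IsKernelLift P L ρ T α κ) (hq : 3 ≤ Nat.card {l // κ l < 0})
    (hX : vertexCount P < Nat.card (RayIndex α)) :
    ∃ x : RayIndex α, {l | 0 < κ l} ⊆ raySupp x := by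
  by_contra! hcon
  have h1 := h.ncard_not_subset_le hq
  have h2 : {x : RayIndex α | ¬ {l | 0 < κ l} ⊆ raySupp x} = univ := eq_univ_of_forall hcon
  rw [h2, ncard_univ] at h1
  omega

theorem injective_and_isVertexOf (h : IsKernelLift P L ρ T α κ)
    (hX : Nat.card (RayIndex α) ≤ vertexCount P) :
    Function.Injective (rayPoint ρ T α) ∧ ∀ x, IsVertexOf (rayPoint ρ T α x) P := by
  have h1 : (range (rayPoint ρ T α)).ncard ≤ Nat.card (RayIndex α) := by
    rw [← image_univ]
    exact (ncard_image_le finite_univ).trans (ncard_univ _).le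
  have h2 := eq_of_subset_of_ncard_le h.vertexSet_subset_range (h1.trans hX) (finite_range _)
  constructor
  · rw [← injOn_univ, ← ncard_image_iff, image_univ, ncard_univ, ← h2]
    exact h.vertexCount_le_card.antisymm hX
  · intro x
    have : rayPoint ρ T α x ∈ vertexSet P := h2 ▸ mem_range_self x
    exact this

/-- If the normal has two positive and four negative coordinates, there is a triangular prism. -/
theorem exists_prism_of_card_four (h : IsKernelLift P L ρ T α κ)
    (hp : 2 ≤ Nat.card {l // 0 < κ l}) (hq : 3 ≤ Nat.card {l // κ l < 0})
    (hX : vertexCount P < Nat.card (RayIndex α)) (hA : Nat.card {l // 0 < α l} = 2)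
    (hB : Nat.card {l // α l < 0} = 4) :
    ∃ S : Finset (Fin N → ℝ), (S : Set (Fin N → ℝ)) ⊆ vertexSet P ∧ S.card = 6 ∧
      CombEquiv (convexHull ℝ (S : Set (Fin N → ℝ))) (prodP 1 2) := by
  obtain ⟨x, hx⟩ := h.exists_subset_raySupp hq hX
  have hxs := raySupp_eq_of_subset hp hx
  obtain ⟨i, j⟩ | k := x
  · have hj : 0 < κ j := by
      have : j.1 ∈ {l | 0 < κ l} := hxs ▸ Or.inr rfl
      exact this
    obtain ⟨a, ha⟩ := exists_injective_fin_of_le_card hA.ge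
    have hB' : 3 ≤ Nat.card {l : {l // α l < 0} // l ≠ j} := by
      classical
      rw [Nat.card_eq_fintype_card] at hB ⊢
      rw [Fintype.card_subtype_compl, Fintype.card_subtype_eq, hB]
    obtain ⟨b, hb⟩ := exists_injective_fin_of_le_card hB'
    have hlost : ∀ x : Fin 2 × Fin 3,
        ¬ {l | 0 < κ l} ⊆ raySupp (α := α) (Sum.inl (a x.1, (b x.2).1)) := by
      intro x hx'
      rw [hxs] at hx'
      have := raySupp_injective hx'
      simp only [Sum.inl.injEq, Prod.mk.injEq] at this
      exact (b x.2).2 this.2.symm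
    have hv := fun x => h.isVertexOf_rayPoint_of_not_subset hq (hlost x)
    refine h.exists_prism ha (Subtype.val_injective.comp hb) hj.ne'
      (fun i h0 => ?_) (fun k h0 => (b k).2 (Subtype.ext h0.symm)) (fun x => (hv x).1)
      fun x y hxy => ?_
    · have h1 := (a i).2
      rw [← h0] at h1
      exact h1.not_gt j.2
    · have := (hv y).2 _ hxy
      simp only [Sum.inl.injEq, Prod.mk.injEq] at this
      exact Prod.ext (ha this.1) (hb (Subtype.ext this.2))
  · have h1 : {l | 0 < κ l}.ncard = 1 := by
      rw [hxs]
      exact ncard_singleton k.1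
    have h2 : Nat.card {l // 0 < κ l} = 1 := h1
    omega

/-- If the normal has two positive and three negative coordinates, there is a triangular prism or
a pyramid over a Desarguian hexagon. -/
theorem exists_hexagon_or_prism_of_card_three (h : IsKernelLift P L ρ T α κ) {d : ℕ}
    (hdP : pdim P = d) (hd : 2 ≤ d) (hp : 2 ≤ Nat.card {l // 0 < κ l})
    (hq : 3 ≤ Nat.card {l // κ l < 0}) (hX : Nat.card (RayIndex α) ≤ vertexCount P)
    (hA : Nat.card {l // 0 < α l} = 2) (hB : Nat.card {l // α l < 0} = 3)
    (hZ : Nat.card {l // α l = 0} = d - 2) :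
    (∃ H : Set (Fin N → ℝ), IsHexagon H ∧ Desarguian H ∧ IsKFoldPyramidOver (d - 2) P H) ∨
      ∃ S : Finset (Fin N → ℝ), (S : Set (Fin N → ℝ)) ⊆ vertexSet P ∧ S.card = 6 ∧
        CombEquiv (convexHull ℝ (S : Set (Fin N → ℝ))) (prodP 1 2) := by
  obtain ⟨hinj, hvert⟩ := h.injective_and_isVertexOf hX
  have hlost : ∀ x : RayIndex α, ¬ {l | 0 < κ l} ⊆ raySupp x := fun x hx => by
    obtain ⟨y, hy, hyx⟩ := h.exists_rayPoint_eq hx (exists_neg_notMem_raySupp hq x) (hvert x)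
    exact hy (hinj hyx)
  obtain ⟨a, ha⟩ := exists_injective_fin_of_le_card hA.ge
  obtain ⟨b, hb⟩ := exists_injective_fin_of_le_card hB.ge
  have hinj' : ∀ {a : Fin 2 → {l // 0 < α l}} {b : Fin 3 → {l // α l < 0}},
      Function.Injective a → Function.Injective b →
      Function.Injective fun x : Fin 2 × Fin 3 => rayPoint ρ T α (Sum.inl (a x.1, b x.2)) :=
    fun ha hb x y hxy => by
      have := hinj hxy
      simp only [Sum.inl.injEq, Prod.mk.injEq] at this
      exact Prod.ext (ha this.1) (hb this.2)
  by_cases hκZ : ∀ k, α k = 0 → κ k = 0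
  swap
  · push Not at hκZ
    obtain ⟨k, hk, hκk⟩ := hκZ
    exact Or.inr (h.exists_prism ha hb hκk (fun i h0 => (a i).2.ne' (h0 ▸ hk))
      (fun j h0 => (b j).2.ne (h0 ▸ hk)) (fun x => hvert _) (hinj' ha hb))
  have hab := injective_bijective_of_card ha hA
  have hle : Nat.card {l // α l = 0} ≤ Nat.card {l // κ l = 0} :=
    ncard_le_ncard (s := {l | α l = 0}) (t := {l | κ l = 0}) hκZ (toFinite _)
  have hcα := card_pos_add_card_neg_add_card_zero α
  have hcκ := card_pos_add_card_neg_add_card_zero κ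
  have hZκ : {l | α l = 0} = {l | κ l = 0} :=
    eq_of_subset_of_ncard_le hκZ (show Nat.card {l // κ l = 0} ≤ Nat.card {l // α l = 0} by omega)
      (toFinite _)
  have hκ0 : ∀ l, κ l = 0 → α l = 0 := fun l hl => hZκ.symm.subset hl
  have hp2 : {l | 0 < κ l}.ncard = 2 := show Nat.card {l // 0 < κ l} = 2 by omega
  obtain ⟨u, v, huv, huvs⟩ := ncard_eq_two.1 hp2
  have hu : 0 < κ u := huvs.symm.subset (Or.inl rfl)
  have hv : 0 < κ v := huvs.symm.subset (Or.inr rfl)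
  have hneg : ∀ l, α l ≠ 0 → l ≠ u → l ≠ v → κ l < 0 := fun l hl hlu hlv => by
    refine lt_of_le_of_ne (not_lt.1 fun h0 => ?_) fun h0 => hl (hκ0 l h0)
    rcases huvs.subset h0 with h0 | h0
    exacts [hlu h0, hlv h0]
  rcases lt_trichotomy (α u) 0 with hαu | hαu | hαu
  swap
  · exact absurd (hκZ u hαu) hu.ne'
  · rcases lt_trichotomy (α v) 0 with hαv | hαv | hαv
    swap
    · exact absurd (hκZ v hαv) hv.ne'
    · obtain ⟨w, hw⟩ : ∃ w : {l // α l < 0}, w ∉ ({⟨u, hαu⟩, ⟨v, hαv⟩} : Set _) := by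
        by_contra! hcon
        have h1 := eq_univ_of_forall hcon
        have h2 := ncard_univ {l // α l < 0}
        rw [← h1, ncard_pair fun h0 => huv (congrArg Subtype.val h0)] at h2
        omega
      rw [mem_insert_iff, mem_singleton_iff, not_or] at hw
      have hb' : Function.Injective ![w, ⟨u, hαu⟩, ⟨v, hαv⟩] := by
        intro i j hij
        fin_cases i <;> fin_cases j
        exacts [rfl, absurd hij hw.1, absurd hij hw.2, absurd hij.symm hw.1, rfl,
          absurd (congrArg Subtype.val hij) huv, absurd hij.symm hw.2,
          absurd (congrArg Subtype.val hij.symm) huv, rfl]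
      have haneg : ∀ i, κ (a i) < 0 := fun i =>
        hneg _ (a i).2.ne' (fun h0 => (h0 ▸ (a i).2).not_gt hαu) fun h0 => (h0 ▸ (a i).2).not_gt hαv
      exact Or.inl (h.exists_hexagon hdP hd (by rw [← hZ, Nat.card_eq_fintype_card]) hab
        (injective_bijective_of_card hb' hB) (haneg 0) (haneg 1)
        (hneg w w.2.ne (fun h0 => hw.1 (Subtype.ext h0)) fun h0 => hw.2 (Subtype.ext h0))
        hu hv hκZ (fun x => hvert _) (hinj' ha hb'))
    · exact absurd huvs.subset fun hs => hlost (Sum.inl (⟨v, hαv⟩, ⟨u, hαu⟩))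
        (hs.trans (pair_comm u v).subset)
  · rcases lt_trichotomy (α v) 0 with hαv | hαv | hαv
    · exact absurd huvs.subset (hlost (Sum.inl (⟨u, hαu⟩, ⟨v, hαv⟩)))
    · exact absurd (hκZ v hαv) hv.ne'
    · have hA' : {u, v} = {l | 0 < α l} := by
        refine eq_of_subset_of_ncard_le ?_ ?_ (toFinite _)
        · rintro l (rfl | rfl)
          exacts [hαu, hαv]
        · rw [ncard_pair huv]
          exact hA.le
      have hnn : ∀ l, 0 ≤ α l * κ l := fun l => by
        rcases lt_trichotomy (α l) 0 with hl | hl | hl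
        · refine (mul_pos_of_neg_of_neg hl (hneg l hl.ne ?_ ?_)).le
          · rintro rfl
            exact hl.not_gt hαu
          · rintro rfl
            exact hl.not_gt hαv
        · rw [hl, zero_mul]
        · have h1 : l ∈ ({u, v} : Set ι) := hA' ▸ hl
          rw [← huvs] at h1
          exact (mul_pos hl h1).le
      have h1 := (Finset.sum_eq_zero_iff_of_nonneg fun l _ => hnn l).1 ((h.mem_iff κ).1 h.mem) u
        (Finset.mem_univ u)
      exact absurd h1 (mul_pos hαu hu).ne'

theorem exists_hexagon_or_prism (h : IsKernelLift P L ρ T α κ) {d : ℕ} (hdP : pdim P = d)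
    (hι : Fintype.card ι = d + 3) (hv : vertexCount P = d + 4)
    (hp : 2 ≤ Nat.card {l // 0 < κ l}) (hq : 3 ≤ Nat.card {l // κ l < 0}) :
    (∃ H : Set (Fin N → ℝ), IsHexagon H ∧ Desarguian H ∧ IsKFoldPyramidOver (d - 2) P H) ∨
      ∃ S : Finset (Fin N → ℝ), (S : Set (Fin N → ℝ)) ⊆ vertexSet P ∧ S.card = 6 ∧
        CombEquiv (convexHull ℝ (S : Set (Fin N → ℝ))) (prodP 1 2) := by
  wlog hab : Nat.card {l // 0 < α l} ≤ Nat.card {l // α l < 0} generalizing α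
  · refine this h.neg_normal ?_
    simpa using (not_le.1 hab).le
  have hle := h.vertexCount_le_card
  have hge := h.card_le_vertexCount_add_one hp hq
  have hX : Nat.card (RayIndex α) = Nat.card {l // 0 < α l} * Nat.card {l // α l < 0} +
      Nat.card {l // α l = 0} := by rw [Nat.card_sum, Nat.card_prod]
  have hcα := card_pos_add_card_neg_add_card_zero α
  obtain ⟨hA, hB | hB⟩ := normal_sign_counts (d := d) (z := Nat.card {l // α l = 0}) hab
    (by omega) (by omega) (by omega)
  · rw [hA, hB] at hX
    exact h.exists_hexagon_or_prism_of_card_three hdP (by omega) hp hq (by omega) hA hB (by omega)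
  · rw [hA, hB] at hX
    exact Or.inr (h.exists_prism_of_card_four hp hq (by omega) hA hB)

end IsKernelLift

theorem exists_hexagon_or_prism_of_xc {N d : ℕ} {P : Set (Fin N → ℝ)} (hP : IsPolytope P)
    (hdP : pdim P = d) (hv : vertexCount P = d + 4) (hf : d + 4 ≤ facetCount P)
    (h : xc P = d + 3) :
    (∃ H : Set (Fin N → ℝ), IsHexagon H ∧ Desarguian H ∧ IsKFoldPyramidOver (d - 2) P H) ∨
      ∃ S : Finset (Fin N → ℝ), (S : Set (Fin N → ℝ)) ⊆ vertexSet P ∧ S.card = 6 ∧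
        CombEquiv (convexHull ℝ (S : Set (Fin N → ℝ))) (prodP 1 2) := by
  obtain ⟨e, G, L, ρ, T, hG, hL, hs⟩ := exists_isSlackLift_of_xc hP
  have hc : Fintype.card G = G.card := by simp
  have hb := hL.finrank_bounds hs hdP (by omega) (by omega)
  obtain ⟨α, -, hα⟩ := Submodule.exists_eq_ker_of_finrank_succ (L := L) (by omega)
  obtain ⟨κ, hκ, hne, hκ0, hker⟩ := hL.exists_kernel hs (by omega)
  obtain ⟨hpos, hneg⟩ := hL.exists_pos_neg hκ hne hκ0
  have hle := hL.facetCount_le hκ hκ0 hker (Or.inr ⟨hpos, hneg⟩)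
  have hcκ := card_pos_add_card_neg_add_card_zero κ
  obtain ⟨hp, hq, hpq⟩ := two_le_sign_counts (d := d) (z := Nat.card {l // κ l = 0}) (by omega) (hf.trans hle)
  have hK : IsKernelLift P L ρ T α κ := ⟨hL, hα, hκ, hκ0, hker, hpos, hneg⟩
  rcases hpq with hp3 | hq3
  · refine hK.neg_ker.exists_hexagon_or_prism hdP (by omega) hv ?_ ?_ <;>
      simpa only [Pi.neg_apply, Left.neg_pos_iff, Left.neg_neg_iff]
  · exact hK.exists_hexagon_or_prism hdP (by omega) hv hp hq3

theorem xc_d_plus_three_characterization (N d : ℕ) (P : Set (Fin N → ℝ))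
    (hP : IsPolytope P) (hdP : pdim P = d)
    (hv : vertexCount P = d + 4) (hf : d + 4 ≤ facetCount P) :
    xc P = d + 3 ↔
      ((∃ H : Set (Fin N → ℝ), IsHexagon H ∧ Desarguian H ∧
          IsKFoldPyramidOver (d - 2) P H) ∨
       (∃ S : Finset (Fin N → ℝ), (S : Set (Fin N → ℝ)) ⊆ vertexSet P ∧ S.card = 6 ∧
          CombEquiv (convexHull ℝ (S : Set (Fin N → ℝ))) (prodP 1 2))) := by
  refine ⟨exists_hexagon_or_prism_of_xc hP hdP hv hf, fun h => ?_⟩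
  have hlift : HasLift P (d + 3) := by
    rcases h with ⟨H, hH, hD, hPH⟩ | ⟨S, hS, hcard, hSP⟩
    · exact hasLift_of_desarguian hdP hH hD hPH
    · exact hasLift_of_prism hP hv hS hcard hSP
  have hne : P.Nonempty := by
    by_contra hcon
    rw [pdim, if_neg hcon] at hdP
    omega
  exact (hlift.xc_le hne).antisymm (le_xc hP hdP hv hf)

end
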